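/- arXiv:1710.01554 — 2 statements merged into one kernel-verified Lean document; each statement's English description precedes it below -/
import Mathlib

section
/- Let (X₁, ..., Xₙ) follow the Curie-Weiss joint law dP_{n,β}, let S_n = X₁ + ... + Xₙ, 𝒳 = σ(X₁,...,Xₙ), and let S_n' be the Gibbs-sampler resampled sum so that (S_n, S_n') is an exchangeable pair. (i) If 0 < β < 1 and there is b > β with ∫ e^{tx} dρ(x) ≤ e^{t²/(2b)} for all real t, then E| E((S_n − S_n')² | 𝒳) − 2 | ≤ C n^{-1/2}. (ii) If β = 1, ρ is of type k with strength λ_ρ > 0, and there are constants b₀ > 0, b₁ > 0, b₂ > 1 with ∫ e^{tx} dρ(x) ≤ exp(t²/2 − b₁ t^{2k}) for |t| ≤ b₀ and ∫ e^{tx} dρ(x) ≤ exp(t²/(2b₂)) for |t| > b₀, then E| E((S_n − S_n')² | 𝒳) − 2 | ≤ C n^{-1/(2k)}. In both cases C is a constant not depending on n. -/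
open MeasureTheory ProbabilityTheory Filter Set

/-- The Curie–Weiss joint law `dP_{n,β}(x) = Zₙ⁻¹ exp(β (x₁+⋯+xₙ)²/(2n)) ∏ᵢ dρ(xᵢ)`. -/
noncomputable def cwMeasure (ρ : Measure ℝ) (β : ℝ) (n : ℕ) : Measure (Fin n → ℝ) :=
  (Measure.pi fun _ : Fin n => ρ).withDensity fun x =>
    ENNReal.ofReal (Real.exp (β * (∑ i, x i) ^ 2 / (2 * n)) /
      ∫ y, Real.exp (β * (∑ i, y i) ^ 2 / (2 * n)) ∂(Measure.pi fun _ : Fin n => ρ))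

/-- The conditional expectation `E(φ(Xᵢ') ∣ 𝒳)` of a function of the Gibbs-resampled
`i`-th coordinate given `𝒳 = σ(X₁,…,Xₙ)`: under the Curie–Weiss law, the conditional
distribution of `Xᵢ'` given the remaining coordinates has density proportional to
`exp(β y²/(2n) + β s y)` w.r.t. `ρ`, where `s = X̄ᵢ = (Sₙ - Xᵢ)/n`. -/
noncomputable def cwCondMoment (ρ : Measure ℝ) (β : ℝ) (n : ℕ) (φ : ℝ → ℝ) (s : ℝ) : ℝ :=
  (∫ y, φ y * Real.exp (β * y ^ 2 / (2 * n) + β * s * y) ∂ρ) /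
    ∫ y, Real.exp (β * y ^ 2 / (2 * n) + β * s * y) ∂ρ

lemma aux_junk (ρ : Measure ℝ) [IsProbabilityMeasure ρ] (β : ℝ) (hβ : 0 < β) (n : ℕ) (hn : 0 < n)
    (h : Integrable (fun y : Fin n → ℝ => Real.exp (β * (∑ i, y i) ^ 2 / (2 * n)))
      (Measure.pi fun _ : Fin n => ρ)) (t : ℝ) : Integrable (fun x => Real.exp (t * x)) ρ := by
  have hn' : (0:ℝ) < n := by exact_mod_cast hn
  have h1 : Integrable (fun y : Fin n → ℝ => Real.exp (t * ∑ i, y i))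
      (Measure.pi fun _ : Fin n => ρ) := by
    refine (h.const_mul (Real.exp (n * t ^ 2 / (2 * β)))).mono'
      (Continuous.aestronglyMeasurable (by fun_prop)) (ae_of_all _ fun y => ?_)
    rw [Real.norm_eq_abs, abs_of_pos (Real.exp_pos _), ← Real.exp_add]
    apply Real.exp_le_exp.2
    set S := ∑ i, y i
    have : n * t ^ 2 / (2 * β) + β * S ^ 2 / (2 * n) - t * S = (n * t - β * S) ^ 2 / (2 * β * n) := by
      field_simp; ring
    have : 0 ≤ (n * t - β * S) ^ 2 / (2 * β * n) := by positivity
    linarith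
  by_contra hc
  have h2 := integral_fintype_prod_eq_pow (ι := Fin n) (μ := ρ) (fun x => Real.exp (t * x))
  rw [integral_undef hc, Fintype.card_fin, zero_pow hn.ne'] at h2
  simp only [← Real.exp_sum, ← Finset.mul_sum] at h2
  exact (integral_exp_pos h1).ne' h2

lemma aux_zero (ρ : Measure ℝ) [IsProbabilityMeasure ρ] (β : ℝ) (hβ : 0 < β) (n : ℕ) (hn : 0 < n)
    (h : ¬ ∀ t : ℝ, Integrable (fun x => Real.exp (t * x)) ρ) : cwMeasure ρ β n = 0 := by
  have : ¬ Integrable (fun y : Fin n → ℝ => Real.exp (β * (∑ i, y i) ^ 2 / (2 * n)))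
      (Measure.pi fun _ : Fin n => ρ) := fun hh => h (aux_junk ρ β hβ n hn hh)
  unfold cwMeasure
  rw [integral_undef this]
  simp

lemma aux_hs (σ S : ℝ) (hσ : 0 < σ) :
    ∫⁻ u : ℝ, ENNReal.ofReal (Real.exp (-σ * u ^ 2 + u * S)) =
      ENNReal.ofReal (√(Real.pi / σ) * Real.exp (S ^ 2 / (4 * σ))) := by
  have e : ∀ u : ℝ, Real.exp (-σ * u ^ 2 + u * S) =
      Real.exp (S ^ 2 / (4 * σ)) * Real.exp (-σ * (u - S / (2 * σ)) ^ 2) := by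
    intro u
    rw [← Real.exp_add]; congr 1; field_simp; ring
  have hi : Integrable (fun u : ℝ => Real.exp (-σ * u ^ 2 + u * S)) := by
    simp_rw [e]
    exact ((integrable_exp_neg_mul_sq hσ).comp_sub_right _).const_mul _
  rw [← ofReal_integral_eq_lintegral_ofReal hi (ae_of_all _ fun u => (Real.exp_pos _).le)]
  simp_rw [e]
  rw [integral_const_mul, integral_sub_right_eq_self (fun u => Real.exp (-σ * u ^ 2)),
    integral_gaussian, mul_comm]

/-- Gaussian integrability. -/
lemma aux_sq (ρ : Measure ℝ) [IsProbabilityMeasure ρ] (b : ℝ) (hb : 0 < b)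
    (hI : ∀ t : ℝ, Integrable (fun x => Real.exp (t * x)) ρ)
    (hm : ∀ t : ℝ, ∫ x, Real.exp (t * x) ∂ρ ≤ Real.exp (t ^ 2 / (2 * b))) :
    Integrable (fun x => Real.exp (b / 4 * x ^ 2)) ρ := by
  refine ⟨Continuous.aestronglyMeasurable (by fun_prop), ?_⟩
  rw [hasFiniteIntegral_iff_ofReal (ae_of_all _ fun u => (Real.exp_pos _).le)]
  have hσ : 0 < 1 / b := by positivity
  have key : ENNReal.ofReal (√(Real.pi / (1 / b))) * ∫⁻ x, ENNReal.ofReal (Real.exp (b / 4 * x ^ 2)) ∂ρ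
      < ⊤ := by
    rw [← lintegral_const_mul _ (by fun_prop)]
    calc _ = ∫⁻ x, (∫⁻ u : ℝ, ENNReal.ofReal (Real.exp (-(1 / b) * u ^ 2 + u * x))) ∂ρ := by
          refine lintegral_congr fun x => ?_
          rw [aux_hs _ _ hσ, ENNReal.ofReal_mul (by positivity)]
          congr 3; field_simp
      _ = ∫⁻ u : ℝ, ∫⁻ x, ENNReal.ofReal (Real.exp (-(1 / b) * u ^ 2 + u * x)) ∂ρ :=
          lintegral_lintegral_swap (by fun_prop)
      _ ≤ ∫⁻ u : ℝ, ENNReal.ofReal (Real.exp (-(1 / (2 * b)) * u ^ 2)) := by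
          refine lintegral_mono fun u => ?_
          simp only [Real.exp_add]
          rw [← ofReal_integral_eq_lintegral_ofReal ((hI u).const_mul _)
            (ae_of_all _ fun x => by positivity), integral_const_mul]
          apply ENNReal.ofReal_le_ofReal
          calc _ ≤ Real.exp (-(1 / b) * u ^ 2) * Real.exp (u ^ 2 / (2 * b)) := by
                gcongr; exact hm u
            _ = _ := by rw [← Real.exp_add]; congr 1; field_simp; ring
      _ < ⊤ := by
          rw [← ofReal_integral_eq_lintegral_ofReal (integrable_exp_neg_mul_sq (by positivity))
            (ae_of_all _ fun x => by positivity)]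
          exact ENNReal.ofReal_lt_top
  refine ENNReal.lt_top_of_mul_ne_top_right key.ne ?_
  simp only [ne_eq, ENNReal.ofReal_eq_zero, not_le]
  positivity

lemma aux_taylor (μ : Measure ℝ) [IsProbabilityMeasure μ]
    (hI : ∀ t : ℝ, Integrable (fun x => Real.exp (t * x)) μ) (N : ℕ) :
    ∃ C : ℝ, 0 ≤ C ∧ ∀ u : ℝ, |u| ≤ 1 →
      |(∫ x, Real.exp (u * x) ∂μ) - ∑ j ∈ Finset.range N, u ^ j / (j.factorial : ℝ) * ∫ x, x ^ j ∂μ|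
        ≤ C * |u| ^ N := by
  have h2 : ∀ t : ℝ, Integrable (fun x => Real.exp (t * |x|)) μ := fun t =>
    integrable_exp_mul_abs (hI t) (hI (-t))
  have hp : ∀ j : ℕ, ∀ y : ℝ, |y| ^ j ≤ j.factorial * Real.exp |y| := by
    intro j y
    have := Real.pow_div_factorial_le_exp |y| (abs_nonneg y) j
    rwa [div_le_iff₀' (by positivity)] at this
  have hmom : ∀ j : ℕ, Integrable (fun x : ℝ => x ^ j) μ := by
    intro j
    refine ((h2 1).const_mul (j.factorial : ℝ)).mono' (by fun_prop) (ae_of_all _ fun x => ?_)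
    rw [Real.norm_eq_abs, abs_pow, one_mul]; exact hp j x
  have hN : Integrable (fun x : ℝ => |x| ^ N * Real.exp |x|) μ := by
    refine ((h2 2).const_mul (N.factorial : ℝ)).mono' (Continuous.aestronglyMeasurable (by fun_prop)) (ae_of_all _ fun x => ?_)
    rw [Real.norm_eq_abs, abs_of_nonneg (by positivity), two_mul, Real.exp_add, ← mul_assoc]
    gcongr; exact hp N x
  refine ⟨∫ x, |x| ^ N * Real.exp |x| ∂μ, integral_nonneg fun x => by positivity, fun u hu => ?_⟩
  have hT : ∀ j : ℕ, Integrable (fun x : ℝ => (u * x) ^ j / (j.factorial : ℝ)) μ := by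
    intro j
    refine ((hmom j).const_mul (u ^ j / (j.factorial : ℝ))).congr (ae_of_all _ fun x => ?_)
    simp only [mul_pow]; ring
  have e : (∫ x, Real.exp (u * x) ∂μ) - ∑ j ∈ Finset.range N, u ^ j / (j.factorial : ℝ) * ∫ x, x ^ j ∂μ
      = ∫ x, (Real.exp (u * x) - ∑ j ∈ Finset.range N, (u * x) ^ j / (j.factorial : ℝ)) ∂μ := by
    rw [integral_sub (hI u), integral_finsetSum]
    · congr 1
      apply Finset.sum_congr rfl; intro j _
      rw [← integral_const_mul]; congr 1; ext x; rw [mul_pow]; ring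
    · intro j _
      exact hT j
    · apply integrable_finsetSum
      intro j _
      exact hT j
  rw [e, mul_comm, ← integral_const_mul, ← Real.norm_eq_abs]
  refine (norm_integral_le_of_norm_le (hN.const_mul (|u| ^ N)) (ae_of_all _ fun x => ?_))
  have h := Complex.norm_exp_sub_sum_le_norm_mul_exp ((u * x : ℝ) : ℂ) N
  have e2 : Complex.exp ((u * x : ℝ) : ℂ) - ∑ m ∈ Finset.range N, ((u * x : ℝ) : ℂ) ^ m / (m.factorial : ℂ)
     = ((Real.exp (u * x) - ∑ j ∈ Finset.range N, (u * x) ^ j / (j.factorial : ℝ) : ℝ) : ℂ) := by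
    push_cast; rfl
  rw [e2, Complex.norm_real, Complex.norm_real, Real.norm_eq_abs (u * x)] at h
  refine h.trans ?_
  rw [abs_mul, mul_pow, mul_assoc]
  gcongr
  nlinarith [abs_nonneg x]

lemma aux_E (ρ : Measure ℝ) [IsProbabilityMeasure ρ] (b : ℝ) (hb : 0 < b)
    (hI : Integrable (fun x => Real.exp (b / 4 * x ^ 2)) ρ) :
    Integrable (fun x => (1 + |x|) ^ 6 * Real.exp (2 * (b / 16) * x ^ 2)) ρ := by
  refine (hI.const_mul (8 * (6 / (b / 8) ^ 3) * Real.exp (b / 8))).mono'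
    (Continuous.aestronglyMeasurable (by fun_prop)) (ae_of_all _ fun x => ?_)
  rw [Real.norm_eq_abs, abs_of_nonneg (by positivity)]
  have h1 : (1 + |x|) ^ 2 ≤ 2 * (1 + x ^ 2) := by
    nlinarith [sq_nonneg (1 - |x|), sq_abs x]
  have h2 : (1 + |x|) ^ 6 ≤ 8 * (1 + x ^ 2) ^ 3 := by
    calc (1 + |x|) ^ 6 = ((1 + |x|) ^ 2) ^ 3 := by ring
      _ ≤ (2 * (1 + x ^ 2)) ^ 3 := by gcongr
      _ = _ := by ring
  have h3 := Real.pow_div_factorial_le_exp (b / 8 * (1 + x ^ 2)) (by positivity) 3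
  have h4 : (1 + x ^ 2) ^ 3 ≤ 6 / (b / 8) ^ 3 * Real.exp (b / 8 * (1 + x ^ 2)) := by
    rw [div_mul_eq_mul_div, le_div_iff₀ (by positivity)]
    rw [div_le_iff₀' (by positivity)] at h3
    norm_num [Nat.factorial] at h3 ⊢
    linarith [h3]
  calc (1 + |x|) ^ 6 * Real.exp (2 * (b / 16) * x ^ 2)
      ≤ (8 * (6 / (b / 8) ^ 3 * Real.exp (b / 8 * (1 + x ^ 2)))) * Real.exp (2 * (b / 16) * x ^ 2) := by
        gcongr; linarith
    _ = _ := by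
        have : Real.exp (b / 8 * (1 + x ^ 2)) * Real.exp (2 * (b / 16) * x ^ 2)
          = Real.exp (b / 8) * Real.exp (b / 4 * x ^ 2) := by
          rw [← Real.exp_add, ← Real.exp_add]; congr 1; ring
        rw [mul_assoc, mul_assoc, this]; ring

lemma aux_exp_le (a u x : ℝ) (ha : 0 < a) :
    Real.exp (|u| * |x|) ≤ Real.exp (u ^ 2 / (4 * a)) * Real.exp (a * x ^ 2) := by
  rw [← Real.exp_add]
  apply Real.exp_le_exp.2
  have : u ^ 2 / (4 * a) + a * x ^ 2 - |u| * |x| = (|u| - 2 * a * |x|) ^ 2 / (4 * a) := by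
    rw [← sq_abs u, ← sq_abs x]; field_simp; ring
  have : 0 ≤ (|u| - 2 * a * |x|) ^ 2 / (4 * a) := by positivity
  linarith

lemma aux_exp_sub (w : ℝ) : |Real.exp w - 1| ≤ |w| * Real.exp |w| := by
  have h := Complex.norm_exp_sub_sum_le_norm_mul_exp (w : ℂ) 1
  have e2 : Complex.exp (w : ℂ) - ∑ m ∈ Finset.range 1, (w : ℂ) ^ m / (m.factorial : ℂ)
     = ((Real.exp w - 1 : ℝ) : ℂ) := by
    push_cast; simp
  rw [e2, Complex.norm_real, Complex.norm_real, pow_one] at h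
  exact h

lemma aux_mom (ρ : Measure ℝ) [IsProbabilityMeasure ρ] (a : ℝ) (ha : 0 < a)
    (hE : Integrable (fun x => (1 + |x|) ^ 6 * Real.exp (2 * a * x ^ 2)) ρ)
    (h : ℝ → ℝ) (hc : Continuous h) (hh : ∀ x, |h x| ≤ 1 + x ^ 2) (h0 : ∫ x, h x ∂ρ = 0) (u : ℝ) :
    Integrable (fun x => h x ^ 2 * Real.exp (u * x)) ρ ∧
    Integrable (fun x => h x * Real.exp (u * x)) ρ ∧
    ∫ x, h x ^ 2 * Real.exp (u * x) ∂ρ ≤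
      (∫ x, (1 + |x|) ^ 6 * Real.exp (2 * a * x ^ 2) ∂ρ) * Real.exp (u ^ 2 / (4 * a)) ∧
    |∫ x, h x * Real.exp (u * x) ∂ρ| ≤
      |u| * ((∫ x, (1 + |x|) ^ 6 * Real.exp (2 * a * x ^ 2) ∂ρ) * Real.exp (u ^ 2 / (4 * a))) := by
  have hh' : ∀ x, |h x| ≤ (1 + |x|) ^ 2 := fun x => (hh x).trans (by
    nlinarith [abs_nonneg x, sq_abs x])
  have ha2 : ∀ x : ℝ, Real.exp (a * x ^ 2) ≤ Real.exp (2 * a * x ^ 2) := fun x => by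
    apply Real.exp_le_exp.2; nlinarith [mul_nonneg ha.le (sq_nonneg x)]
  have hux : ∀ x : ℝ, Real.exp (|u * x|) ≤ Real.exp (u ^ 2 / (4 * a)) * Real.exp (2 * a * x ^ 2) := fun x => by
    rw [abs_mul]
    exact (aux_exp_le a u x ha).trans (mul_le_mul_of_nonneg_left (ha2 x) (Real.exp_pos _).le)
  have one_le : ∀ x : ℝ, 1 ≤ 1 + |x| := fun x => by linarith [abs_nonneg x]
  have b1 : ∀ x, ‖h x ^ 2 * Real.exp (u * x)‖ ≤
      (1 + |x|) ^ 6 * Real.exp (2 * a * x ^ 2) * Real.exp (u ^ 2 / (4 * a)) := by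
    intro x
    rw [norm_mul, norm_pow, Real.norm_eq_abs, Real.norm_eq_abs, abs_of_pos (Real.exp_pos _)]
    calc |h x| ^ 2 * Real.exp (u * x) ≤ ((1 + |x|) ^ 2) ^ 2 *
          (Real.exp (u ^ 2 / (4 * a)) * Real.exp (2 * a * x ^ 2)) := by
          gcongr
          · exact hh' x
          · exact (Real.exp_le_exp.2 (le_abs_self _)).trans (hux x)
      _ = (1 + |x|) ^ 4 * (Real.exp (2 * a * x ^ 2) * Real.exp (u ^ 2 / (4 * a))) := by ring
      _ ≤ (1 + |x|) ^ 6 * (Real.exp (2 * a * x ^ 2) * Real.exp (u ^ 2 / (4 * a))) := by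
          gcongr
          · exact one_le x
          · norm_num
      _ = _ := by ring
  have b2 : ∀ x, ‖h x * (Real.exp (u * x) - 1)‖ ≤
      |u| * ((1 + |x|) ^ 6 * Real.exp (2 * a * x ^ 2) * Real.exp (u ^ 2 / (4 * a))) := by
    intro x
    rw [norm_mul, Real.norm_eq_abs, Real.norm_eq_abs]
    calc |h x| * |Real.exp (u * x) - 1| ≤ (1 + |x|) ^ 2 *
          ((|u| * (1 + |x|)) * (Real.exp (u ^ 2 / (4 * a)) * Real.exp (2 * a * x ^ 2))) := by
          gcongr
          · exact hh' x
          · refine (aux_exp_sub _).trans ?_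
            gcongr
            · rw [abs_mul]; gcongr; linarith [one_le x]
            · exact hux x
      _ = |u| * ((1 + |x|) ^ 3 * (Real.exp (2 * a * x ^ 2) * Real.exp (u ^ 2 / (4 * a)))) := by ring
      _ ≤ |u| * ((1 + |x|) ^ 6 * (Real.exp (2 * a * x ^ 2) * Real.exp (u ^ 2 / (4 * a)))) := by
          gcongr
          · exact one_le x
          · norm_num
      _ = _ := by ring
  have hEE := hE.mul_const (Real.exp (u ^ 2 / (4 * a)))
  have hint : Integrable h ρ := by
    refine hE.mono' hc.aestronglyMeasurable (ae_of_all _ fun x => ?_)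
    rw [Real.norm_eq_abs]
    calc |h x| ≤ (1 + |x|) ^ 2 * 1 := by rw [mul_one]; exact hh' x
      _ ≤ _ := by
        gcongr
        · exact one_le x
        · norm_num
        · apply Real.one_le_exp; positivity
  have i2 : Integrable (fun x => h x * (Real.exp (u * x) - 1)) ρ :=
    (hEE.const_mul |u|).mono' (Continuous.aestronglyMeasurable (by fun_prop)) (ae_of_all _ b2)
  have i1 : Integrable (fun x => h x ^ 2 * Real.exp (u * x)) ρ :=
    hEE.mono' (Continuous.aestronglyMeasurable (by fun_prop)) (ae_of_all _ b1)
  have i3 : Integrable (fun x => h x * Real.exp (u * x)) ρ := by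
    refine (i2.add hint).congr (ae_of_all _ fun x => ?_)
    simp only [Pi.add_apply]; ring
  refine ⟨i1, i3, ?_, ?_⟩
  · rw [← integral_mul_const]
    exact integral_mono i1 hEE fun x => (le_abs_self _).trans (b1 x)
  · have e : ∫ x, h x * Real.exp (u * x) ∂ρ = ∫ x, h x * (Real.exp (u * x) - 1) ∂ρ := by
      simp_rw [mul_sub, mul_one]
      rw [integral_sub i3 hint, h0, sub_zero]
    rw [e, ← integral_mul_const, ← integral_const_mul, ← Real.norm_eq_abs (∫ x, _ ∂ρ)]
    exact norm_integral_le_of_norm_le (hEE.const_mul |u|) (ae_of_all _ b2)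

lemma aux_pi (ρ : Measure ℝ) [IsProbabilityMeasure ρ] (h w : ℝ → ℝ) (n : ℕ)
    (hw : Integrable w ρ) (hhw : Integrable (fun x => h x * w x) ρ)
    (hhhw : Integrable (fun x => h x ^ 2 * w x) ρ) (hw1 : 1 ≤ ∫ x, w x ∂ρ)
    (hw0 : ∀ x, 0 ≤ w x) :
    Integrable (fun x : Fin n → ℝ => (∑ i, h (x i)) ^ 2 * ∏ i, w (x i))
      (Measure.pi fun _ : Fin n => ρ) ∧
    ∫ x : Fin n → ℝ, (∑ i, h (x i)) ^ 2 * ∏ i, w (x i) ∂(Measure.pi fun _ : Fin n => ρ) ≤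
      (∫ x, w x ∂ρ) ^ n * (n * (∫ x, h x ^ 2 * w x ∂ρ) + n ^ 2 * (∫ x, h x * w x ∂ρ) ^ 2) := by
  classical
  set m := ∫ x, w x ∂ρ with hm
  set q2 := ∫ x, h x ^ 2 * w x ∂ρ with hq2
  set q1 := ∫ x, h x * w x ∂ρ with hq1
  have q2nn : 0 ≤ q2 := integral_nonneg fun x => mul_nonneg (sq_nonneg _) (hw0 x)
  -- single factor functions
  let φ : Fin n → Fin n → Fin n → ℝ → ℝ := fun i j l x =>
    (if l = i then h x else 1) * (if l = j then h x else 1) * w x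
  have hφ : ∀ i j l, Integrable (φ i j l) ρ := by
    intro i j l
    by_cases h1 : l = i <;> by_cases h2 : l = j <;> simp only [φ, h1, h2, if_true, if_false, one_mul, mul_one]
    all_goals (try subst h1) 
    all_goals (try subst h2)
    all_goals first
      | simpa [sq] using hhhw
      | simpa using hhw
      | simpa using hw
      | simp_all [sq]
  have hprod : ∀ i j (x : Fin n → ℝ), h (x i) * h (x j) * ∏ l, w (x l) = ∏ l, φ i j l (x l) := by
    intro i j x
    simp only [φ, Finset.prod_mul_distrib, Finset.prod_ite_eq', Finset.mem_univ, if_true]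
  have hexp : ∀ x : Fin n → ℝ, (∑ i, h (x i)) ^ 2 * ∏ i, w (x i) = ∑ i, ∑ j, ∏ l, φ i j l (x l) := by
    intro x
    rw [sq, Finset.sum_mul_sum, Finset.sum_mul]
    refine Finset.sum_congr rfl fun i _ => ?_
    rw [Finset.sum_mul]
    exact Finset.sum_congr rfl fun j _ => hprod i j x
  have hint : ∀ i j, Integrable (fun x : Fin n → ℝ => ∏ l, φ i j l (x l)) (Measure.pi fun _ : Fin n => ρ) :=
    fun i j => Integrable.fintype_prod (hφ i j)
  have hval : ∀ i j, ∫ x : Fin n → ℝ, ∏ l, φ i j l (x l) ∂(Measure.pi fun _ : Fin n => ρ) ≤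
      m ^ n * ((if i = j then q2 else 0) + q1 ^ 2) := by
    intro i j
    rw [integral_fintype_prod_eq_prod]
    by_cases hij : i = j
    · subst hij
      have : ∀ l, ∫ x, φ i i l x ∂ρ = if l = i then q2 else m := by
        intro l
        by_cases hl : l = i <;> simp [φ, hl, sq, hq2, hm]
      simp_rw [this]
      rw [← Finset.mul_prod_erase _ _ (Finset.mem_univ i)]
      have e : ∏ x ∈ Finset.univ.erase i, (if x = i then q2 else m) = m ^ (n - 1) := by
        rw [Finset.prod_congr rfl (g := fun _ => m), Finset.prod_const, Finset.card_erase_of_mem (Finset.mem_univ _)]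
        · simp
        · intro x hx; simp [(Finset.mem_erase.1 hx).1]
      rw [e]; simp only [if_true]
      have : m ^ (n - 1) ≤ m ^ n := pow_le_pow_right₀ hw1 (by omega)
      have h3 : 0 ≤ m ^ n * q1 ^ 2 := by positivity
      nlinarith
    · have : ∀ l, ∫ x, φ i j l x ∂ρ = if l = i then q1 else if l = j then q1 else m := by
        intro l
        by_cases hl : l = i
        · subst hl; simp [φ, hij, hq1]
        · by_cases hl2 : l = j <;> simp [φ, hl, hl2, hq1, hm]
          subst hl2; simp [hl]
      simp_rw [this]
      rw [← Finset.mul_prod_erase _ _ (Finset.mem_univ i), 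
        ← Finset.mul_prod_erase _ _ (Finset.mem_erase.2 ⟨Ne.symm hij, Finset.mem_univ j⟩)]
      have e : ∏ x ∈ (Finset.univ.erase i).erase j, (if x = i then q1 else if x = j then q1 else m)
          = m ^ (n - 2) := by
        rw [Finset.prod_congr rfl (g := fun _ => m), Finset.prod_const, Finset.card_erase_of_mem
          (Finset.mem_erase.2 ⟨Ne.symm hij, Finset.mem_univ j⟩), Finset.card_erase_of_mem (Finset.mem_univ _)]
        · simp; congr 1
        · intro x hx
          simp only [Finset.mem_erase] at hx
          simp [hx.1, hx.2.1]
      rw [e]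
      simp only [if_true, if_neg hij, if_neg (Ne.symm hij)]
      have : m ^ (n - 2) ≤ m ^ n := pow_le_pow_right₀ hw1 (by omega)
      nlinarith [sq_nonneg q1]
  simp_rw [hexp]
  refine ⟨integrable_finsetSum _ fun i _ => integrable_finsetSum _ fun j _ => hint i j, ?_⟩
  rw [integral_finsetSum _ fun i _ => integrable_finsetSum _ fun j _ => hint i j]
  have : ∀ i ∈ Finset.univ, ∫ x : Fin n → ℝ, ∑ j, ∏ l, φ i j l (x l) ∂(Measure.pi fun _ : Fin n => ρ) =
      ∑ j, ∫ x : Fin n → ℝ, ∏ l, φ i j l (x l) ∂(Measure.pi fun _ : Fin n => ρ) :=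
    fun i _ => integral_finsetSum _ fun j _ => hint i j
  rw [Finset.sum_congr rfl this]
  refine (Finset.sum_le_sum fun i _ => Finset.sum_le_sum fun j _ => hval i j).trans (le_of_eq ?_)
  simp only [← Finset.mul_sum, Finset.sum_add_distrib, Finset.sum_ite_eq, Finset.mem_univ, if_true,
    Finset.sum_const, Finset.card_univ, Fintype.card_fin, nsmul_eq_mul]
  ring

set_option maxHeartbeats 1000000 in
lemma aux_fg (ρ : Measure ℝ) [IsProbabilityMeasure ρ]
    (hmean : ∫ x, x ∂ρ = 0) (hvar : ∫ x, x ^ 2 ∂ρ = 1) (β : ℝ) (hβ : 0 < β) (hβ1 : β ≤ 1)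
    (a : ℝ) (ha : 0 < a)
    (hE : Integrable (fun x => (1 + |x|) ^ 6 * Real.exp (2 * a * x ^ 2)) ρ) :
    ∃ C : ℝ, 0 < C ∧ ∀ n : ℕ, 0 < n → 1 / (2 * (n : ℝ)) ≤ a → ∀ s : ℝ,
      (cwCondMoment ρ β n (fun y => y) s) ^ 2 ≤ C * (s ^ 2 + 1 / n) ∧
      |cwCondMoment ρ β n (fun y => y ^ 2) s - 1| ≤ C * (|s| + s ^ 2 + 1 / n) := by
  set E : ℝ → ℝ := fun x => (1 + |x|) ^ 6 * Real.exp (2 * a * x ^ 2) with hEdef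
  set J := ∫ x, E x ∂ρ with hJ
  have one_le : ∀ x : ℝ, 1 ≤ 1 + |x| := fun x => by linarith [abs_nonneg x]
  have hEp : ∀ (k : ℕ), k ≤ 6 → ∀ x, (1 + |x|) ^ k * Real.exp (2 * a * x ^ 2) ≤ E x := by
    intro k hk x
    simp only [hEdef]
    gcongr
    exact one_le x
  have hEp1 : ∀ (k : ℕ), k ≤ 6 → ∀ x, (1 + |x|) ^ k ≤ E x := by
    intro k hk x
    refine le_trans ?_ (hEp k hk x)
    refine le_mul_of_one_le_right (by positivity) (Real.one_le_exp (by positivity))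
  have hJ0 : 0 ≤ J := integral_nonneg fun x => by simp only [hEdef]; positivity
  set K := J * Real.exp (1 / (4 * a)) with hK
  have hK0 : 0 ≤ K := by positivity
  refine ⟨2 * K ^ 2 + K + (1 / a + J) ^ 2 + (1 / a ^ 2 + J + 1), by positivity, ?_⟩
  intro n hn hna s
  have hn' : (0:ℝ) < n := by exact_mod_cast hn
  have hn1 : (1:ℝ) ≤ n := by exact_mod_cast hn
  set w : ℝ → ℝ := fun y => β * y ^ 2 / (2 * n) + β * s * y with hw
  have hwabs0 : ∀ y, |w y| ≤ 1 / (2 * n) * y ^ 2 + |s| * |y| := by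
    intro y
    have e1 : |β * y ^ 2 / (2 * n)| ≤ 1 / (2 * n) * y ^ 2 := by
      rw [abs_of_nonneg (by positivity)]
      rw [div_mul_eq_mul_div]; gcongr
    have e2 : |β * s * y| ≤ |s| * |y| := by
      rw [abs_mul, abs_mul, abs_of_pos hβ]
      gcongr
      exact mul_le_of_le_one_left (abs_nonneg _) hβ1
    exact (abs_add_le _ _).trans (add_le_add e1 e2)
  have hwabs : ∀ y, |w y| ≤ a * y ^ 2 + |s| * |y| := fun y => (hwabs0 y).trans (by gcongr)
  have hwabs2 : ∀ y, |w y| ≤ (|s| + 1 / n) * (1 + |y|) ^ 2 := by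
    intro y
    refine (hwabs0 y).trans ?_
    have : 1 / (2 * (n:ℝ)) ≤ 1 / n := by
      apply one_div_le_one_div_of_le hn'; linarith
    have h1 : y ^ 2 ≤ (1 + |y|) ^ 2 := by nlinarith [abs_nonneg y, sq_abs y]
    have h2 : |y| ≤ (1 + |y|) ^ 2 := by nlinarith [abs_nonneg y, sq_abs y]
    calc _ ≤ 1 / (n:ℝ) * (1 + |y|) ^ 2 + |s| * (1 + |y|) ^ 2 := by gcongr
      _ = _ := by ring
  have hew : ∀ y, Real.exp |w y| ≤ Real.exp (s ^ 2 / (4 * a)) * Real.exp (2 * a * y ^ 2) := by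
    intro y
    calc Real.exp |w y| ≤ Real.exp (a * y ^ 2 + |s| * |y|) := Real.exp_le_exp.2 (hwabs y)
      _ = Real.exp (a * y ^ 2) * Real.exp (|s| * |y|) := Real.exp_add _ _
      _ ≤ Real.exp (a * y ^ 2) * (Real.exp (s ^ 2 / (4 * a)) * Real.exp (a * y ^ 2)) := by
          gcongr; exact aux_exp_le a s y ha
      _ = Real.exp (s ^ 2 / (4 * a)) * (Real.exp (a * y ^ 2) * Real.exp (a * y ^ 2)) := by ring
      _ = _ := by rw [← Real.exp_add]; congr 2; ring
  have hwc : Continuous w := by simp only [hw]; fun_prop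
  -- integrability
  have hintg : ∀ h : ℝ → ℝ, Continuous h → (∀ x, |h x| ≤ (1 + |x|) ^ 2) →
      Integrable (fun y => h y * Real.exp (w y)) ρ := by
    intro h hc hh
    refine (hE.const_mul (Real.exp (s ^ 2 / (4 * a)))).mono'
      (Continuous.aestronglyMeasurable (by fun_prop)) (ae_of_all _ fun y => ?_)
    rw [norm_mul, Real.norm_eq_abs, Real.norm_eq_abs, abs_of_pos (Real.exp_pos _)]
    calc |h y| * Real.exp (w y) ≤ (1 + |y|) ^ 2 *
          (Real.exp (s ^ 2 / (4 * a)) * Real.exp (2 * a * y ^ 2)) := by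
          gcongr
          · exact hh y
          · exact (Real.exp_le_exp.2 (le_abs_self _)).trans (hew y)
      _ = Real.exp (s ^ 2 / (4 * a)) * ((1 + |y|) ^ 2 * Real.exp (2 * a * y ^ 2)) := by ring
      _ ≤ _ := by gcongr; exact hEp 2 (by norm_num) y
  have hpoly : ∀ h : ℝ → ℝ, Continuous h → (∀ x, |h x| ≤ (1 + |x|) ^ 2) → Integrable h ρ := by
    intro h hc hh
    exact hE.mono' hc.aestronglyMeasurable (ae_of_all _ fun y => (hh y).trans (hEp1 2 (by norm_num) y))
  have p0 : ∀ x : ℝ, |(1:ℝ)| ≤ (1 + |x|) ^ 2 := fun x => by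
    rw [abs_one]; nlinarith [abs_nonneg x]
  have p1 : ∀ x : ℝ, |x| ≤ (1 + |x|) ^ 2 := fun x => by nlinarith [abs_nonneg x]
  have p2 : ∀ x : ℝ, |x ^ 2| ≤ (1 + |x|) ^ 2 := fun x => by
    rw [abs_pow]; nlinarith [abs_nonneg x]
  have p3 : ∀ x : ℝ, |x ^ 2 - 1| ≤ (1 + |x|) ^ 2 := fun x => by
    rw [abs_le]; constructor <;> nlinarith [abs_nonneg x, sq_abs x]
  have p4 : ∀ x : ℝ, |(|x|)| ≤ (1 + |x|) ^ 2 := fun x => by rw [abs_abs]; exact p1 x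
  have iD : Integrable (fun y => Real.exp (w y)) ρ := by
    simpa using hintg (fun _ => 1) (by fun_prop) p0
  set D := ∫ y, Real.exp (w y) ∂ρ with hD
  have hD1 : 1 ≤ D := by
    have i1 : Integrable (fun y : ℝ => 1 + β * s * y) ρ :=
      (integrable_const _).add ((hpoly (fun y => y) (by fun_prop) p1).const_mul _)
    have : ∫ y, (1 + β * s * y) ∂ρ = 1 := by
      rw [integral_add (integrable_const _) ((hpoly (fun y => y) (by fun_prop) p1).const_mul _),
        integral_const_mul, hmean]; simp
    rw [← this]
    refine integral_mono i1 iD fun y => ?_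
    have h1 := Real.add_one_le_exp (w y)
    have h2 : 0 ≤ β * y ^ 2 / (2 * n) := by positivity
    simp only [hw] at h1 ⊢
    linarith
  have hDpos : 0 < D := by linarith
  -- small s
  have hsmall : |s| ≤ 1 → ∀ h : ℝ → ℝ, Continuous h → (∀ x, |h x| ≤ (1 + |x|) ^ 2) →
      ∫ x, h x ∂ρ = 0 → |(∫ y, h y * Real.exp (w y) ∂ρ) / D| ≤ K * (|s| + 1 / n) := by
    intro hs h hc hh h0
    have e : ∫ y, h y * Real.exp (w y) ∂ρ = ∫ y, h y * (Real.exp (w y) - 1) ∂ρ := by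
      simp_rw [mul_sub, mul_one]
      rw [integral_sub (hintg h hc hh) (hpoly h hc hh), h0, sub_zero]
    rw [abs_div, abs_of_pos hDpos]
    refine (div_le_self (abs_nonneg _) hD1).trans ?_
    rw [e, ← Real.norm_eq_abs (∫ y, _ ∂ρ)]
    have : K * (|s| + 1 / n) = ∫ y, (Real.exp (1 / (4 * a)) * (|s| + 1 / n)) * E y ∂ρ := by
      rw [integral_const_mul]; ring
    rw [this]
    refine norm_integral_le_of_norm_le (hE.const_mul _) (ae_of_all _ fun y => ?_)
    rw [norm_mul, Real.norm_eq_abs, Real.norm_eq_abs]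
    calc |h y| * |Real.exp (w y) - 1| ≤ (1 + |y|) ^ 2 * (((|s| + 1 / n) * (1 + |y|) ^ 2) *
          (Real.exp (1 / (4 * a)) * Real.exp (2 * a * y ^ 2))) := by
          gcongr
          · exact hh y
          · refine (aux_exp_sub _).trans ?_
            gcongr
            · exact hwabs2 y
            · refine (hew y).trans ?_
              gcongr
              nlinarith [sq_abs s, abs_nonneg s]
      _ = (Real.exp (1 / (4 * a)) * (|s| + 1 / n)) * ((1 + |y|) ^ 4 * Real.exp (2 * a * y ^ 2)) := by ring
      _ ≤ _ := by gcongr; exact hEp 4 (by norm_num) y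
  -- large s
  have hlarge : ∀ j : ℕ, j ≤ 2 → (∫ y, |y| ^ j * Real.exp (w y) ∂ρ) / D ≤ (|s| / a) ^ j + J := by
    intro j hj
    rw [div_le_iff₀ hDpos]
    have iJ : Integrable (fun y => |y| ^ j * Real.exp (w y)) ρ := by
      refine hintg (fun y => |y| ^ j) (by fun_prop) fun x => ?_
      rw [abs_pow, abs_abs]
      calc |x| ^ j ≤ (1 + |x|) ^ j := by gcongr; linarith
        _ ≤ _ := by gcongr; exact one_le x
    have : ∫ y, |y| ^ j * Real.exp (w y) ∂ρ ≤ ∫ y, ((|s| / a) ^ j * Real.exp (w y) + E y) ∂ρ := by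
      refine integral_mono iJ ((iD.const_mul _).add hE) fun y => ?_
      have hE0 : 0 ≤ E y := by simp only [hEdef]; positivity
      by_cases hy : |y| ≤ |s| / a
      · have : |y| ^ j * Real.exp (w y) ≤ (|s| / a) ^ j * Real.exp (w y) := by gcongr
        simp only; linarith
      · push Not at hy
        rw [div_lt_iff₀ ha] at hy
        have h1 : w y ≤ 2 * a * y ^ 2 := by
          refine (le_abs_self _).trans ((hwabs y).trans ?_)
          nlinarith [abs_nonneg y, sq_abs y]
        have h2 : |y| ^ j * Real.exp (w y) ≤ E y := by
          refine le_trans ?_ (hEp 2 (by norm_num) y)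
          gcongr
          calc |y| ^ j ≤ (1 + |y|) ^ j := by gcongr; linarith
            _ ≤ _ := by gcongr; exact one_le y
        have h3 : 0 ≤ (|s| / a) ^ j * Real.exp (w y) := by positivity
        simp only; linarith
    refine this.trans ?_
    rw [integral_add (iD.const_mul _) hE, integral_const_mul]
    nlinarith
  have ef : cwCondMoment ρ β n (fun y => y) s = (∫ y, y * Real.exp (w y) ∂ρ) / D := rfl
  have eg : cwCondMoment ρ β n (fun y => y ^ 2) s = (∫ y, y ^ 2 * Real.exp (w y) ∂ρ) / D := rfl
  have eg1 : cwCondMoment ρ β n (fun y => y ^ 2) s - 1 = (∫ y, (y ^ 2 - 1) * Real.exp (w y) ∂ρ) / D := by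
    rw [eg]
    simp_rw [sub_mul, one_mul]
    rw [integral_sub (hintg _ (by fun_prop) p2) iD, sub_div, div_self hDpos.ne']
  have hni : (0:ℝ) < 1 / n := by positivity
  have hni1 : 1 / (n:ℝ) ≤ 1 := by rw [div_le_one hn']; exact hn1
  by_cases hs : |s| ≤ 1
  · have h1 := hsmall hs (fun y => y) (by fun_prop) p1 hmean
    have h2 := hsmall hs (fun y => y ^ 2 - 1) (by fun_prop) p3 (by
      rw [integral_sub (hpoly _ (by fun_prop) p2) (integrable_const _), hvar]; simp)
    rw [← ef] at h1
    rw [← eg1] at h2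
    constructor
    · calc _ = |cwCondMoment ρ β n (fun y => y) s| ^ 2 := (sq_abs _).symm
        _ ≤ (K * (|s| + 1 / n)) ^ 2 := by gcongr
        _ = K ^ 2 * (|s| + 1 / n) ^ 2 := by ring
        _ ≤ K ^ 2 * (2 * (s ^ 2 + 1 / n)) := by
            gcongr
            nlinarith [sq_nonneg (|s| - 1 / n), sq_abs s]
        _ = 2 * K ^ 2 * (s ^ 2 + 1 / n) := by ring
        _ ≤ _ := by
            gcongr
            have : 0 ≤ K + (1 / a + J) ^ 2 + (1 / a ^ 2 + J + 1) := by positivity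
            linarith
    · refine h2.trans ?_
      calc _ ≤ K * (|s| + s ^ 2 + 1 / n) := by gcongr; nlinarith [sq_nonneg s]
        _ ≤ _ := by
            gcongr
            have : 0 ≤ 2 * K ^ 2 + (1 / a + J) ^ 2 + (1 / a ^ 2 + J + 1) := by positivity
            linarith
  · push Not at hs
    have h1 := hlarge 1 (by norm_num)
    have h2 := hlarge 2 (by norm_num)
    have hs2 : 1 ≤ s ^ 2 := by nlinarith [sq_abs s]
    constructor
    · have hf : |cwCondMoment ρ β n (fun y => y) s| ≤ (1 / a + J) * |s| := by
        rw [ef, abs_div, abs_of_pos hDpos]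
        calc _ ≤ (∫ y, |y| ^ 1 * Real.exp (w y) ∂ρ) / D := by
              gcongr
              refine (abs_integral_le_integral_abs).trans (le_of_eq ?_)
              refine integral_congr_ae (ae_of_all _ fun y => ?_)
              simp [abs_mul]
          _ ≤ _ := h1
          _ ≤ _ := by rw [pow_one, add_mul, div_mul_eq_mul_div, one_mul]; gcongr; nlinarith
      calc _ = |cwCondMoment ρ β n (fun y => y) s| ^ 2 := (sq_abs _).symm
        _ ≤ ((1 / a + J) * |s|) ^ 2 := by gcongr
        _ = (1 / a + J) ^ 2 * s ^ 2 := by rw [mul_pow, sq_abs]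
        _ ≤ (1 / a + J) ^ 2 * (s ^ 2 + 1 / n) := by gcongr; linarith
        _ ≤ _ := by
            gcongr
            have : 0 ≤ 2 * K ^ 2 + K + (1 / a ^ 2 + J + 1) := by positivity
            linarith
    · have hg0 : 0 ≤ cwCondMoment ρ β n (fun y => y ^ 2) s := by
        rw [eg]; exact div_nonneg (integral_nonneg fun y => by positivity) hDpos.le
      have hg : cwCondMoment ρ β n (fun y => y ^ 2) s ≤ (|s| / a) ^ 2 + J := by
        rw [eg]; simpa only [sq_abs] using h2
      have : |cwCondMoment ρ β n (fun y => y ^ 2) s - 1| ≤ (1 / a ^ 2 + J + 1) * s ^ 2 := by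
        rw [div_pow, sq_abs] at hg
        have e : (1 / a ^ 2 + J + 1) * s ^ 2 = s ^ 2 / a ^ 2 + J * s ^ 2 + s ^ 2 := by ring
        have e2 : J ≤ J * s ^ 2 := le_mul_of_one_le_right hJ0 hs2
        have e3 : 0 ≤ s ^ 2 / a ^ 2 := by positivity
        rw [e, abs_le]; constructor <;> linarith
      calc _ ≤ (1 / a ^ 2 + J + 1) * s ^ 2 := this
        _ ≤ (1 / a ^ 2 + J + 1) * (|s| + s ^ 2 + 1 / n) := by
            gcongr; linarith [abs_nonneg s]
        _ ≤ _ := by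
            refine mul_le_mul_of_nonneg_right ?_ (by positivity)
            have : 0 ≤ 2 * K ^ 2 + K + (1 / a + J) ^ 2 := by positivity
            linarith

lemma aux_point (n : ℕ) (hn : 0 < n) (x f g : Fin n → ℝ) (C r : ℝ) (hC : 0 < C) (hr : 0 < r)
    (hr1 : r ≤ 1) (hnr : 1 / (n : ℝ) ≤ r ^ 2)
    (hf : ∀ i, f i ^ 2 ≤ C * ((((∑ j, x j) - x i) / n) ^ 2 + 1 / n))
    (hg : ∀ i, |g i - 1| ≤ C * (|((∑ j, x j) - x i) / n| + (((∑ j, x j) - x i) / n) ^ 2 + 1 / n)) :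
    |(1 / (n : ℝ)) * (∑ i, (x i ^ 2 - 2 * x i * f i + g i)) - 2| ≤
      (3 + 15 * C) * (r + (1 / r) * (((∑ i, (x i ^ 2 - 1)) / n) ^ 2 + ((∑ i, x i) / n) ^ 2)) := by
  have hn' : (0:ℝ) < n := by exact_mod_cast hn
  set S := ∑ j, x j with hS
  set T : ℝ := (∑ i, (x i ^ 2 - 1)) / (n : ℝ) with hT
  set B := (S / n) ^ 2 with hB
  have hB0 : 0 ≤ B := sq_nonneg _
  have hi : ∀ i, |2 * x i * f i| + |g i - 1| ≤
      (1 + 6 * C) * r * x i ^ 2 + (6 * C * (B / r) + 3 * C * r) := by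
    intro i
    set s := (S - x i) / n with hs
    have hsB : s ^ 2 ≤ 2 * B + 2 * (x i ^ 2 * r ^ 2) := by
      have e : s = S / n - x i * (1 / n) := by rw [hs]; field_simp
      have h2 : (x i * (1 / n)) ^ 2 ≤ x i ^ 2 * r ^ 2 := by
        rw [mul_pow]
        gcongr
        have h3 : 1 / (n:ℝ) ≤ 1 := hnr.trans (pow_le_one₀ hr.le hr1)
        have h4 : 0 < 1 / (n:ℝ) := by positivity
        nlinarith
      rw [e]
      nlinarith [sq_nonneg (S / n + x i * (1 / n))]
    have h1 : |2 * x i * f i| ≤ r * x i ^ 2 + f i ^ 2 / r := by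
      rw [abs_le]
      have e1 : r * x i ^ 2 + f i ^ 2 / r - 2 * x i * f i = (r * x i - f i) ^ 2 / r := by
        field_simp; ring
      have e2 : r * x i ^ 2 + f i ^ 2 / r + 2 * x i * f i = (r * x i + f i) ^ 2 / r := by
        field_simp; ring
      have e3 : 0 ≤ (r * x i - f i) ^ 2 / r := by positivity
      have e4 : 0 ≤ (r * x i + f i) ^ 2 / r := by positivity
      constructor <;> linarith
    have h2 : f i ^ 2 / r ≤ C * (s ^ 2 / r) + C * r := by
      rw [div_le_iff₀ hr]
      have : (C * (s ^ 2 / r) + C * r) * r = C * (s ^ 2 + r ^ 2) := by field_simp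
      rw [this]
      exact (hf i).trans (by gcongr)
    have hsr : s ^ 2 ≤ s ^ 2 / r := by
      rw [le_div_iff₀ hr]; nlinarith [sq_nonneg s]
    have habs : |s| ≤ r + s ^ 2 / r := by
      have : r + s ^ 2 / r - |s| = ((r - |s|) ^ 2 + r * |s|) / r := by
        rw [← sq_abs s]; field_simp; ring
      have : 0 ≤ ((r - |s|) ^ 2 + r * |s|) / r := by positivity
      linarith
    have hr2 : r ^ 2 ≤ r := by nlinarith
    have h3 : |g i - 1| ≤ C * (2 * (s ^ 2 / r) + 2 * r) := by
      have hgi := hg i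
      rw [← hs] at hgi
      refine hgi.trans (mul_le_mul_of_nonneg_left ?_ hC.le)
      linarith
    have h4 : s ^ 2 / r ≤ 2 * (B / r) + 2 * (x i ^ 2 * r) := by
      rw [div_le_iff₀ hr]
      have : (2 * (B / r) + 2 * (x i ^ 2 * r)) * r = 2 * B + 2 * (x i ^ 2 * r ^ 2) := by field_simp
      rw [this]; exact hsB
    nlinarith
  have hT2 : (1 / (n:ℝ)) * ∑ i, x i ^ 2 = 1 + T := by
    rw [hT, Finset.sum_sub_distrib]; simp; field_simp; ring
  have e : (1 / (n : ℝ)) * (∑ i, (x i ^ 2 - 2 * x i * f i + g i)) - 2 =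
      T + (1 / (n:ℝ)) * ∑ i, (- (2 * x i * f i) + (g i - 1)) := by
    have e1 : ∑ i, (x i ^ 2 - 2 * x i * f i + g i) =
       ∑ i, (x i ^ 2 - 1) + ∑ i, (- (2 * x i * f i) + (g i - 1)) + ∑ i : Fin n, (2:ℝ) := by
      rw [← Finset.sum_add_distrib, ← Finset.sum_add_distrib]
      exact Finset.sum_congr rfl fun i _ => by ring
    rw [e1, hT]; simp; field_simp; ring
  have hsum : |(1 / (n:ℝ)) * ∑ i, (- (2 * x i * f i) + (g i - 1))| ≤
      (1 + 6 * C) * r * (1 + T) + (6 * C * (B / r) + 3 * C * r) := by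
    rw [abs_mul, abs_of_pos (by positivity : 0 < 1 / (n:ℝ))]
    calc _ ≤ (1 / (n:ℝ)) * ∑ i, ((1 + 6 * C) * r * x i ^ 2 + (6 * C * (B / r) + 3 * C * r)) := by
          gcongr
          refine (Finset.abs_sum_le_sum_abs _ _).trans (Finset.sum_le_sum fun i _ => ?_)
          refine (abs_add_le _ _).trans ?_
          rw [abs_neg]; exact hi i
      _ = _ := by
          rw [← hT2, Finset.sum_add_distrib, ← Finset.mul_sum]; simp; field_simp
  rw [e]
  refine (abs_add_le _ _).trans ?_
  have hTr : |T| ≤ r + T ^ 2 / r := by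
    have : r + T ^ 2 / r - |T| = ((r - |T|) ^ 2 + r * |T|) / r := by
      rw [← sq_abs T]; field_simp; ring
    have : 0 ≤ ((r - |T|) ^ 2 + r * |T|) / r := by positivity
    linarith
  have hT3 : r * T ≤ r + T ^ 2 / r := by
    refine le_trans ?_ hTr
    calc r * T ≤ |r * T| := le_abs_self _
      _ = r * |T| := by rw [abs_mul, abs_of_pos hr]
      _ ≤ 1 * |T| := by gcongr
      _ = _ := one_mul _
  have hA0 : 0 ≤ T ^ 2 / r := by positivity
  have hBr : 0 ≤ B / r := by positivity
  have e5 : (3 + 15 * C) * (r + (1 / r) * (T ^ 2 + B)) =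
    (3 + 15 * C) * (r + T ^ 2 / r + B / r) := by ring
  rw [e5]
  have := mul_le_mul_of_nonneg_left hT3 (by positivity : 0 ≤ 1 + 6 * C)
  nlinarith [mul_nonneg hC.le hA0, mul_nonneg hC.le hBr, mul_pos hC hr]

lemma aux_G (p d : ℕ) (hd : 0 < d) (σ : ℝ) (hσ : 0 < σ) :
    Integrable (fun u : ℝ => |u| ^ p * Real.exp (-σ * |u| ^ d)) ∧
    ∫ u : ℝ, |u| ^ p * Real.exp (-σ * |u| ^ d) =
      2 * (σ ^ (-((p : ℝ) + 1) / d) * (1 / d) * Real.Gamma (((p : ℝ) + 1) / d)) := by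
  have hd' : (0:ℝ) < d := by exact_mod_cast hd
  have hp : (-1:ℝ) < p := by have : (0:ℝ) ≤ p := by positivity
                             linarith
  have i1 := integrableOn_rpow_mul_exp_neg_mul_rpow hp hd' hσ
  have e1 := integral_rpow_mul_exp_neg_mul_rpow hd' hp hσ
  simp only [Real.rpow_natCast] at i1 e1
  have i2 : IntegrableOn (fun u : ℝ => |u| ^ p * Real.exp (-σ * |u| ^ d)) (Ioi 0) := by
    refine i1.congr_fun (fun u hu => ?_) measurableSet_Ioi
    simp only [abs_of_pos (mem_Ioi.1 hu)]
  constructor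
  · rw [← integrableOn_univ, ← Iic_union_Ioi (a := (0:ℝ))]
    refine IntegrableOn.union ?_ i2
    have := (integrableOn_Iic_iff_integrableOn_Iio (μ := volume) (f := fun u : ℝ => |u| ^ p * Real.exp (-σ * |u| ^ d)) (b := 0))
    rw [this]
    have h3 := i2.comp_neg
    simpa using h3
  · rw [integral_comp_abs (f := fun u => u ^ p * Real.exp (-σ * u ^ d)), e1]

lemma aux_G2 (κ d p : ℕ) (hd : 1 ≤ d) (hdκ : d ≤ κ) (c : ℝ) (hc : 0 < c) :
    ∃ C : ℝ, 0 ≤ C ∧ ∀ n : ℕ, 0 < n →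
      Integrable (fun u : ℝ => |u| ^ p * Real.exp (-(n * c) * |u| ^ (2 * d))) ∧
      ∫ u : ℝ, |u| ^ p * Real.exp (-(n * c) * |u| ^ (2 * d)) ≤
        C * ((n : ℝ) ^ (-(1 / (2 * (κ : ℝ))))) ^ (p + 1) := by
  have hd' : (1:ℝ) ≤ d := by exact_mod_cast hd
  have hdk' : (d:ℝ) ≤ κ := by exact_mod_cast hdκ
  refine ⟨2 * (c ^ (-((p : ℝ) + 1) / (2 * d : ℕ)) * (1 / (2 * d : ℕ)) * Real.Gamma (((p : ℝ) + 1) / (2 * d : ℕ))),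
    ?_, fun n hn => ?_⟩
  · have : 0 ≤ Real.Gamma (((p : ℝ) + 1) / (2 * d : ℕ)) := by
      apply Real.Gamma_nonneg_of_nonneg; positivity
    positivity
  have hn' : (0:ℝ) < n := by exact_mod_cast hn
  have hn1 : (1:ℝ) ≤ n := by exact_mod_cast hn
  obtain ⟨h1, h2⟩ := aux_G p (2 * d) (by omega) (n * c) (by positivity)
  refine ⟨h1, ?_⟩
  rw [h2, Real.mul_rpow hn'.le hc.le]
  have h3 : (n:ℝ) ^ (-((p : ℝ) + 1) / (2 * d : ℕ)) ≤ ((n : ℝ) ^ (-(1 / (2 * (κ : ℝ))))) ^ (p + 1) := by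
    rw [← Real.rpow_natCast, ← Real.rpow_mul hn'.le]
    apply Real.rpow_le_rpow_of_exponent_le hn1
    push_cast
    have : 1 / (2 * (κ:ℝ)) ≤ 1 / (2 * d) := by
      apply one_div_le_one_div_of_le <;> linarith
    have hp : (0:ℝ) < (p:ℝ) + 1 := by positivity
    calc -((p:ℝ) + 1) / (2 * d) = -(((p:ℝ) + 1) * (1 / (2 * d))) := by ring
      _ ≤ -(((p:ℝ) + 1) * (1 / (2 * κ))) := by gcongr
      _ = _ := by ring
  have hΓ : 0 ≤ Real.Gamma (((p : ℝ) + 1) / (2 * d : ℕ)) := by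
    apply Real.Gamma_nonneg_of_nonneg; positivity
  set R := ((n : ℝ) ^ (-(1 / (2 * (κ : ℝ))))) ^ (p + 1)
  calc _ = (n:ℝ) ^ (-((p : ℝ) + 1) / (2 * d : ℕ)) * (2 * (c ^ (-((p : ℝ) + 1) / (2 * d : ℕ)) * (1 / (2 * d : ℕ)) * Real.Gamma (((p : ℝ) + 1) / (2 * d : ℕ)))) := by ring
    _ ≤ R * (2 * (c ^ (-((p : ℝ) + 1) / (2 * d : ℕ)) * (1 / (2 * d : ℕ)) * Real.Gamma (((p : ℝ) + 1) / (2 * d : ℕ)))) := by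
        gcongr
    _ = _ := by ring

lemma aux_r (κ n : ℕ) (hκ : 1 ≤ κ) (hn : 0 < n) :
    0 < (n : ℝ) ^ (-(1 / (2 * (κ : ℝ)))) ∧ (n : ℝ) ^ (-(1 / (2 * (κ : ℝ)))) ≤ 1 ∧
    1 / (n : ℝ) ≤ ((n : ℝ) ^ (-(1 / (2 * (κ : ℝ))))) ^ 2 ∧
    ((n : ℝ) ^ (-(1 / (2 * (κ : ℝ))))) ^ (2 * κ) = 1 / n := by
  have hn' : (0:ℝ) < n := by exact_mod_cast hn
  have hn1 : (1:ℝ) ≤ n := by exact_mod_cast hn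
  have hκ' : (1:ℝ) ≤ κ := by exact_mod_cast hκ
  have e4 : ((n : ℝ) ^ (-(1 / (2 * (κ : ℝ))))) ^ (2 * κ) = 1 / n := by
    rw [← Real.rpow_natCast, ← Real.rpow_mul hn'.le]
    have : -(1 / (2 * (κ:ℝ))) * ((2 * κ : ℕ) : ℝ) = -1 := by
      push_cast; field_simp
    rw [this, Real.rpow_neg_one, one_div]
  have e1 : 0 < (n : ℝ) ^ (-(1 / (2 * (κ : ℝ)))) := by positivity
  have e2 : (n : ℝ) ^ (-(1 / (2 * (κ : ℝ)))) ≤ 1 := by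
    apply Real.rpow_le_one_of_one_le_of_nonpos hn1
    simp
  refine ⟨e1, e2, ?_, e4⟩
  rw [← e4]
  exact pow_le_pow_of_le_one e1.le e2 (by omega)

lemma aux_tonelli (ρ : Measure ℝ) [IsProbabilityMeasure ρ] (n : ℕ) (G : (Fin n → ℝ) → ℝ)
    (hG : Continuous G) (hG0 : ∀ x, 0 ≤ G x) (σ : ℝ) (hσ : 0 < σ) :
    ENNReal.ofReal (√(Real.pi / σ)) *
      ∫⁻ x, ENNReal.ofReal (G x * Real.exp ((∑ i, x i) ^ 2 / (4 * σ))) ∂(Measure.pi fun _ : Fin n => ρ) =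
    ∫⁻ u : ℝ, (∫⁻ x, ENNReal.ofReal (Real.exp (-σ * u ^ 2) * (G x * ∏ i, Real.exp (u * x i)))
      ∂(Measure.pi fun _ : Fin n => ρ)) := by
  rw [← lintegral_const_mul _ (by fun_prop)]
  calc _ = ∫⁻ x, (∫⁻ u : ℝ, ENNReal.ofReal (Real.exp (-σ * u ^ 2) * (G x * ∏ i, Real.exp (u * x i))))
      ∂(Measure.pi fun _ : Fin n => ρ) := by
        refine lintegral_congr fun x => ?_
        have : ∀ u : ℝ, ENNReal.ofReal (Real.exp (-σ * u ^ 2) * (G x * ∏ i, Real.exp (u * x i))) =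
          ENNReal.ofReal (G x) * ENNReal.ofReal (Real.exp (-σ * u ^ 2 + u * ∑ i, x i)) := by
          intro u
          rw [← ENNReal.ofReal_mul (hG0 x), Real.exp_add, Finset.mul_sum, Real.exp_sum]
          congr 1; ring
        simp_rw [this]
        rw [lintegral_const_mul _ (by fun_prop), aux_hs _ _ hσ, ENNReal.ofReal_mul (hG0 x),
          ENNReal.ofReal_mul (by positivity)]
        ring
    _ = _ := lintegral_lintegral_swap (by fun_prop)

lemma aux_inner (ρ : Measure ℝ) [IsProbabilityMeasure ρ]
    (hmean : ∫ x, x ∂ρ = 0) (hvar : ∫ x, x ^ 2 ∂ρ = 1) (a : ℝ) (ha : 0 < a)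
    (hE : Integrable (fun x => (1 + |x|) ^ 6 * Real.exp (2 * a * x ^ 2)) ρ)
    (hI : ∀ t : ℝ, Integrable (fun x => Real.exp (t * x)) ρ) :
    ∃ M : ℝ, 0 < M ∧ ∀ n : ℕ, 0 < n → ∀ u : ℝ,
      1 ≤ (∫ x, Real.exp (u * x) ∂ρ) ∧
      Integrable (fun x : Fin n → ℝ => (((∑ i, (x i ^ 2 - 1)) / n) ^ 2 + ((∑ i, x i) / n) ^ 2 + 1 / n)
        * ∏ i, Real.exp (u * x i)) (Measure.pi fun _ : Fin n => ρ) ∧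
      ∫ x : Fin n → ℝ, (((∑ i, (x i ^ 2 - 1)) / n) ^ 2 + ((∑ i, x i) / n) ^ 2 + 1 / n)
        * ∏ i, Real.exp (u * x i) ∂(Measure.pi fun _ : Fin n => ρ) ≤
      M * (u ^ 2 + 1 / n) * Real.exp (1 / (2 * a) * u ^ 2) * (∫ x, Real.exp (u * x) ∂ρ) ^ n := by
  set J := ∫ x, (1 + |x|) ^ 6 * Real.exp (2 * a * x ^ 2) ∂ρ with hJ
  have hJ0 : 0 ≤ J := integral_nonneg fun x => by positivity
  refine ⟨2 * J + 2 * J ^ 2 + 1, by positivity, fun n hn u => ?_⟩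
  have hn' : (0:ℝ) < n := by exact_mod_cast hn
  have hx1 : Integrable (fun x : ℝ => x) ρ := by
    refine hE.mono' (by fun_prop) (ae_of_all _ fun x => ?_)
    rw [Real.norm_eq_abs]
    have h1 : |x| ≤ (1 + |x|) ^ 6 := by
      calc |x| ≤ (1 + |x|) ^ 1 := by linarith
        _ ≤ _ := pow_le_pow_right₀ (by linarith [abs_nonneg x]) (by norm_num)
    have h2 : 1 ≤ Real.exp (2 * a * x ^ 2) := Real.one_le_exp (by positivity)
    nlinarith [abs_nonneg x]
  have hx2 : Integrable (fun x : ℝ => x ^ 2) ρ := by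
    by_contra h
    rw [integral_undef h] at hvar; norm_num at hvar
  have hm1 : 1 ≤ ∫ x, Real.exp (u * x) ∂ρ := by
    calc (1:ℝ) = ∫ x, (u * x + 1) ∂ρ := by
          rw [integral_add (hx1.const_mul u) (integrable_const _), integral_const_mul, hmean]; simp
      _ ≤ _ := integral_mono ((hx1.const_mul u).add (integrable_const _)) (hI u)
          (fun x => Real.add_one_le_exp _)
  set m := ∫ x, Real.exp (u * x) ∂ρ with hm
  set P := Measure.pi fun _ : Fin n => ρ with hP
  obtain ⟨a1, a2, a3, a4⟩ := aux_mom ρ a ha hE (fun x => x ^ 2 - 1) (by fun_prop)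
    (fun x => by rw [abs_le]; constructor <;> nlinarith [sq_nonneg x])
    (by rw [integral_sub hx2 (integrable_const _), hvar]; simp) u
  obtain ⟨c1, c2, c3, c4⟩ := aux_mom ρ a ha hE (fun x => x) (by fun_prop)
    (fun x => by
      have := sq_nonneg (|x| - 1)
      nlinarith [sq_abs x, abs_nonneg x]) hmean u
  obtain ⟨d1, d2⟩ := aux_pi ρ (fun x => x ^ 2 - 1) (fun x => Real.exp (u * x)) n (hI u) a2 a1 hm1
    (fun x => (Real.exp_pos _).le)
  obtain ⟨e1, e2⟩ := aux_pi ρ (fun x => x) (fun x => Real.exp (u * x)) n (hI u) c2 c1 hm1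
    (fun x => (Real.exp_pos _).le)
  have f1 : Integrable (fun x : Fin n → ℝ => ∏ i, Real.exp (u * x i)) P :=
    Integrable.fintype_prod (fun i => hI u)
  have f2 : ∫ x : Fin n → ℝ, ∏ i, Real.exp (u * x i) ∂P = m ^ n := by
    rw [hP, integral_fintype_prod_eq_prod (fun (_ : Fin n) (y : ℝ) => Real.exp (u * y))]
    simp [hm]
  set E := Real.exp (u ^ 2 / (4 * a)) with hEd
  have hE1 : 1 ≤ E := Real.one_le_exp (by positivity)
  have hE2 : Real.exp (1 / (2 * a) * u ^ 2) = E ^ 2 := by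
    rw [hEd, ← Real.exp_nat_mul]; congr 1; field_simp; push_cast; ring
  have key : ∀ q2 q1 : ℝ, q2 ≤ J * E → |q1| ≤ |u| * (J * E) →
      m ^ n * (n * q2 + n ^ 2 * q1 ^ 2) * (1 / n ^ 2) ≤ m ^ n * (E ^ 2 * (J * (1 / n) + J ^ 2 * u ^ 2)) := by
    intro q2 q1 h2 h1
    rw [mul_assoc]
    apply mul_le_mul_of_nonneg_left _ (by positivity)
    have h3 : q1 ^ 2 ≤ u ^ 2 * (J ^ 2 * E ^ 2) := by
      calc q1 ^ 2 = |q1| ^ 2 := (sq_abs _).symm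
        _ ≤ (|u| * (J * E)) ^ 2 := by gcongr
        _ = _ := by rw [mul_pow, sq_abs]; ring
    have h4 : q2 ≤ J * E ^ 2 := h2.trans
      (mul_le_mul_of_nonneg_left (by nlinarith) hJ0)
    calc (n * q2 + n ^ 2 * q1 ^ 2) * (1 / (n:ℝ) ^ 2) = q2 * (1 / n) + q1 ^ 2 := by field_simp
      _ ≤ (J * E ^ 2) * (1 / n) + u ^ 2 * (J ^ 2 * E ^ 2) := by gcongr
      _ = _ := by ring
  have eqf : (fun x : Fin n → ℝ => (((∑ i, (x i ^ 2 - 1)) / n) ^ 2 + ((∑ i, x i) / n) ^ 2 + 1 / n)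
        * ∏ i, Real.exp (u * x i)) = fun x => ((1 / (n:ℝ) ^ 2) * ((∑ i, (x i ^ 2 - 1)) ^ 2 * ∏ i, Real.exp (u * x i))
        + (1 / (n:ℝ) ^ 2) * ((∑ i, x i) ^ 2 * ∏ i, Real.exp (u * x i))) + (1 / (n:ℝ)) * ∏ i, Real.exp (u * x i) := by
    funext x; ring
  refine ⟨hm1, ?_, ?_⟩
  · rw [eqf]
    exact ((d1.const_mul _).add (e1.const_mul _)).add (f1.const_mul _)
  · have de : Integrable (fun x : Fin n → ℝ => (1 / (n:ℝ) ^ 2) * ((∑ i, (x i ^ 2 - 1)) ^ 2 * ∏ i, Real.exp (u * x i))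
        + (1 / (n:ℝ) ^ 2) * ((∑ i, x i) ^ 2 * ∏ i, Real.exp (u * x i))) P :=
      (d1.const_mul _).add (e1.const_mul _)
    rw [eqf, integral_add de (f1.const_mul _),
      integral_add (d1.const_mul _) (e1.const_mul _), integral_const_mul, integral_const_mul,
      integral_const_mul, f2, hE2]
    have k1 := key _ _ a3 a4
    have k2 := key _ _ c3 c4
    have hn2 : (0:ℝ) ≤ 1 / (n:ℝ) ^ 2 := by positivity
    have g1 := mul_le_mul_of_nonneg_right d2 hn2
    have g2 := mul_le_mul_of_nonneg_right e2 hn2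
    have hn3 : (0:ℝ) ≤ 1 / (n:ℝ) := by positivity
    have g3 : 1 / (n:ℝ) * m ^ n ≤ m ^ n * (E ^ 2 * (1 / n)) := by
      have : 1 / (n:ℝ) ≤ E ^ 2 * (1 / n) := le_mul_of_one_le_left hn3 (one_le_pow₀ hE1)
      rw [mul_comm]
      exact mul_le_mul_of_nonneg_left this (by positivity)
    have g4 : 0 ≤ m ^ n * (E ^ 2 * (2 * J * u ^ 2 + 2 * J ^ 2 * (1 / n) + u ^ 2)) := by positivity
    have : (2 * J + 2 * J ^ 2 + 1) * (u ^ 2 + 1 / n) * E ^ 2 * m ^ n =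
      m ^ n * (E ^ 2 * (J * (1 / n) + J ^ 2 * u ^ 2)) + m ^ n * (E ^ 2 * (J * (1 / n) + J ^ 2 * u ^ 2))
      + m ^ n * (E ^ 2 * (1 / n)) + m ^ n * (E ^ 2 * (2 * J * u ^ 2 + 2 * J ^ 2 * (1 / n) + u ^ 2)) := by ring
    rw [this]
    rw [mul_comm (1 / (n:ℝ) ^ 2), mul_comm (1 / (n:ℝ) ^ 2)]
    linarith

lemma aux_upper (ρ : Measure ℝ) [IsProbabilityMeasure ρ]
    (hmean : ∫ x, x ∂ρ = 0) (hvar : ∫ x, x ^ 2 ∂ρ = 1) (a : ℝ) (ha : 0 < a)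
    (hE : Integrable (fun x => (1 + |x|) ^ 6 * Real.exp (2 * a * x ^ 2)) ρ)
    (hI : ∀ t : ℝ, Integrable (fun x => Real.exp (t * x)) ρ)
    (β : ℝ) (hβ : 0 < β) (κ : ℕ) (hκ : 1 ≤ κ) (b0 c : ℝ) (hc : 0 < c)
    (H1 : ∀ u : ℝ, |u| ≤ b0 → ∫ x, Real.exp (u * x) ∂ρ ≤ Real.exp (u ^ 2 / (2 * β) - c * u ^ (2 * κ)))
    (H2 : ∀ u : ℝ, b0 < |u| → ∫ x, Real.exp (u * x) ∂ρ ≤ Real.exp (u ^ 2 / (2 * β) - c * u ^ 2)) :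
    ∃ C : ℝ, 0 < C ∧ ∃ N : ℕ, ∀ n : ℕ, N ≤ n → 0 < n →
      ENNReal.ofReal (√(Real.pi / ((n:ℝ) / (2 * β)))) *
      ∫⁻ x, ENNReal.ofReal ((((∑ i, (x i ^ 2 - 1)) / n) ^ 2 + ((∑ i, x i) / n) ^ 2 + 1 / n) *
        Real.exp ((∑ i, x i) ^ 2 / (4 * ((n:ℝ) / (2 * β))))) ∂(Measure.pi fun _ : Fin n => ρ) ≤
      ENNReal.ofReal (C * ((n : ℝ) ^ (-(1 / (2 * (κ : ℝ))))) ^ 3) := by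
  obtain ⟨M, hM, hin⟩ := aux_inner ρ hmean hvar a ha hE hI
  obtain ⟨C1, hC1, hG1⟩ := aux_G2 κ κ 2 hκ le_rfl c hc
  obtain ⟨C2, hC2, hG2⟩ := aux_G2 κ κ 0 hκ le_rfl c hc
  obtain ⟨C3, hC3, hG3⟩ := aux_G2 κ 1 2 le_rfl hκ (c / 2) (by positivity)
  obtain ⟨C4, hC4, hG4⟩ := aux_G2 κ 1 0 le_rfl hκ (c / 2) (by positivity)
  set K := 1 / (2 * a) with hK
  have hK0 : 0 < K := by positivity
  set B := Real.exp (K * b0 ^ 2) with hB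
  have hB0 : 0 < B := Real.exp_pos _
  obtain ⟨N, hN⟩ := exists_nat_ge (K / (c / 2))
  refine ⟨M * ((C1 + C2) * B + (C3 + C4)) + 1, by positivity, N, fun n hnN hn => ?_⟩
  have hn' : (0:ℝ) < n := by exact_mod_cast hn
  have hnK : K ≤ n * (c / 2) := by
    have : (N:ℝ) ≤ n := by exact_mod_cast hnN
    rw [div_le_iff₀ (by positivity)] at hN
    nlinarith
  obtain ⟨r0, r1, r2, r3⟩ := aux_r κ n hκ hn
  obtain ⟨i1, g1⟩ := hG1 n hn
  obtain ⟨i2, g2⟩ := hG2 n hn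
  obtain ⟨i3, g3⟩ := hG3 n hn
  obtain ⟨i4, g4⟩ := hG4 n hn
  set r := (n : ℝ) ^ (-(1 / (2 * (κ : ℝ)))) with hr
  rw [aux_tonelli ρ n (fun x => ((∑ i, (x i ^ 2 - 1)) / n) ^ 2 + ((∑ i, x i) / n) ^ 2 + 1 / n)
    (by fun_prop) (fun x => by positivity) _ (by positivity)]
  set f1 := fun u : ℝ => |u| ^ 2 * Real.exp (-(n * c) * |u| ^ (2 * κ)) with hf1
  set f2 := fun u : ℝ => |u| ^ 0 * Real.exp (-(n * c) * |u| ^ (2 * κ)) with hf2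
  set f3 := fun u : ℝ => |u| ^ 2 * Real.exp (-(n * (c / 2)) * |u| ^ (2 * 1)) with hf3
  set f4 := fun u : ℝ => |u| ^ 0 * Real.exp (-(n * (c / 2)) * |u| ^ (2 * 1)) with hf4
  set Y : ℝ → ℝ := fun u => M * ((f1 u + 1 / (n:ℝ) * f2 u) * B + (f3 u + 1 / (n:ℝ) * f4 u)) with hY
  have j1 : Integrable (fun u => f1 u + 1 / (n:ℝ) * f2 u) := i1.add (i2.const_mul _)
  have j2 : Integrable (fun u => f3 u + 1 / (n:ℝ) * f4 u) := i3.add (i4.const_mul _)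
  have j3 : Integrable Y := ((j1.mul_const _).add j2).const_mul _
  have hY0 : ∀ u, 0 ≤ Y u := fun u => by positivity
  have hYi : ∫ u, Y u ≤ M * ((C1 + C2) * B + (C3 + C4)) * r ^ 3 := by
    have : ∫ u, Y u = M * (((∫ u, f1 u) + 1 / (n:ℝ) * ∫ u, f2 u) * B + ((∫ u, f3 u) + 1 / (n:ℝ) * ∫ u, f4 u)) := by
      rw [hY, integral_const_mul, integral_add (j1.mul_const _) j2, integral_mul_const,
        integral_add i1 (i2.const_mul _), integral_add i3 (i4.const_mul _), integral_const_mul, integral_const_mul]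
    rw [this, mul_assoc]
    apply mul_le_mul_of_nonneg_left _ hM.le
    have h2 : 1 / (n:ℝ) * ∫ u, f2 u ≤ r ^ 2 * (C2 * r) := by
      apply mul_le_mul r2 (by simpa using g2) (integral_nonneg fun u => by positivity) (by positivity)
    have h4 : 1 / (n:ℝ) * ∫ u, f4 u ≤ r ^ 2 * (C4 * r) := by
      apply mul_le_mul r2 (by simpa using g4) (integral_nonneg fun u => by positivity) (by positivity)
    have h5 : ((∫ u, f1 u) + 1 / (n:ℝ) * ∫ u, f2 u) * B ≤ (C1 * r ^ 3 + r ^ 2 * (C2 * r)) * B :=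
      mul_le_mul_of_nonneg_right (add_le_add g1 h2) hB0.le
    have h6 : (∫ u, f3 u) + 1 / (n:ℝ) * ∫ u, f4 u ≤ C3 * r ^ 3 + r ^ 2 * (C4 * r) := add_le_add g3 h4
    calc _ ≤ (C1 * r ^ 3 + r ^ 2 * (C2 * r)) * B + (C3 * r ^ 3 + r ^ 2 * (C4 * r)) := add_le_add h5 h6
      _ = _ := by ring
  have hpt : ∀ u : ℝ, (∫⁻ x, ENNReal.ofReal (Real.exp (-((n:ℝ) / (2 * β)) * u ^ 2) *
      ((((∑ i, (x i ^ 2 - 1)) / n) ^ 2 + ((∑ i, x i) / n) ^ 2 + 1 / n) * ∏ i, Real.exp (u * x i)))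
      ∂(Measure.pi fun _ : Fin n => ρ)) ≤ ENNReal.ofReal (Y u) := by
    intro u
    obtain ⟨m1, int, le⟩ := hin n hn u
    rw [← ofReal_integral_eq_lintegral_ofReal (int.const_mul _) (ae_of_all _ fun x => by positivity),
      integral_const_mul]
    apply ENNReal.ofReal_le_ofReal
    refine (mul_le_mul_of_nonneg_left le (Real.exp_pos _).le).trans ?_
    set m := ∫ x, Real.exp (u * x) ∂ρ with hm
    have hle : Real.exp (-((n:ℝ) / (2 * β)) * u ^ 2) * Real.exp (K * u ^ 2) * m ^ n ≤
        B * Real.exp (-(n * c) * |u| ^ (2 * κ)) + Real.exp (-(n * (c / 2)) * |u| ^ (2 * 1)) := by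
      have hab : |u| ^ (2 * κ) = u ^ (2 * κ) := by rw [pow_mul, sq_abs, ← pow_mul]
      have hab2 : |u| ^ (2 * 1) = u ^ 2 := by rw [mul_one, sq_abs]
      rcases le_or_gt |u| b0 with hu | hu
      · have h1 : m ^ n ≤ Real.exp (n * (u ^ 2 / (2 * β) - c * u ^ (2 * κ))) := by
          rw [Real.exp_nat_mul]
          exact pow_le_pow_left₀ (by linarith) (H1 u hu) n
        have h2 : u ^ 2 ≤ b0 ^ 2 := by
          rw [← sq_abs u]; exact pow_le_pow_left₀ (abs_nonneg _) hu 2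
        calc _ ≤ Real.exp (-((n:ℝ) / (2 * β)) * u ^ 2) * Real.exp (K * u ^ 2) * Real.exp (n * (u ^ 2 / (2 * β) - c * u ^ (2 * κ))) := by gcongr
          _ ≤ B * Real.exp (-(n * c) * |u| ^ (2 * κ)) := by
            rw [hab, hB, ← Real.exp_add, ← Real.exp_add, ← Real.exp_add]
            apply Real.exp_le_exp.2
            have : (n:ℝ) * (u ^ 2 / (2 * β) - c * u ^ (2 * κ)) = (n:ℝ) / (2 * β) * u ^ 2 - n * c * u ^ (2 * κ) := by ring
            rw [this]
            have := mul_le_mul_of_nonneg_left h2 hK0.le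
            linarith
          _ ≤ _ := by linarith [Real.exp_pos (-(n * (c / 2)) * |u| ^ (2 * 1))]
      · have h1 : m ^ n ≤ Real.exp (n * (u ^ 2 / (2 * β) - c * u ^ 2)) := by
          rw [Real.exp_nat_mul]
          exact pow_le_pow_left₀ (by linarith) (H2 u hu) n
        calc _ ≤ Real.exp (-((n:ℝ) / (2 * β)) * u ^ 2) * Real.exp (K * u ^ 2) * Real.exp (n * (u ^ 2 / (2 * β) - c * u ^ 2)) := by gcongr
          _ ≤ Real.exp (-(n * (c / 2)) * |u| ^ (2 * 1)) := by
            rw [hab2, ← Real.exp_add, ← Real.exp_add]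
            apply Real.exp_le_exp.2
            have : (n:ℝ) * (u ^ 2 / (2 * β) - c * u ^ 2) = (n:ℝ) / (2 * β) * u ^ 2 - 2 * ((n * (c / 2)) * u ^ 2) := by ring
            rw [this]
            have := mul_le_mul_of_nonneg_right hnK (sq_nonneg u)
            linarith
          _ ≤ _ := by
            have : 0 ≤ B * Real.exp (-(n * c) * |u| ^ (2 * κ)) := by positivity
            linarith
    calc _ = M * (u ^ 2 + 1 / n) * (Real.exp (-((n:ℝ) / (2 * β)) * u ^ 2) * Real.exp (K * u ^ 2) * m ^ n) := by ring
      _ ≤ M * (u ^ 2 + 1 / n) * (B * Real.exp (-(n * c) * |u| ^ (2 * κ)) + Real.exp (-(n * (c / 2)) * |u| ^ (2 * 1))) :=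
        mul_le_mul_of_nonneg_left hle (by positivity)
      _ = Y u := by
        simp only [hY, hf1, hf2, hf3, hf4, sq_abs]; ring
  calc _ ≤ ∫⁻ u, ENNReal.ofReal (Y u) := lintegral_mono hpt
    _ = ENNReal.ofReal (∫ u, Y u) := (ofReal_integral_eq_lintegral_ofReal j3 (ae_of_all _ hY0)).symm
    _ ≤ _ := by
      apply ENNReal.ofReal_le_ofReal
      refine hYi.trans ?_
      have : 0 ≤ r ^ 3 := by positivity
      linarith

lemma aux_lower (ρ : Measure ℝ) [IsProbabilityMeasure ρ]
    (hI : ∀ t : ℝ, Integrable (fun x => Real.exp (t * x)) ρ)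
    (β : ℝ) (hβ : 0 < β) (κ : ℕ) (hκ : 1 ≤ κ) (C0 : ℝ) (hC0 : 0 < C0)
    (H3 : ∀ u : ℝ, |u| ≤ 1 → Real.exp (u ^ 2 / (2 * β)) * (1 - C0 * u ^ (2 * κ)) ≤ ∫ x, Real.exp (u * x) ∂ρ) :
    ∃ δ : ℝ, 0 < δ ∧ ∀ n : ℕ, 0 < n →
      ENNReal.ofReal (δ * (n : ℝ) ^ (-(1 / (2 * (κ : ℝ))))) ≤
      ENNReal.ofReal (√(Real.pi / ((n:ℝ) / (2 * β)))) *
      ∫⁻ x, ENNReal.ofReal (1 *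
        Real.exp ((∑ i, x i) ^ 2 / (4 * ((n:ℝ) / (2 * β))))) ∂(Measure.pi fun _ : Fin n => ρ) := by
  set δ : ℝ := 1 / (2 * C0 + 1) with hδ
  have hδ0 : 0 < δ := by positivity
  have hδ1 : δ ≤ 1 := by rw [hδ, div_le_one (by positivity)]; linarith
  have hδC : C0 * δ ≤ 1 / 2 := by
    rw [hδ, mul_one_div, div_le_div_iff₀ (by positivity) (by norm_num)]; linarith
  refine ⟨δ, hδ0, fun n hn => ?_⟩
  have hn' : (0:ℝ) < n := by exact_mod_cast hn
  have hn1 : (1:ℝ) ≤ n := by exact_mod_cast hn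
  obtain ⟨r0, r1, r2, r3⟩ := aux_r κ n hκ hn
  set r := (n : ℝ) ^ (-(1 / (2 * (κ : ℝ)))) with hr
  rw [aux_tonelli ρ n (fun x => 1) (by fun_prop) (fun x => by positivity) _ (by positivity)]
  have hpt : ∀ u ∈ Icc (-(δ * r)) (δ * r), ENNReal.ofReal (1 / 2) ≤
      (∫⁻ x, ENNReal.ofReal (Real.exp (-((n:ℝ) / (2 * β)) * u ^ 2) * (1 * ∏ i, Real.exp (u * x i)))
      ∂(Measure.pi fun _ : Fin n => ρ)) := by
    intro u hu
    have hu1 : |u| ≤ δ * r := abs_le.2 hu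
    have f1 : Integrable (fun x : Fin n → ℝ => 1 * ∏ i, Real.exp (u * x i)) (Measure.pi fun _ : Fin n => ρ) := by
      simp only [one_mul]
      exact Integrable.fintype_prod (fun i => hI u)
    have f2 : ∫ x : Fin n → ℝ, 1 * ∏ i, Real.exp (u * x i) ∂(Measure.pi fun _ : Fin n => ρ) = (∫ x, Real.exp (u * x) ∂ρ) ^ n := by
      simp only [one_mul]
      rw [integral_fintype_prod_eq_prod (fun (_ : Fin n) (y : ℝ) => Real.exp (u * y))]
      simp
    rw [← ofReal_integral_eq_lintegral_ofReal (f1.const_mul _) (ae_of_all _ fun x => by positivity),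
      integral_const_mul, f2]
    apply ENNReal.ofReal_le_ofReal
    have hab : u ^ (2 * κ) = |u| ^ (2 * κ) := by rw [pow_mul |u|, sq_abs, ← pow_mul]
    have h1 : u ^ (2 * κ) ≤ δ * (1 / n) := by
      rw [hab, ← r3]
      calc |u| ^ (2 * κ) ≤ (δ * r) ^ (2 * κ) := pow_le_pow_left₀ (abs_nonneg _) hu1 _
        _ = δ ^ (2 * κ) * r ^ (2 * κ) := mul_pow _ _ _
        _ ≤ δ * r ^ (2 * κ) := by
          apply mul_le_mul_of_nonneg_right _ (by positivity)
          exact pow_le_of_le_one hδ0.le hδ1 (by omega)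
    have h2 : C0 * u ^ (2 * κ) ≤ 1 / 2 * (1 / n) := by
      calc C0 * u ^ (2 * κ) ≤ C0 * (δ * (1 / n)) := mul_le_mul_of_nonneg_left h1 hC0.le
        _ = (C0 * δ) * (1 / n) := by ring
        _ ≤ _ := mul_le_mul_of_nonneg_right hδC (by positivity)
    have hni : 1 / (n:ℝ) ≤ 1 := by rw [div_le_one hn']; exact hn1
    have h3 : 0 ≤ 1 - C0 * u ^ (2 * κ) := by linarith
    have h4 : 1 / 2 ≤ (1 - C0 * u ^ (2 * κ)) ^ n := by
      have hb := one_add_mul_le_pow (a := -(C0 * u ^ (2 * κ))) (by linarith) n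
      have : (n:ℝ) * (C0 * u ^ (2 * κ)) ≤ 1 / 2 := by
        calc _ ≤ (n:ℝ) * (1 / 2 * (1 / n)) := mul_le_mul_of_nonneg_left h2 hn'.le
          _ = 1 / 2 := by field_simp
      rw [← sub_eq_add_neg] at hb
      linarith
    have h5 := pow_le_pow_left₀ (by positivity) (H3 u (hu1.trans (by nlinarith))) n
    rw [mul_pow, ← Real.exp_nat_mul] at h5
    calc (1:ℝ) / 2 ≤ (1 - C0 * u ^ (2 * κ)) ^ n := h4
      _ = Real.exp (-((n:ℝ) / (2 * β)) * u ^ 2) * (Real.exp (n * (u ^ 2 / (2 * β))) * (1 - C0 * u ^ (2 * κ)) ^ n) := by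
        rw [← mul_assoc, ← Real.exp_add]
        have : -((n:ℝ) / (2 * β)) * u ^ 2 + n * (u ^ 2 / (2 * β)) = 0 := by ring
        rw [this]; simp
      _ ≤ _ := mul_le_mul_of_nonneg_left h5 (Real.exp_pos _).le
  calc ENNReal.ofReal (δ * r) = ENNReal.ofReal (1 / 2) * volume (Icc (-(δ * r)) (δ * r)) := by
        rw [Real.volume_Icc, ← ENNReal.ofReal_mul (by norm_num)]; congr 1; ring
    _ = ∫⁻ u in Icc (-(δ * r)) (δ * r), ENNReal.ofReal (1 / 2) := by rw [setLIntegral_const]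
    _ ≤ ∫⁻ u in Icc (-(δ * r)) (δ * r), _ := setLIntegral_mono' measurableSet_Icc hpt
    _ ≤ _ := setLIntegral_le_lintegral _ _

lemma aux_core (ρ : Measure ℝ) [IsProbabilityMeasure ρ]
    (hmean : ∫ x, x ∂ρ = 0) (hvar : ∫ x, x ^ 2 ∂ρ = 1) (a : ℝ) (ha : 0 < a)
    (hE : Integrable (fun x => (1 + |x|) ^ 6 * Real.exp (2 * a * x ^ 2)) ρ)
    (hI : ∀ t : ℝ, Integrable (fun x => Real.exp (t * x)) ρ)
    (β : ℝ) (hβ : 0 < β) (κ : ℕ) (hκ : 1 ≤ κ) (b0 c : ℝ) (hc : 0 < c)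
    (H1 : ∀ u : ℝ, |u| ≤ b0 → ∫ x, Real.exp (u * x) ∂ρ ≤ Real.exp (u ^ 2 / (2 * β) - c * u ^ (2 * κ)))
    (H2 : ∀ u : ℝ, b0 < |u| → ∫ x, Real.exp (u * x) ∂ρ ≤ Real.exp (u ^ 2 / (2 * β) - c * u ^ 2))
    (C0 : ℝ) (hC0 : 0 < C0)
    (H3 : ∀ u : ℝ, |u| ≤ 1 → Real.exp (u ^ 2 / (2 * β)) * (1 - C0 * u ^ (2 * κ)) ≤ ∫ x, Real.exp (u * x) ∂ρ) :
    ∃ C : ℝ, 0 < C ∧ ∃ N : ℕ, ∀ n : ℕ, N ≤ n → 0 < n →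
      Integrable (fun x : Fin n → ℝ => Real.exp (β * (∑ i, x i) ^ 2 / (2 * n))) (Measure.pi fun _ : Fin n => ρ) ∧
      Integrable (fun x : Fin n → ℝ => (((∑ i, (x i ^ 2 - 1)) / n) ^ 2 + ((∑ i, x i) / n) ^ 2) *
        Real.exp (β * (∑ i, x i) ^ 2 / (2 * n))) (Measure.pi fun _ : Fin n => ρ) ∧
      0 < ∫ x : Fin n → ℝ, Real.exp (β * (∑ i, x i) ^ 2 / (2 * n)) ∂(Measure.pi fun _ : Fin n => ρ) ∧
      ∫ x : Fin n → ℝ, (((∑ i, (x i ^ 2 - 1)) / n) ^ 2 + ((∑ i, x i) / n) ^ 2) *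
        Real.exp (β * (∑ i, x i) ^ 2 / (2 * n)) ∂(Measure.pi fun _ : Fin n => ρ) ≤
      C * ((n : ℝ) ^ (-(1 / (2 * (κ : ℝ))))) ^ 2 *
        ∫ x : Fin n → ℝ, Real.exp (β * (∑ i, x i) ^ 2 / (2 * n)) ∂(Measure.pi fun _ : Fin n => ρ) := by
  obtain ⟨C, hC, N, hU⟩ := aux_upper ρ hmean hvar a ha hE hI β hβ κ hκ b0 c hc H1 H2
  obtain ⟨δ, hδ, hL⟩ := aux_lower ρ hI β hβ κ hκ C0 hC0 H3
  refine ⟨C / δ, by positivity, N, fun n hnN hn => ?_⟩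
  have hn' : (0:ℝ) < n := by exact_mod_cast hn
  obtain ⟨r0, r1, r2, r3⟩ := aux_r κ n hκ hn
  have hU := hU n hnN hn
  have hL := hL n hn
  set r := (n : ℝ) ^ (-(1 / (2 * (κ : ℝ)))) with hr
  have hexp : ∀ S : ℝ, S ^ 2 / (4 * ((n:ℝ) / (2 * β))) = β * S ^ 2 / (2 * n) := fun S => by
    field_simp; ring
  simp only [hexp, one_mul] at hU hL
  set s := √(Real.pi / ((n:ℝ) / (2 * β))) with hs
  have hs0 : 0 < s := Real.sqrt_pos.2 (by have := Real.pi_pos; positivity)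
  set P := Measure.pi fun _ : Fin n => ρ with hP
  set e : (Fin n → ℝ) → ℝ := fun x => Real.exp (β * (∑ i, x i) ^ 2 / (2 * n)) with he
  set F : (Fin n → ℝ) → ℝ := fun x => ((∑ i, (x i ^ 2 - 1)) / n) ^ 2 + ((∑ i, x i) / n) ^ 2 with hF
  have he0 : ∀ x, 0 < e x := fun x => Real.exp_pos _
  have hF0 : ∀ x, 0 ≤ F x := fun x => by simp only [hF]; positivity
  have hec : Continuous e := by simp only [he]; fun_prop
  have hFc : Continuous F := by simp only [hF]; fun_prop
  change ENNReal.ofReal s * ∫⁻ x, ENNReal.ofReal ((F x + 1 / n) * e x) ∂P ≤ _ at hU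
  change _ ≤ ENNReal.ofReal s * ∫⁻ x, ENNReal.ofReal (e x) ∂P at hL
  have iGe : Integrable (fun x => (F x + 1 / n) * e x) P := by
    refine ⟨Continuous.aestronglyMeasurable (by fun_prop), ?_⟩
    rw [hasFiniteIntegral_iff_ofReal (ae_of_all _ fun x => by
      have := hF0 x; have := he0 x; positivity)]
    by_contra h
    rw [not_lt, top_le_iff] at h
    rw [h, ENNReal.mul_top (by simpa using hs0)] at hU
    exact absurd hU (by simp)
  have hee : ∀ x, e x ≤ n * ((F x + 1 / n) * e x) := fun x => by
    have : n * ((F x + 1 / n) * e x) = e x + n * F x * e x := by field_simp; ring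
    rw [this]
    have := mul_nonneg (mul_nonneg hn'.le (hF0 x)) (he0 x).le
    linarith
  have ie : Integrable e P := (iGe.const_mul (n:ℝ)).mono' hec.aestronglyMeasurable
    (ae_of_all _ fun x => by rw [Real.norm_eq_abs, abs_of_pos (he0 x)]; exact hee x)
  have hFG : ∀ x, F x * e x ≤ (F x + 1 / n) * e x := fun x =>
    mul_le_mul_of_nonneg_right (by have : 0 < 1 / (n:ℝ) := by positivity
                                   linarith) (he0 x).le
  have iFe : Integrable (fun x => F x * e x) P := iGe.mono' (hFc.mul hec).aestronglyMeasurable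
    (ae_of_all _ fun x => by
      rw [Real.norm_eq_abs, abs_of_nonneg (mul_nonneg (hF0 x) (he0 x).le)]; exact hFG x)
  rw [← ofReal_integral_eq_lintegral_ofReal iGe (ae_of_all _ fun x => by
      have := hF0 x; have := he0 x; positivity), ← ENNReal.ofReal_mul hs0.le,
      ENNReal.ofReal_le_ofReal_iff (by positivity)] at hU
  rw [← ofReal_integral_eq_lintegral_ofReal ie (ae_of_all _ fun x => (he0 x).le),
      ← ENNReal.ofReal_mul hs0.le,
      ENNReal.ofReal_le_ofReal_iff (mul_nonneg hs0.le (integral_nonneg fun x => (he0 x).le))] at hL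
  have hZ : 0 < ∫ x, e x ∂P := by
    by_contra h
    have : s * ∫ x, e x ∂P ≤ 0 := mul_nonpos_of_nonneg_of_nonpos hs0.le (not_lt.1 h)
    have : 0 < δ * r := by positivity
    linarith
  refine ⟨ie, iFe, hZ, ?_⟩
  have h1 : ∫ x, F x * e x ∂P ≤ ∫ x, (F x + 1 / n) * e x ∂P := integral_mono iFe iGe hFG
  refine h1.trans ?_
  refine le_of_mul_le_mul_left ?_ hs0
  calc s * ∫ x, (F x + 1 / n) * e x ∂P ≤ C * r ^ 3 := hU
    _ = C / δ * r ^ 2 * (δ * r) := by field_simp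
    _ ≤ C / δ * r ^ 2 * (s * ∫ x, e x ∂P) := mul_le_mul_of_nonneg_left hL (by positivity)
    _ = s * (C / δ * r ^ 2 * ∫ x, e x ∂P) := by ring

lemma aux_main (ρ : Measure ℝ) [IsProbabilityMeasure ρ]
    (hmean : ∫ x, x ∂ρ = 0) (hvar : ∫ x, x ^ 2 ∂ρ = 1) (a : ℝ) (ha : 0 < a)
    (hE : Integrable (fun x => (1 + |x|) ^ 6 * Real.exp (2 * a * x ^ 2)) ρ)
    (hI : ∀ t : ℝ, Integrable (fun x => Real.exp (t * x)) ρ)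
    (β : ℝ) (hβ : 0 < β) (hβ1 : β ≤ 1) (κ : ℕ) (hκ : 1 ≤ κ) (b0 c : ℝ) (hc : 0 < c)
    (H1 : ∀ u : ℝ, |u| ≤ b0 → ∫ x, Real.exp (u * x) ∂ρ ≤ Real.exp (u ^ 2 / (2 * β) - c * u ^ (2 * κ)))
    (H2 : ∀ u : ℝ, b0 < |u| → ∫ x, Real.exp (u * x) ∂ρ ≤ Real.exp (u ^ 2 / (2 * β) - c * u ^ 2))
    (C0 : ℝ) (hC0 : 0 < C0)
    (H3 : ∀ u : ℝ, |u| ≤ 1 → Real.exp (u ^ 2 / (2 * β)) * (1 - C0 * u ^ (2 * κ)) ≤ ∫ x, Real.exp (u * x) ∂ρ) :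
    ∃ C : ℝ, 0 < C ∧
        ∀ n : ℕ, 0 < n →
          (∫ x, |(1 / (n : ℝ)) *
              (∑ i, (x i ^ 2 -
                2 * x i * cwCondMoment ρ β n (fun y => y) (((∑ j, x j) - x i) / n) +
                cwCondMoment ρ β n (fun y => y ^ 2) (((∑ j, x j) - x i) / n))) - 2|
            ∂(cwMeasure ρ β n)) ≤ C * (n : ℝ) ^ (-(1 / (2 * (κ : ℝ)))) := by
  obtain ⟨C1, hC1, N, hcore⟩ := aux_core ρ hmean hvar a ha hE hI β hβ κ hκ b0 c hc H1 H2 C0 hC0 H3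
  obtain ⟨C2, hC2, hfg⟩ := aux_fg ρ hmean hvar β hβ hβ1 a ha hE
  obtain ⟨N2, hN2⟩ := exists_nat_ge (1 / (2 * a))
  set T : ℕ → ℝ := fun n => ∫ x, |(1 / (n : ℝ)) *
              (∑ i, (x i ^ 2 -
                2 * x i * cwCondMoment ρ β n (fun y => y) (((∑ j, x j) - x i) / n) +
                cwCondMoment ρ β n (fun y => y ^ 2) (((∑ j, x j) - x i) / n))) - 2|
            ∂(cwMeasure ρ β n) with hT
  set R : ℕ → ℝ := fun n => (n : ℝ) ^ (-(1 / (2 * (κ : ℝ)))) with hR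
  have hT0 : ∀ n, 0 ≤ T n := fun n => integral_nonneg fun x => abs_nonneg _
  have big : ∀ n : ℕ, N + N2 ≤ n → 0 < n → T n ≤ (3 + 15 * C2) * (1 + C1) * R n := by
    intro n hnN hn
    have hn' : (0:ℝ) < n := by exact_mod_cast hn
    obtain ⟨r0, r1, r2, r3⟩ := aux_r κ n hκ hn
    obtain ⟨ie, iFe, hZ, hle⟩ := hcore n (by omega) hn
    have hna : 1 / (2 * (n:ℝ)) ≤ a := by
      have h1 : (N2:ℝ) ≤ n := by exact_mod_cast (by omega : N2 ≤ n)
      have h2 := hN2.trans h1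
      rw [div_le_iff₀ (by positivity)] at h2
      rw [div_le_iff₀ (by positivity)]
      linarith
    change _ ≤ _ * (R n) ^ 2 * _ at hle
    change 0 < R n at r0
    change R n ≤ 1 at r1
    change _ ≤ (R n) ^ 2 at r2
    set r := R n with hr
    set P := Measure.pi fun _ : Fin n => ρ with hP
    set e : (Fin n → ℝ) → ℝ := fun x => Real.exp (β * (∑ i, x i) ^ 2 / (2 * n)) with he
    set F : (Fin n → ℝ) → ℝ := fun x => ((∑ i, (x i ^ 2 - 1)) / n) ^ 2 + ((∑ i, x i) / n) ^ 2 with hF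
    change ∫ x, F x * e x ∂P ≤ C1 * r ^ 2 * ∫ x, e x ∂P at hle
    change 0 < ∫ x, e x ∂P at hZ
    change Integrable (fun x => F x * e x) P at iFe
    set Z := ∫ x, e x ∂P with hZd
    have hcw : cwMeasure ρ β n = P.withDensity fun x => ENNReal.ofReal (e x / Z) := rfl
    have he0 : ∀ x, 0 < e x := fun x => Real.exp_pos _
    have hec : Continuous e := by simp only [he]; fun_prop
    simp only [hT]
    rw [hcw, integral_withDensity_eq_integral_toReal_smul
      (by fun_prop) (ae_of_all _ fun x => ENNReal.ofReal_lt_top)]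
    have hZe : ∀ x, (ENNReal.ofReal (e x / Z)).toReal = e x / Z := fun x =>
      ENNReal.toReal_ofReal (div_nonneg (he0 x).le hZ.le)
    simp only [hZe, smul_eq_mul]
    have iD : Integrable (fun x => (3 + 15 * C2) / Z * (r * e x + 1 / r * (F x * e x))) P :=
      ((ie.const_mul r).add (iFe.const_mul (1 / r))).const_mul _
    calc _ ≤ ∫ x, (3 + 15 * C2) / Z * (r * e x + 1 / r * (F x * e x)) ∂P := by
          refine integral_mono_of_nonneg
            (ae_of_all _ fun x => mul_nonneg (div_nonneg (he0 x).le hZ.le) (abs_nonneg _)) iD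
            (ae_of_all _ fun x => ?_)
          have hp := aux_point n hn x
            (fun i => cwCondMoment ρ β n (fun y => y) (((∑ j, x j) - x i) / n))
            (fun i => cwCondMoment ρ β n (fun y => y ^ 2) (((∑ j, x j) - x i) / n)) C2 r hC2 r0 r1 r2
            (fun i => (hfg n hn hna _).1) (fun i => (hfg n hn hna _).2)
          refine (mul_le_mul_of_nonneg_left hp (div_nonneg (he0 x).le hZ.le)).trans (le_of_eq ?_)
          simp only [hF]
          ring
      _ = (3 + 15 * C2) / Z * (r * Z + 1 / r * ∫ x, F x * e x ∂P) := by
          rw [integral_const_mul, integral_add (ie.const_mul r) (iFe.const_mul (1 / r)),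
            integral_const_mul, integral_const_mul]
      _ ≤ (3 + 15 * C2) / Z * (r * Z + 1 / r * (C1 * r ^ 2 * Z)) := by
          apply mul_le_mul_of_nonneg_left _ (by positivity)
          have : 1 / r * ∫ x, F x * e x ∂P ≤ 1 / r * (C1 * r ^ 2 * Z) :=
            mul_le_mul_of_nonneg_left hle (by positivity)
          linarith
      _ = (3 + 15 * C2) * (1 + C1) * r := by field_simp
  refine ⟨(3 + 15 * C2) * (1 + C1) + ∑ n ∈ Finset.range (N + N2), T n / R n, ?_, fun n hn => ?_⟩
  · have : 0 ≤ ∑ n ∈ Finset.range (N + N2), T n / R n :=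
      Finset.sum_nonneg fun n _ => div_nonneg (hT0 n) (by simp only [hR]; positivity)
    positivity
  · change T n ≤ _ * R n
    have hRn : 0 < R n := (aux_r κ n hκ hn).1
    have hsum : 0 ≤ ∑ n ∈ Finset.range (N + N2), T n / R n :=
      Finset.sum_nonneg fun n _ => div_nonneg (hT0 n) (by simp only [hR]; positivity)
    rcases le_or_gt (N + N2) n with h | h
    · refine (big n h hn).trans (mul_le_mul_of_nonneg_right (by linarith) hRn.le)
    · have h1 : T n / R n ≤ ∑ n ∈ Finset.range (N + N2), T n / R n :=
        Finset.single_le_sum (f := fun n => T n / R n)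
          (fun n _ => div_nonneg (hT0 n) (by simp only [hR]; positivity)) (Finset.mem_range.2 h)
      calc T n = T n / R n * R n := by field_simp
        _ ≤ _ := mul_le_mul_of_nonneg_right (by
          have : 0 < (3 + 15 * C2) * (1 + C1) := by positivity
          linarith) hRn.le

/-- Proposition 5.2.  For the Gibbs-sampler exchangeable pair
`(Sₙ, Sₙ')` of the Curie–Weiss model, the conditional second moment
`E((Sₙ - Sₙ')² ∣ 𝒳)(x) = (1/n) ∑ᵢ (xᵢ² - 2 xᵢ E(Xᵢ' ∣ 𝒳) + E(Xᵢ'² ∣ 𝒳))` satisfies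
`E|E((Sₙ-Sₙ')² ∣ 𝒳) - 2| ≤ C n^{-1/2}` for `0 < β < 1` and `≤ C n^{-1/(2k)}` at `β = 1`. -/
theorem curie_weiss_gibbs_conditional_variance
    (ρ : Measure ℝ) [IsProbabilityMeasure ρ]
    (hmean : ∫ x, x ∂ρ = 0) (hvar : ∫ x, x ^ 2 ∂ρ = 1) :
    (∀ β b : ℝ, 0 < β → β < 1 → β < b →
      (∀ t : ℝ, ∫ x, Real.exp (t * x) ∂ρ ≤ Real.exp (t ^ 2 / (2 * b))) →
      ∃ C : ℝ, 0 < C ∧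
        ∀ n : ℕ, 0 < n →
          (∫ x, |(1 / (n : ℝ)) *
              (∑ i, (x i ^ 2 -
                2 * x i * cwCondMoment ρ β n (fun y => y) (((∑ j, x j) - x i) / n) +
                cwCondMoment ρ β n (fun y => y ^ 2) (((∑ j, x j) - x i) / n))) - 2|
            ∂(cwMeasure ρ β n)) ≤ C * (n : ℝ) ^ (-(1 / 2) : ℝ)) ∧
    (∀ (k : ℕ), 1 ≤ k → ∀ lamρ : ℝ, 0 < lamρ →
      (∀ j : ℕ, j < 2 * k →
        (∫ x, x ^ j ∂(ProbabilityTheory.gaussianReal 0 1)) - ∫ x, x ^ j ∂ρ = 0) →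
      ((∫ x, x ^ (2 * k) ∂(ProbabilityTheory.gaussianReal 0 1)) -
        ∫ x, x ^ (2 * k) ∂ρ = lamρ) →
      ∀ b₀ b₁ b₂ : ℝ, 0 < b₀ → 0 < b₁ → 1 < b₂ →
      (∀ t : ℝ, |t| ≤ b₀ →
        ∫ x, Real.exp (t * x) ∂ρ ≤ Real.exp (t ^ 2 / 2 - b₁ * t ^ (2 * k))) →
      (∀ t : ℝ, b₀ < |t| →
        ∫ x, Real.exp (t * x) ∂ρ ≤ Real.exp (t ^ 2 / (2 * b₂))) →
      ∃ C : ℝ, 0 < C ∧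
        ∀ n : ℕ, 0 < n →
          (∫ x, |(1 / (n : ℝ)) *
              (∑ i, (x i ^ 2 -
                2 * x i * cwCondMoment ρ 1 n (fun y => y) (((∑ j, x j) - x i) / n) +
                cwCondMoment ρ 1 n (fun y => y ^ 2) (((∑ j, x j) - x i) / n))) - 2|
            ∂(cwMeasure ρ 1 n)) ≤ C * (n : ℝ) ^ (-(1 / (2 * (k : ℝ))))) := by
  constructor
  · intro β b hβ hβ1 hb hm
    by_cases hI : ∀ t : ℝ, Integrable (fun x => Real.exp (t * x)) ρ
    swap
    · refine ⟨1, one_pos, fun n hn => ?_⟩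
      rw [aux_zero ρ β hβ n hn hI, integral_zero_measure]
      positivity
    have hb0 : 0 < b := hβ.trans hb
    have hE := aux_E ρ b hb0 (aux_sq ρ b hb0 hI hm)
    have ha : 0 < b / 16 := by positivity
    obtain ⟨M, -, hM⟩ := aux_inner ρ hmean hvar (b / 16) ha hE hI
    have hc : 0 < 1 / (2 * β) - 1 / (2 * b) := by
      rw [sub_pos]; apply one_div_lt_one_div_of_lt <;> linarith
    have hexp : ∀ u : ℝ, u ^ 2 / (2 * β) - (1 / (2 * β) - 1 / (2 * b)) * u ^ 2 = u ^ 2 / (2 * b) :=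
      fun u => by ring
    have := aux_main ρ hmean hvar (b / 16) ha hE hI β hβ hβ1.le 1 le_rfl 1 _ hc
      (fun u _ => by rw [mul_one, hexp]; exact hm u)
      (fun u _ => by rw [hexp]; exact hm u) (1 / (2 * β)) (by positivity)
      (fun u _ => by
        refine le_trans ?_ (hM 1 one_pos u).1
        have h1 := Real.add_one_le_exp (-(u ^ 2 / (2 * β)))
        calc Real.exp (u ^ 2 / (2 * β)) * (1 - 1 / (2 * β) * u ^ (2 * 1))
            ≤ Real.exp (u ^ 2 / (2 * β)) * Real.exp (-(u ^ 2 / (2 * β))) := by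
              apply mul_le_mul_of_nonneg_left _ (Real.exp_pos _).le
              have : 1 / (2 * β) * u ^ (2 * 1) = u ^ 2 / (2 * β) := by ring
              linarith
          _ = 1 := by rw [← Real.exp_add]; simp)
    simpa using this
  · intro k hk lamρ hlam hmom htop b₀ b₁ b₂ hb₀ hb₁ hb₂ hm1 hm2
    by_cases hI : ∀ t : ℝ, Integrable (fun x => Real.exp (t * x)) ρ
    swap
    · refine ⟨1, one_pos, fun n hn => ?_⟩
      rw [aux_zero ρ 1 one_pos n hn hI, integral_zero_measure]
      positivity
    have hpow : ∀ t : ℝ, 0 ≤ t ^ (2 * k) := fun t => by rw [pow_mul]; positivity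
    have hm : ∀ t : ℝ, ∫ x, Real.exp (t * x) ∂ρ ≤ Real.exp (t ^ 2 / (2 * 1)) := by
      intro t
      rcases le_or_gt |t| b₀ with h | h
      · refine (hm1 t h).trans (Real.exp_le_exp.2 ?_)
        have := mul_nonneg hb₁.le (hpow t)
        rw [mul_one]; linarith
      · refine (hm2 t h).trans (Real.exp_le_exp.2 ?_)
        apply div_le_div_of_nonneg_left (sq_nonneg t) (by norm_num) (by linarith)
    have hE := aux_E ρ 1 one_pos (aux_sq ρ 1 one_pos hI hm)
    have hc2 : 0 < 1 / 2 - 1 / (2 * b₂) := by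
      rw [sub_pos]; apply one_div_lt_one_div_of_lt <;> linarith
    have hc : 0 < min b₁ (1 / 2 - 1 / (2 * b₂)) := lt_min hb₁ hc2
    obtain ⟨D1, hD1, hT1⟩ := aux_taylor ρ hI (2 * k)
    obtain ⟨D2, hD2, hT2⟩ := aux_taylor (gaussianReal 0 1)
      (fun t => integrable_exp_mul_gaussianReal t) (2 * k)
    have hgauss : ∀ u : ℝ, ∫ x, Real.exp (u * x) ∂(gaussianReal 0 1) = Real.exp (u ^ 2 / 2) := by
      intro u
      have h := mgf_gaussianReal (p := gaussianReal 0 1) (X := fun x => x) (μ := 0) (v := 1) (by simp) u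
      simpa [mgf] using h
    refine aux_main ρ hmean hvar (1 / 16) (by norm_num) hE hI 1 one_pos le_rfl k hk b₀ _ hc
      (fun u hu => ?_) (fun u hu => ?_) (D1 + D2 + 1) (by positivity) (fun u hu => ?_)
    · refine (hm1 u hu).trans (Real.exp_le_exp.2 ?_)
      have := mul_le_mul_of_nonneg_right (min_le_left b₁ (1 / 2 - 1 / (2 * b₂))) (hpow u)
      rw [mul_one]; linarith
    · refine (hm2 u hu).trans (Real.exp_le_exp.2 ?_)
      have := mul_le_mul_of_nonneg_right (min_le_right b₁ (1 / 2 - 1 / (2 * b₂))) (sq_nonneg u)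
      have e : (1 / 2 - 1 / (2 * b₂)) * u ^ 2 = u ^ 2 / 2 - u ^ 2 / (2 * b₂) := by ring
      rw [mul_one]; linarith
    · have h1 := hT1 u hu
      have h2 := hT2 u hu
      rw [hgauss] at h2
      have hs : ∑ j ∈ Finset.range (2 * k), u ^ j / (j.factorial : ℝ) * ∫ x, x ^ j ∂(gaussianReal 0 1) =
          ∑ j ∈ Finset.range (2 * k), u ^ j / (j.factorial : ℝ) * ∫ x, x ^ j ∂ρ :=
        Finset.sum_congr rfl fun j hj => by
          rw [sub_eq_zero.1 (hmom j (Finset.mem_range.1 hj))]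
      rw [hs] at h2
      have hab : |u| ^ (2 * k) = u ^ (2 * k) := by rw [pow_mul, sq_abs, ← pow_mul]
      rw [hab] at h1 h2
      have g1 := (abs_le.1 h1).1
      have g2 := (abs_le.1 h2).2
      have e1 : 1 ≤ Real.exp (u ^ 2 / 2) := Real.one_le_exp (by positivity)
      have e2 : (D1 + D2 + 1) * u ^ (2 * k) ≤ Real.exp (u ^ 2 / 2) * ((D1 + D2 + 1) * u ^ (2 * k)) :=
        le_mul_of_one_le_left (mul_nonneg (by positivity) (hpow u)) e1
      rw [mul_one, mul_sub, mul_one]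
      have := hpow u
      linarith
end

section
/- Let (X₁, ..., Xₙ) follow the Curie-Weiss joint law dP_{n,β} with 0 < β ≤ 1, let S_n = X₁ + ... + Xₙ, 𝒳 = σ(X₁,...,Xₙ), and let S_n' be the Gibbs-sampler resampled sum so that (S_n, S_n') is an exchangeable pair. Assume either (for 0 < β < 1) that there is b > β with ∫ e^{tx} dρ(x) ≤ e^{t²/(2b)} for all real t, or (for β = 1) that ρ is of type k with strength λ_ρ > 0 and there are constants b₀ > 0, b₁ > 0, b₂ > 1 with ∫ e^{tx} dρ(x) ≤ exp(t²/2 − b₁ t^{2k}) for |t| ≤ b₀ and ∫ e^{tx} dρ(x) ≤ exp(t²/(2b₂)) for |t| > b₀. Then there is a constant C not depending on n such that E| E( (S_n − S_n') |S_n − S_n'| | 𝒳 ) | ≤ C n^{-1/2}. -/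
open MeasureTheory ProbabilityTheory Filter Set

namespace CW

/-- polynomial weight -/
noncomputable def J (u : ℝ) : ℝ := 1 + u ^ 2

lemma one_le_J (u : ℝ) : 1 ≤ J u := by unfold J; nlinarith [sq_nonneg u]
lemma J_pos (u : ℝ) : 0 < J u := lt_of_lt_of_le one_pos (one_le_J u)
lemma J_meas : Measurable J := by unfold J; fun_prop
lemma J_cont : Continuous J := by unfold J; fun_prop

lemma J_pow_le_exp (q : ℕ) {κ : ℝ} (hκ : 0 < κ) :
    ∃ C : ℝ, 0 < C ∧ ∀ u : ℝ, J u ^ q ≤ C * Real.exp (κ * u ^ 2) := by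
  refine ⟨Nat.factorial q / κ ^ q * Real.exp κ, by positivity, fun u => ?_⟩
  have h := Real.pow_div_factorial_le_exp (κ * J u) (by have := J_pos u; positivity) q
  have e : Real.exp (κ * J u) = Real.exp κ * Real.exp (κ * u ^ 2) := by
    rw [← Real.exp_add]; congr 1; unfold J; ring
  rw [e, div_le_iff₀ (by positivity), mul_pow] at h
  rw [div_mul_eq_mul_div, div_mul_eq_mul_div, le_div_iff₀ (by positivity)]
  nlinarith

/-- Hubbard-Stratonovich -/
lemma hs {a : ℝ} (ha : 0 < a) (t : ℝ) :
    ∫⁻ m : ℝ, ENNReal.ofReal (√(a / (2 * Real.pi)) * Real.exp (-(a * m ^ 2 / 2)) *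
      Real.exp (t * m)) = ENNReal.ofReal (Real.exp (t ^ 2 / (2 * a))) := by
  have h1 : ∀ m : ℝ, √(a / (2 * Real.pi)) * Real.exp (-(a * m ^ 2 / 2)) * Real.exp (t * m)
      = √(a / (2 * Real.pi)) * Real.exp (t ^ 2 / (2 * a)) *
        Real.exp (-(a / 2) * (m - t / a) ^ 2) := by
    intro m
    rw [mul_assoc, mul_assoc, ← Real.exp_add, ← Real.exp_add]
    congr 2
    field_simp
    ring
  simp_rw [h1]
  have hi : Integrable (fun m : ℝ => Real.exp (-(a / 2) * (m - t / a) ^ 2)) :=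
    (integrable_exp_neg_mul_sq (by positivity : 0 < a / 2)).comp_sub_right (t / a)
  rw [← ofReal_integral_eq_lintegral_ofReal (hi.const_mul _)
    (ae_of_all _ fun m => by positivity), integral_const_mul,
    integral_sub_right_eq_self (fun m : ℝ => Real.exp (-(a / 2) * m ^ 2)), integral_gaussian]
  congr 1
  rw [mul_right_comm, ← Real.sqrt_mul (by positivity)]
  rw [show a / (2 * Real.pi) * (Real.pi / (a / 2)) = 1 by field_simp]
  simp

/-- generic: lintegral of product over pi -/
lemma lint_prod_pi {n : ℕ} (ρ : Measure ℝ) [IsProbabilityMeasure ρ] (f : Fin n → ℝ → ENNReal)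
    (hf : ∀ i, Measurable (f i)) :
    ∫⁻ x, ∏ i, f i (x i) ∂(Measure.pi fun _ : Fin n => ρ) = ∏ i, ∫⁻ y, f i y ∂ρ := by
  have h := lintegral_prod_eq_prod_lintegral_of_indepFun
    (μ := Measure.pi fun _ : Fin n => ρ) Finset.univ (fun i x => f i (x i))
    (iIndepFun_pi (X := f) fun i => (hf i).aemeasurable)
    (fun i => (hf i).comp (measurable_pi_apply i))
  rw [h]
  refine Finset.prod_congr rfl fun i _ => ?_
  exact (measurePreserving_eval (fun _ : Fin n => ρ) i).lintegral_comp (hf i)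

lemma pi_withDensity {n : ℕ} (ρ : Measure ℝ) [IsProbabilityMeasure ρ] (d : ℝ → ENNReal)
    (hd : Measurable d) [SigmaFinite (ρ.withDensity d)] :
    (Measure.pi fun _ : Fin n => ρ.withDensity d) =
      (Measure.pi fun _ : Fin n => ρ).withDensity fun x => ∏ i, d (x i) := by
  refine Measure.pi_eq fun s hs => ?_
  rw [withDensity_apply _ (MeasurableSet.univ_pi hs), ← lintegral_indicator (MeasurableSet.univ_pi hs)]
  have : ∀ x : Fin n → ℝ, (Set.univ.pi s).indicator (fun x => ∏ i, d (x i)) x =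
      ∏ i, (s i).indicator d (x i) := by
    intro x
    by_cases hx : x ∈ Set.univ.pi s
    · rw [Set.indicator_of_mem hx]
      exact Finset.prod_congr rfl fun i _ => (Set.indicator_of_mem (hx i trivial) _).symm
    · rw [Set.indicator_of_notMem hx]
      simp only [Set.mem_pi, Set.mem_univ, true_imp_iff, not_forall] at hx
      obtain ⟨i, hi⟩ := hx
      exact (Finset.prod_eq_zero (Finset.mem_univ i) (Set.indicator_of_notMem hi _)).symm
  simp_rw [this]
  rw [lint_prod_pi ρ _ fun i => hd.indicator (hs i)]
  refine Finset.prod_congr rfl fun i _ => ?_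
  rw [lintegral_indicator (hs i), withDensity_apply _ (hs i)]

lemma tilted_pi {n : ℕ} (ρ : Measure ℝ) [IsProbabilityMeasure ρ] (t : ℝ)
    (hi : Integrable (fun y => Real.exp (t * y)) ρ) (F : (Fin n → ℝ) → ENNReal) :
    ∫⁻ x, ENNReal.ofReal (Real.exp (t * ∑ i, x i)) * F x ∂(Measure.pi fun _ : Fin n => ρ) =
      ENNReal.ofReal (∫ y, Real.exp (t * y) ∂ρ) ^ n *
        ∫⁻ x, F x ∂(Measure.pi fun _ : Fin n => ρ.tilted (fun y => t * y)) := by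
  have hM : 0 < ∫ y, Real.exp (t * y) ∂ρ := integral_exp_pos hi
  have := isProbabilityMeasure_tilted hi
  have hd : Measurable (fun y => ENNReal.ofReal (Real.exp (t * y) / ∫ y, Real.exp (t * y) ∂ρ)) := by
    fun_prop
  have e : ρ.tilted (fun y => t * y) = ρ.withDensity
    (fun y => ENNReal.ofReal (Real.exp (t * y) / ∫ y, Real.exp (t * y) ∂ρ)) := rfl
  rw [e] at this ⊢
  rw [pi_withDensity ρ _ hd, lintegral_withDensity_eq_lintegral_mul_non_measurable _
    (by fun_prop) (ae_of_all _ fun x => ENNReal.prod_lt_top fun i _ => ENNReal.ofReal_lt_top),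
    ← lintegral_const_mul' _ _ (by simp)]
  refine lintegral_congr fun x => ?_
  simp only [Pi.mul_apply]
  rw [← mul_assoc]
  congr 1
  rw [← ENNReal.ofReal_prod_of_nonneg (fun i _ => by positivity), ← ENNReal.ofReal_pow hM.le,
    ← ENNReal.ofReal_mul (by positivity), Finset.prod_div_distrib, ← Real.exp_sum, Finset.mul_sum]
  congr 1
  simp
  field_simp


/-- standing assumptions -/
structure Good (ρ : Measure ℝ) (β R δ c : ℝ) : Prop where
  hβ0 : 0 < β
  hβ1 : β ≤ 1
  hmean : ∫ x, x ∂ρ = 0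
  hid : Integrable (fun x => x) ρ
  H : ∀ t : ℝ, Integrable (fun x => Real.exp (t * x)) ρ
  hR : 0 ≤ R
  hδ0 : 0 < δ
  tail : ∀ m : ℝ, R < |m| → ∫ x, Real.exp (β * m * x) ∂ρ ≤ Real.exp (β * m ^ 2 * (1 - δ) / 2)
  hc : β < c
  hexp : Integrable (fun y => Real.exp (c / 2 * y ^ 2)) ρ

section single
variable {ρ : Measure ℝ} [IsProbabilityMeasure ρ] {β R δ c : ℝ}

lemma wint (hG : Good ρ β R δ c) (q : ℕ) {a : ℝ} (ha : a ≤ β / 2) (s : ℝ) :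
    Integrable (fun y => J y ^ q * Real.exp (a * y ^ 2 + β * s * y)) ρ := by
  have hc := hG.hc
  set κ := (c - β) / 8 with hκ
  have hκ0 : 0 < κ := by rw [hκ]; linarith
  obtain ⟨C, hC, hJ⟩ := J_pow_le_exp q hκ0
  refine (hG.hexp.const_mul (C * Real.exp ((β * s) ^ 2 / (4 * κ)))).mono'
    ((J_meas.pow_const q).mul (by fun_prop)).aestronglyMeasurable (ae_of_all _ fun y => ?_)
  have := J_pos y
  rw [Real.norm_of_nonneg (by positivity)]
  calc J y ^ q * Real.exp (a * y ^ 2 + β * s * y)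
      ≤ (C * Real.exp (κ * y ^ 2)) * Real.exp (a * y ^ 2 + β * s * y) := by gcongr; exact hJ y
    _ = C * Real.exp (κ * y ^ 2 + (a * y ^ 2 + β * s * y)) := by rw [mul_assoc, ← Real.exp_add]
    _ ≤ C * Real.exp ((β * s) ^ 2 / (4 * κ) + c / 2 * y ^ 2) := by
        refine mul_le_mul_of_nonneg_left (Real.exp_le_exp.2 ?_) hC.le
        have h1 : β * s * y ≤ κ * y ^ 2 + (β * s) ^ 2 / (4 * κ) := by
          have : κ * y ^ 2 + (β * s) ^ 2 / (4 * κ) - β * s * y =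
            (2 * κ * y - β * s) ^ 2 / (4 * κ) := by field_simp; ring
          have h2 : 0 ≤ (2 * κ * y - β * s) ^ 2 / (4 * κ) := by positivity
          linarith
        have h3 : (κ + κ + a) * y ^ 2 ≤ c / 2 * y ^ 2 := by
          gcongr; linarith
        linarith
    _ = _ := by rw [Real.exp_add]; ring

lemma wint0 (hG : Good ρ β R δ c) {a : ℝ} (ha : a ≤ β / 2) (s : ℝ) :
    Integrable (fun y => Real.exp (a * y ^ 2 + β * s * y)) ρ := by
  simpa using wint hG 0 ha s

lemma one_le_Z (hG : Good ρ β R δ c) {a : ℝ} (ha0 : 0 ≤ a) (ha : a ≤ β / 2) (s : ℝ) :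
    1 ≤ ∫ y, Real.exp (a * y ^ 2 + β * s * y) ∂ρ := by
  have h : ∫ y, (1 + β * s * y) ∂ρ ≤ ∫ y, Real.exp (a * y ^ 2 + β * s * y) ∂ρ := by
    refine integral_mono ((integrable_const 1).add (hG.hid.const_mul _)) (wint0 hG ha s) fun y => ?_
    have h1 := Real.add_one_le_exp (a * y ^ 2 + β * s * y)
    have : 0 ≤ a * y ^ 2 := by positivity
    simp only
    linarith
  rw [integral_add (integrable_const 1) (hG.hid.const_mul _), integral_const_mul, hG.hmean] at h
  simpa using h

lemma moment (hG : Good ρ β R δ c) (q : ℕ) :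
    ∃ K : ℝ, 0 < K ∧ ∀ a s : ℝ, 0 ≤ a → a ≤ β / 2 →
      ∫ y, J y ^ q * Real.exp (a * y ^ 2 + β * s * y) ∂ρ ≤
        K * J s ^ q * ∫ y, Real.exp (a * y ^ 2 + β * s * y) ∂ρ := by
  have hc := hG.hc
  have hβ0 := hG.hβ0
  have hβ1 := hG.hβ1
  set κ := (c - β) / 8 with hκ
  have hκ0 : 0 < κ := by rw [hκ]; linarith
  obtain ⟨C, hC, hJ⟩ := J_pow_le_exp q hκ0
  set A := 1 + 1 / κ with hA
  have hA1 : 1 ≤ A := by rw [hA]; have : 0 < 1 / κ := by positivity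
                         linarith
  have hAκ : 1 ≤ κ * A := by rw [hA]; field_simp; linarith
  have hI : 0 ≤ ∫ y, Real.exp (c / 2 * y ^ 2) ∂ρ := integral_nonneg fun y => (Real.exp_pos _).le
  refine ⟨(A ^ 2) ^ q + C * ∫ y, Real.exp (c / 2 * y ^ 2) ∂ρ, by positivity, fun a s ha0 ha => ?_⟩
  have hZ := one_le_Z hG ha0 ha s
  have hJs := one_le_J s
  have hJq : 1 ≤ J s ^ q := one_le_pow₀ hJs
  calc ∫ y, J y ^ q * Real.exp (a * y ^ 2 + β * s * y) ∂ρ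
      ≤ ∫ y, ((A ^ 2 * J s) ^ q * Real.exp (a * y ^ 2 + β * s * y)
          + C * Real.exp (c / 2 * y ^ 2)) ∂ρ := by
        refine integral_mono (wint hG q ha s)
          (((wint0 hG ha s).const_mul _).add (hG.hexp.const_mul _)) fun y => ?_
        have hJy := J_pos y
        simp only
        by_cases hy : |y| ≤ A * |s|
        · have : J y ≤ A ^ 2 * J s := by
            unfold J
            have h2 : y ^ 2 ≤ A ^ 2 * s ^ 2 := by
              rw [← sq_abs y, ← sq_abs s, ← mul_pow]; gcongr
            nlinarith
          have h3 : J y ^ q ≤ (A ^ 2 * J s) ^ q := by gcongr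
          have h4 : 0 < C * Real.exp (c / 2 * y ^ 2) := by positivity
          have := mul_le_mul_of_nonneg_right h3 (Real.exp_pos (a * y ^ 2 + β * s * y)).le
          linarith
        · push Not at hy
          have h1 : β * s * y ≤ κ * y ^ 2 := by
            have h5 : s * y ≤ |s| * |y| := by rw [← abs_mul]; exact le_abs_self _
            have h6 : |s| * |y| ≤ κ * |y| ^ 2 := by
              have : |s| ≤ κ * |y| := by
                have h7 : κ * (A * |s|) ≤ κ * |y| := by gcongr
                nlinarith [abs_nonneg s]
              nlinarith [abs_nonneg y]
            rw [sq_abs] at h6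
            have h8 : 0 ≤ κ * y ^ 2 := by positivity
            nlinarith
          have h3 : (κ + κ + a) * y ^ 2 ≤ c / 2 * y ^ 2 := by
            gcongr; linarith
          have h4 : 0 ≤ (A ^ 2 * J s) ^ q * Real.exp (a * y ^ 2 + β * s * y) := by positivity
          calc J y ^ q * Real.exp (a * y ^ 2 + β * s * y)
            ≤ (C * Real.exp (κ * y ^ 2)) * Real.exp (a * y ^ 2 + β * s * y) := by gcongr; exact hJ y
            _ = C * Real.exp (κ * y ^ 2 + (a * y ^ 2 + β * s * y)) := by
              rw [mul_assoc, ← Real.exp_add]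
            _ ≤ C * Real.exp (c / 2 * y ^ 2) := by gcongr; linarith
            _ ≤ _ := by linarith
    _ = (A ^ 2) ^ q * J s ^ q * (∫ y, Real.exp (a * y ^ 2 + β * s * y) ∂ρ)
          + C * ∫ y, Real.exp (c / 2 * y ^ 2) ∂ρ := by
        rw [integral_add ((wint0 hG ha s).const_mul _) (hG.hexp.const_mul _),
          integral_const_mul, integral_const_mul, mul_pow]
    _ ≤ _ := by
        have h9 : 1 ≤ J s ^ q * ∫ y, Real.exp (a * y ^ 2 + β * s * y) ∂ρ := by nlinarith
        have : 0 ≤ C * ∫ y, Real.exp (c / 2 * y ^ 2) ∂ρ := by positivity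
        nlinarith

lemma exp_sub_le (a b : ℝ) : |Real.exp a - Real.exp b| ≤ |a - b| * (Real.exp a + Real.exp b) := by
  have key : ∀ a b : ℝ, b ≤ a → Real.exp a - Real.exp b ≤ (a - b) * Real.exp a := by
    intro a b _
    have h := Real.add_one_le_exp (b - a)
    have h2 : Real.exp b = Real.exp (b - a) * Real.exp a := by rw [← Real.exp_add]; congr 1; ring
    have := Real.exp_pos a
    nlinarith
  have pa := Real.exp_pos a
  have pb := Real.exp_pos b
  rcases le_total b a with h | h
  · have h0 := Real.exp_le_exp.2 h
    rw [abs_of_nonneg (by linarith), abs_of_nonneg (by linarith)]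
    nlinarith [key a b h]
  · have h0 := Real.exp_le_exp.2 h
    rw [abs_of_nonpos (by linarith), abs_of_nonpos (by linarith)]
    nlinarith [key b a h]

lemma int_four {f₁ f₂ f₃ f₄ : ℝ → ℝ} (h₁ : Integrable f₁ ρ) (h₂ : Integrable f₂ ρ)
    (h₃ : Integrable f₃ ρ) (h₄ : Integrable f₄ ρ) {a b d e : ℝ} :
    ∫ z, (a * f₁ z + b * f₂ z + (d * f₃ z + e * f₄ z)) ∂ρ =
      a * (∫ z, f₁ z ∂ρ) + b * (∫ z, f₂ z ∂ρ) + (d * (∫ z, f₃ z ∂ρ) + e * (∫ z, f₄ z ∂ρ)) := by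
  have i12 : Integrable (fun z => a * f₁ z + b * f₂ z) ρ := (h₁.const_mul a).add (h₂.const_mul b)
  have i34 : Integrable (fun z => d * f₃ z + e * f₄ z) ρ := (h₃.const_mul d).add (h₄.const_mul e)
  rw [integral_add i12 i34, integral_add (h₁.const_mul a) (h₂.const_mul b),
    integral_add (h₃.const_mul d) (h₄.const_mul e),
    integral_const_mul, integral_const_mul, integral_const_mul, integral_const_mul]

/-- comparison of two exponentially weighted averages -/
lemma diff_bound (q₁ q₂ φ : ℝ → ℝ) {A ε : ℝ} (hA : 0 ≤ A) (hε : 0 ≤ ε)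
    (hφ : ∀ y, |φ y| ≤ A * J y) (hq : ∀ y, |q₁ y - q₂ y| ≤ ε * J y)
    (hφm : Measurable φ)
    (h1 : ∀ q : ℕ, Integrable (fun y => J y ^ q * Real.exp (q₁ y)) ρ)
    (h2 : ∀ q : ℕ, Integrable (fun y => J y ^ q * Real.exp (q₂ y)) ρ) :
    |(∫ y, φ y * Real.exp (q₁ y) ∂ρ) / (∫ y, Real.exp (q₁ y) ∂ρ)
      - (∫ y, φ y * Real.exp (q₂ y) ∂ρ) / (∫ y, Real.exp (q₂ y) ∂ρ)| ≤
    A * ε * ((∫ y, J y ^ 2 * Real.exp (q₁ y) ∂ρ) / (∫ y, Real.exp (q₁ y) ∂ρ)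
      + (∫ y, J y ^ 2 * Real.exp (q₂ y) ∂ρ) / (∫ y, Real.exp (q₂ y) ∂ρ)
      + 2 * ((∫ y, J y ^ 1 * Real.exp (q₁ y) ∂ρ) / (∫ y, Real.exp (q₁ y) ∂ρ))
        * ((∫ y, J y ^ 1 * Real.exp (q₂ y) ∂ρ) / (∫ y, Real.exp (q₂ y) ∂ρ))) := by
  have h10 : Integrable (fun y => Real.exp (q₁ y)) ρ := by simpa using h1 0
  have h20 : Integrable (fun y => Real.exp (q₂ y)) ρ := by simpa using h2 0
  have hp1 := integral_exp_pos h10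
  have hp2 := integral_exp_pos h20
  have i1 : Integrable (fun y => φ y * Real.exp (q₁ y)) ρ := by
    refine ((h1 1).const_mul A).mono' (hφm.aestronglyMeasurable.mul h10.1) (ae_of_all _ fun y => ?_)
    rw [norm_mul, Real.norm_eq_abs, Real.norm_of_nonneg (Real.exp_pos _).le, pow_one, ← mul_assoc]
    gcongr; exact hφ y
  have i2 : Integrable (fun y => φ y * Real.exp (q₂ y)) ρ := by
    refine ((h2 1).const_mul A).mono' (hφm.aestronglyMeasurable.mul h20.1) (ae_of_all _ fun y => ?_)
    rw [norm_mul, Real.norm_eq_abs, Real.norm_of_nonneg (Real.exp_pos _).le, pow_one, ← mul_assoc]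
    gcongr; exact hφ y
  set Z₁ := ∫ y, Real.exp (q₁ y) ∂ρ with hZ1
  set Z₂ := ∫ y, Real.exp (q₂ y) ∂ρ with hZ2
  set B₁ := ∫ y, J y ^ 1 * Real.exp (q₁ y) ∂ρ with hB1
  set B₂ := ∫ y, J y ^ 1 * Real.exp (q₂ y) ∂ρ with hB2
  have inner : ∀ y, |Real.exp (q₁ y) * Z₂ - Real.exp (q₂ y) * Z₁| ≤
      ε * (J y * (Real.exp (q₁ y) * Z₂ + Real.exp (q₂ y) * Z₁) +
        (Real.exp (q₁ y) * B₂ + Real.exp (q₂ y) * B₁)) := by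
    intro y
    have e1 : Real.exp (q₁ y) * Z₂ - Real.exp (q₂ y) * Z₁ =
        ∫ z, (Real.exp (q₁ y) * Real.exp (q₂ z) - Real.exp (q₂ y) * Real.exp (q₁ z)) ∂ρ := by
      rw [integral_sub (h20.const_mul _) (h10.const_mul _), integral_const_mul, integral_const_mul]
    have e2 : ε * (J y * (Real.exp (q₁ y) * Z₂ + Real.exp (q₂ y) * Z₁) +
        (Real.exp (q₁ y) * B₂ + Real.exp (q₂ y) * B₁)) =
        ∫ z, ((ε * J y * Real.exp (q₁ y)) * Real.exp (q₂ z)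
          + (ε * J y * Real.exp (q₂ y)) * Real.exp (q₁ z)
          + ((ε * Real.exp (q₁ y)) * (J z ^ 1 * Real.exp (q₂ z))
          + (ε * Real.exp (q₂ y)) * (J z ^ 1 * Real.exp (q₁ z)))) ∂ρ := by
      rw [int_four h20 h10 (h2 1) (h1 1)]
      ring
    rw [e1, e2]
    refine (abs_integral_le_integral_abs).trans (integral_mono
      ((h20.const_mul _).sub (h10.const_mul _)).abs
      (((h20.const_mul _).add (h10.const_mul _)).add
        (((h2 1).const_mul _).add ((h1 1).const_mul _))) fun z => ?_)
    have h := exp_sub_le (q₁ y + q₂ z) (q₂ y + q₁ z)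
    rw [Real.exp_add, Real.exp_add] at h
    have h3 : |q₁ y + q₂ z - (q₂ y + q₁ z)| ≤ ε * J y + ε * J z := by
      rw [show q₁ y + q₂ z - (q₂ y + q₁ z) = (q₁ y - q₂ y) - (q₁ z - q₂ z) by ring]
      exact (abs_sub _ _).trans (add_le_add (hq y) (hq z))
    simp only
    refine h.trans ?_
    refine (mul_le_mul_of_nonneg_right h3 (by positivity)).trans (le_of_eq ?_)
    ring
  have outer : |(∫ y, φ y * Real.exp (q₁ y) ∂ρ) * Z₂ - (∫ y, φ y * Real.exp (q₂ y) ∂ρ) * Z₁| ≤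
      A * ε * ((∫ y, J y ^ 2 * Real.exp (q₁ y) ∂ρ) * Z₂ + (∫ y, J y ^ 2 * Real.exp (q₂ y) ∂ρ) * Z₁
        + 2 * B₁ * B₂) := by
    have e1 : (∫ y, φ y * Real.exp (q₁ y) ∂ρ) * Z₂ - (∫ y, φ y * Real.exp (q₂ y) ∂ρ) * Z₁ =
        ∫ y, ((φ y * Real.exp (q₁ y)) * Z₂ - (φ y * Real.exp (q₂ y)) * Z₁) ∂ρ := by
      rw [integral_sub (i1.mul_const _) (i2.mul_const _), integral_mul_const, integral_mul_const]
    have e2 : A * ε * ((∫ y, J y ^ 2 * Real.exp (q₁ y) ∂ρ) * Z₂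
        + (∫ y, J y ^ 2 * Real.exp (q₂ y) ∂ρ) * Z₁ + 2 * B₁ * B₂) =
        ∫ y, ((A * ε * Z₂) * (J y ^ 2 * Real.exp (q₁ y))
          + (A * ε * Z₁) * (J y ^ 2 * Real.exp (q₂ y))
          + ((A * ε * B₂) * (J y ^ 1 * Real.exp (q₁ y))
          + (A * ε * B₁) * (J y ^ 1 * Real.exp (q₂ y)))) ∂ρ := by
      rw [int_four (h1 2) (h2 2) (h1 1) (h2 1)]
      ring
    rw [e1, e2]
    refine (abs_integral_le_integral_abs).trans (integral_mono
      ((i1.mul_const _).sub (i2.mul_const _)).abs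
      ((((h1 2).const_mul _).add ((h2 2).const_mul _)).add
        (((h1 1).const_mul _).add ((h2 1).const_mul _))) fun y => ?_)
    simp only
    rw [mul_assoc, mul_assoc (φ y), ← mul_sub, abs_mul]
    have hJ := J_pos y
    refine (mul_le_mul (hφ y) (inner y) (abs_nonneg _) (by positivity)).trans (le_of_eq ?_)
    ring
  rw [div_sub_div _ _ hp1.ne' hp2.ne', abs_div, abs_of_pos (mul_pos hp1 hp2),
    div_le_iff₀ (mul_pos hp1 hp2), mul_comm Z₁ (∫ y, φ y * Real.exp (q₂ y) ∂ρ)]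
  refine outer.trans (le_of_eq ?_)
  field_simp

end single

section tilt
variable {ρ : Measure ℝ} [IsProbabilityMeasure ρ] {β R δ c : ℝ}

/-- conditional drift under the tilted law -/
noncomputable def hh (ρ : Measure ℝ) (β m x : ℝ) : ℝ :=
  (∫ y, (x - y) * |x - y| * Real.exp (β * m * y) ∂ρ) / ∫ y, Real.exp (β * m * y) ∂ρ

lemma phi_bound (x y : ℝ) : abs ((x - y) * |x - y|) ≤ 2 * J x * J y := by
  rw [abs_mul, abs_abs, ← sq, sq_abs]
  unfold J
  nlinarith [sq_nonneg (x + y), sq_nonneg (x * y)]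

lemma wintm (hG : Good ρ β R δ c) (q : ℕ) (s : ℝ) :
    Integrable (fun y => J y ^ q * Real.exp (β * s * y)) ρ := by
  have := wint hG q (a := 0) (by have := hG.hβ0; linarith) s
  simpa using this

lemma one_le_M (hG : Good ρ β R δ c) (s : ℝ) : 1 ≤ ∫ y, Real.exp (β * s * y) ∂ρ := by
  have := one_le_Z hG (a := 0) le_rfl (by have := hG.hβ0; linarith) s
  simpa using this

lemma momentm (hG : Good ρ β R δ c) (q : ℕ) :
    ∃ K : ℝ, 0 < K ∧ ∀ s : ℝ, ∫ y, J y ^ q * Real.exp (β * s * y) ∂ρ ≤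
        K * J s ^ q * ∫ y, Real.exp (β * s * y) ∂ρ := by
  obtain ⟨K, hK, h⟩ := moment hG q
  refine ⟨K, hK, fun s => ?_⟩
  simpa using h 0 s le_rfl (by have := hG.hβ0; linarith)

lemma compare (hG : Good ρ β R δ c) :
    ∃ K : ℝ, 0 < K ∧ ∀ n : ℕ, 0 < n → ∀ x s m : ℝ,
      |cwCondMoment ρ β n (fun y => (x - y) * |x - y|) s - hh ρ β m x| ≤
        K * J x * (1 / n + |s - m|) * (J s ^ 2 + J m ^ 2) := by
  obtain ⟨K1, hK1, h1⟩ := moment hG 1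
  obtain ⟨K2, hK2, h2⟩ := moment hG 2
  refine ⟨2 * (K2 + K1 ^ 2), by positivity, fun n hn x s m => ?_⟩
  have hβ0 := hG.hβ0
  have hβ1 := hG.hβ1
  have hn1 : (1 : ℝ) ≤ n := by exact_mod_cast hn
  have ha0 : 0 ≤ β / (2 * n) := by positivity
  have ha : β / (2 * n) ≤ β / 2 := by gcongr; linarith
  have eq1 : ∀ y, β * y ^ 2 / (2 * n) + β * s * y = β / (2 * n) * y ^ 2 + β * s * y := by
    intro y; ring
  unfold cwCondMoment hh
  simp_rw [eq1]
  have Jx := J_pos x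
  have key := diff_bound (ρ := ρ) (fun y => β / (2 * n) * y ^ 2 + β * s * y)
    (fun y => β * m * y) (fun y => (x - y) * |x - y|) (A := 2 * J x)
    (ε := 1 / n + |s - m|) (by positivity) (by positivity) (fun y => phi_bound x y) (fun y => ?_)
    (by fun_prop) (fun q => wint hG q ha s) (fun q => wintm hG q m)
  · refine key.trans ?_
    have z1 := one_le_Z hG ha0 ha s
    have z2 := one_le_M hG m
    have h1' := h1 0 m le_rfl (by linarith)
    have h2' := h2 0 m le_rfl (by linarith)
    simp only [zero_mul, zero_add] at h1' h2'
    have b1 := (div_le_iff₀ (by linarith)).2 (h1 _ s ha0 ha)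
    have b2 := (div_le_iff₀ (by linarith)).2 h1'
    have c1 := (div_le_iff₀ (by linarith)).2 (h2 _ s ha0 ha)
    have c2 := (div_le_iff₀ (by linarith)).2 h2'
    rw [pow_one] at b1 b2
    have nn : 0 ≤ (∫ y, J y ^ 1 * Real.exp (β * m * y) ∂ρ) /
        ∫ y, Real.exp (β * m * y) ∂ρ :=
      div_nonneg (integral_nonneg fun y => by have := J_pos y; positivity) (by linarith)
    have Js := J_pos s
    have Jm := J_pos m
    have bb := mul_le_mul b1 b2 nn (by positivity)
    have : (K1 * J s) * (K1 * J m) ≤ K1 ^ 2 * ((J s ^ 2 + J m ^ 2) / 2) := by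
      nlinarith [mul_nonneg (sq_nonneg K1) (sq_nonneg (J s - J m))]
    calc _ ≤ 2 * J x * (1 / n + |s - m|) * ((K2 + K1 ^ 2) * (J s ^ 2 + J m ^ 2)) := by
          refine mul_le_mul_of_nonneg_left ?_ (by positivity)
          linarith
      _ = _ := by ring
  · have e : β / (2 * n) * y ^ 2 + β * s * y - β * m * y =
      β / (2 * n) * y ^ 2 + β * (s - m) * y := by ring
    simp only [e]
    refine (abs_add_le _ _).trans ?_
    rw [abs_of_nonneg (by positivity), abs_mul, abs_mul, abs_of_pos hβ0]
    have f1 : β / (2 * n) * y ^ 2 ≤ 1 / n * y ^ 2 := by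
      gcongr
      linarith
    have f2 : |y| ≤ J y := by
      unfold J; rw [← sq_abs y]; nlinarith [abs_nonneg y, sq_nonneg (|y| - 1)]
    have f3 : β * |s - m| * |y| ≤ |s - m| * J y := by
      have : β * |s - m| ≤ |s - m| := mul_le_of_le_one_left (abs_nonneg _) hβ1
      exact mul_le_mul this f2 (abs_nonneg _) (abs_nonneg _)
    have f4 : 1 / (n : ℝ) * y ^ 2 ≤ 1 / n * J y := by
      gcongr; unfold J; linarith
    linarith

lemma abc_le {a b d : ℝ} (ha : 0 ≤ a) (hb : 0 ≤ b) (hd : 0 ≤ d) :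
    a * b * d ≤ a ^ 3 + b ^ 3 + d ^ 3 := by
  have h1 := mul_nonneg (add_nonneg (add_nonneg ha hb) hd)
    (add_nonneg (add_nonneg (sq_nonneg (a - b)) (sq_nonneg (b - d))) (sq_nonneg (a - d)))
  have := mul_nonneg (mul_nonneg ha hb) hd
  nlinarith

lemma compare2 (hG : Good ρ β R δ c) :
    ∃ K : ℝ, 0 < K ∧ ∀ n : ℕ, 0 < n → ∀ x S m : ℝ,
      |cwCondMoment ρ β n (fun y => (x - y) * |x - y|) ((S - x) / n) - hh ρ β m x| ≤
        K * (1 / √n) * (J x ^ 12 + J (√n * (m - S / n)) ^ 12 + J m ^ 12) := by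
  obtain ⟨K, hK, h⟩ := compare hG
  refine ⟨20 * K, by positivity, fun n hn x S m => ?_⟩
  refine (h n hn x _ m).trans ?_
  have hn1 : (1 : ℝ) ≤ n := by exact_mod_cast hn
  set s := (S - x) / n with hs
  set V := √n * (m - S / n) with hV
  set r := 1 / √(n : ℝ) with hr
  have hsq : 1 ≤ √(n : ℝ) := Real.one_le_sqrt.2 hn1
  have r0 : 0 < r := by positivity
  have r1 : r ≤ 1 := by rw [hr, div_le_one (by positivity)]; exact hsq
  have rr : 1 / (n : ℝ) = r ^ 2 := by rw [hr, div_pow, Real.sq_sqrt (by positivity), one_pow]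
  have rr' : r ^ 2 ≤ r := by nlinarith
  have es : s - m = -(r * V) - x * r ^ 2 := by
    rw [← rr, hV, hs, hr]; field_simp; ring
  have hsm : |s - m| ≤ r * |V| + |x| * r := by
    rw [es]
    refine (abs_sub _ _).trans ?_
    rw [abs_neg, abs_mul r V, abs_mul x, abs_of_pos r0, abs_of_pos (by positivity : 0 < r ^ 2)]
    gcongr
  have absJ : ∀ u : ℝ, |u| ≤ J u / 2 := by
    intro u; unfold J; rw [← sq_abs u]; nlinarith [sq_nonneg (|u| - 1)]
  have JV := one_le_J V
  have Jx := one_le_J x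
  have Jm := one_le_J m
  have hε : 1 / n + |s - m| ≤ r * (2 * (J V * J x)) := by
    rw [rr]
    have : 1 + |V| + |x| ≤ 2 * (J V * J x) := by
      nlinarith [absJ V, absJ x, mul_nonneg (sub_nonneg.2 JV) (sub_nonneg.2 Jx)]
    have := mul_le_mul_of_nonneg_left this r0.le
    linarith
  have hJs : J s ≤ 3 * (J m * J V * J x) := by
    have hs2 : s ^ 2 ≤ 3 * (m ^ 2 + V ^ 2 + x ^ 2) := by
      have e3 : |s| ≤ |m| + |V| + |x| := by
        have : |s| ≤ |s - m| + |m| := by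
          have := abs_add_le (s - m) m; simpa using this
        nlinarith [abs_nonneg V, abs_nonneg x]
      rw [← sq_abs s, ← sq_abs m, ← sq_abs V, ← sq_abs x]
      have : |s| ^ 2 ≤ (|m| + |V| + |x|) ^ 2 := by gcongr
      nlinarith [sq_nonneg (|m| - |V|), sq_nonneg (|m| - |x|), sq_nonneg (|V| - |x|)]
    have p1 : 1 + (m ^ 2 + V ^ 2 + x ^ 2) ≤ J m * J V * J x := by
      unfold J
      have q1 : 0 ≤ m ^ 2 * V ^ 2 := by positivity
      have q2 : 0 ≤ m ^ 2 * x ^ 2 := by positivity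
      have q3 : 0 ≤ V ^ 2 * x ^ 2 := by positivity
      have q4 : 0 ≤ m ^ 2 * V ^ 2 * x ^ 2 := by positivity
      nlinarith
    have : J s = 1 + s ^ 2 := rfl
    linarith
  have Js := one_le_J s
  have hsum : J s ^ 2 + J m ^ 2 ≤ 10 * (J m * J V * J x) ^ 2 := by
    have g1 : J s ^ 2 ≤ (3 * (J m * J V * J x)) ^ 2 := by gcongr
    have g2 : J m ≤ J m * J V * J x := by
      have : 1 ≤ J V * J x := by nlinarith
      nlinarith
    have g3 : J m ^ 2 ≤ (J m * J V * J x) ^ 2 := by gcongr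
    nlinarith
  calc K * J x * (1 / n + |s - m|) * (J s ^ 2 + J m ^ 2)
      ≤ K * J x * (r * (2 * (J V * J x))) * (10 * (J m * J V * J x) ^ 2) := by gcongr
    _ = 20 * K * r * (J x ^ 4 * J V ^ 3 * J m ^ 2) := by ring
    _ ≤ 20 * K * r * (J x ^ 4 * J V ^ 4 * J m ^ 4) := by
        gcongr <;> first | assumption | norm_num
    _ ≤ 20 * K * r * ((J x ^ 4) ^ 3 + (J V ^ 4) ^ 3 + (J m ^ 4) ^ 3) := by
        gcongr; exact abc_le (by positivity) (by positivity) (by positivity)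
    _ = _ := by ring

lemma Mint (hG : Good ρ β R δ c) (m : ℝ) : Integrable (fun y => Real.exp (β * m * y)) ρ :=
  hG.H (β * m)

lemma int_tilt (m : ℝ) (g : ℝ → ℝ) :
    ∫ y, g y ∂(ρ.tilted fun y => β * m * y) =
      (∫ y, g y * Real.exp (β * m * y) ∂ρ) / ∫ y, Real.exp (β * m * y) ∂ρ := by
  rw [integral_tilted, ← integral_div]
  refine integral_congr_ae (ae_of_all _ fun y => ?_)
  simp only [smul_eq_mul]; ring

lemma integrable_tilt (hG : Good ρ β R δ c) (m : ℝ) (q : ℕ) :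
    Integrable (fun y => J y ^ q) (ρ.tilted fun y => β * m * y) := by
  rw [integrable_tilted_iff (Mint hG m)]
  refine (wintm hG q m).congr (ae_of_all _ fun y => ?_)
  simp [mul_comm]

lemma hh_eq (m x : ℝ) :
    hh ρ β m x = ∫ y, (x - y) * |x - y| ∂(ρ.tilted fun y => β * m * y) := by
  rw [int_tilt]; rfl

lemma hh_meas : Measurable (fun p : ℝ × ℝ => hh ρ β p.1 p.2) := by
  unfold hh
  refine Measurable.div ?_ ?_
  · have : StronglyMeasurable (fun z : (ℝ × ℝ) × ℝ =>
        (z.1.2 - z.2) * |z.1.2 - z.2| * Real.exp (β * z.1.1 * z.2)) :=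
      Measurable.stronglyMeasurable (by fun_prop)
    exact this.integral_prod_right'.measurable
  · have : StronglyMeasurable (fun z : (ℝ × ℝ) × ℝ => Real.exp (β * z.1.1 * z.2)) :=
      Measurable.stronglyMeasurable (by fun_prop)
    exact this.integral_prod_right'.measurable

lemma var_bound (hG : Good ρ β R δ c) :
    ∃ K : ℝ, 0 < K ∧ ∀ n : ℕ, 0 < n → ∀ m : ℝ,
      ∫⁻ x, ENNReal.ofReal |(1 / (n : ℝ)) * ∑ i, hh ρ β m (x i)|
        ∂(Measure.pi fun _ : Fin n => ρ.tilted fun y => β * m * y) ≤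
      ENNReal.ofReal (K * (1 / √n) * J m ^ 12) := by
  obtain ⟨K1, hK1, h1⟩ := momentm hG 1
  obtain ⟨K2, hK2, h2⟩ := momentm hG 2
  refine ⟨4 * K1 ^ 2 * K2 + 1, by positivity, fun n hn m => ?_⟩
  have hn0 : (0 : ℝ) < n := by exact_mod_cast hn
  set ν := ρ.tilted fun y => β * m * y with hν
  have hp : IsProbabilityMeasure ν := isProbabilityMeasure_tilted (Mint hG m)
  have hM := one_le_M hG m
  have Jm := one_le_J m
  have m1 : ∫ y, J y ∂ν ≤ K1 * J m := by
    have := h1 m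
    simp only [pow_one] at this
    rw [hν, int_tilt, div_le_iff₀ (by linarith)]; exact this
  have m2 : ∫ y, J y ^ 2 ∂ν ≤ K2 * J m ^ 2 := by
    rw [hν, int_tilt, div_le_iff₀ (by linarith)]; exact h2 m
  have iJ1 : Integrable J ν := by simpa using integrable_tilt hG m 1
  have iJ2 : Integrable (fun y => J y ^ 2) ν := integrable_tilt hG m 2
  have hb : ∀ x, |hh ρ β m x| ≤ 2 * K1 * J m * J x := by
    intro x
    have Jx := J_pos x
    rw [hh_eq]
    refine abs_integral_le_integral_abs.trans ?_
    calc ∫ y, abs ((x - y) * |x - y|) ∂ν ≤ ∫ y, 2 * J x * J y ∂ν :=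
          integral_mono_of_nonneg (ae_of_all _ fun y => abs_nonneg _) (iJ1.const_mul _)
            (ae_of_all _ fun y => phi_bound x y)
      _ = 2 * J x * ∫ y, J y ∂ν := integral_const_mul _ _
      _ ≤ 2 * J x * (K1 * J m) := by gcongr
      _ = _ := by ring
  have hmeas : Measurable (hh ρ β m) := hh_meas.comp (measurable_const.prodMk measurable_id)
  have hsq : Integrable (fun x => hh ρ β m x ^ 2) ν := by
    refine (iJ2.const_mul ((2 * K1 * J m) ^ 2)).mono' (hmeas.pow_const 2).aestronglyMeasurable
      (ae_of_all _ fun x => ?_)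
    rw [Real.norm_of_nonneg (sq_nonneg _), ← mul_pow, ← sq_abs]
    gcongr; exact hb x
  have hL2 : MemLp (hh ρ β m) 2 ν := (memLp_two_iff_integrable_sq hmeas.aestronglyMeasurable).2 hsq
  have hmean0 : ∫ x, hh ρ β m x ∂ν = 0 := by
    have ip : Integrable (Function.uncurry fun x y : ℝ => (x - y) * |x - y|) (ν.prod ν) := by
      refine ((iJ1.mul_prod iJ1).const_mul 2).mono' ?_ (ae_of_all _ fun z => ?_)
      · exact Measurable.aestronglyMeasurable (by unfold Function.uncurry; fun_prop)
      · have := phi_bound z.1 z.2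
        rw [mul_assoc] at this
        exact this
    have sw := integral_integral_swap ip
    have e1 : ∫ x, hh ρ β m x ∂ν = ∫ x, ∫ y, (x - y) * |x - y| ∂ν ∂ν := by
      simp_rw [hh_eq]; rfl
    have e2 : ∫ y, ∫ x, (x - y) * |x - y| ∂ν ∂ν = - ∫ x, ∫ y, (x - y) * |x - y| ∂ν ∂ν := by
      rw [← integral_neg]
      refine integral_congr_ae (ae_of_all _ fun y => ?_)
      simp only
      rw [← integral_neg]
      refine integral_congr_ae (ae_of_all _ fun x => ?_)
      simp only
      rw [abs_sub_comm]; ring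
    rw [e2] at sw
    rw [e1]; linarith
  have hvar1 : Var[hh ρ β m; ν] ≤ 4 * K1 ^ 2 * K2 * J m ^ 4 := by
    refine (variance_le_expectation_sq hmeas.aestronglyMeasurable).trans ?_
    calc ∫ x, (hh ρ β m ^ 2) x ∂ν ≤ ∫ x, (2 * K1 * J m) ^ 2 * J x ^ 2 ∂ν := by
          refine integral_mono hsq (iJ2.const_mul _) fun x => ?_
          simp only [Pi.pow_apply]
          rw [← mul_pow, ← sq_abs]
          gcongr; exact hb x
      _ = (2 * K1 * J m) ^ 2 * ∫ x, J x ^ 2 ∂ν := integral_const_mul _ _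
      _ ≤ (2 * K1 * J m) ^ 2 * (K2 * J m ^ 2) := by gcongr
      _ = _ := by ring
  set PP := Measure.pi fun _ : Fin n => ν with hPP
  have hvs := variance_sum_pi (μ := fun _ : Fin n => ν) (X := fun _ => hh ρ β m) (fun _ => hL2)
  have hLi : ∀ i : Fin n, MemLp (fun x : Fin n → ℝ => hh ρ β m (x i)) 2 PP :=
    fun i => hL2.comp_measurePreserving (measurePreserving_eval (fun _ : Fin n => ν) i)
  have hLs : MemLp (∑ i : Fin n, fun x : Fin n → ℝ => hh ρ β m (x i)) 2 PP :=
    memLp_finsetSum' _ fun i _ => hLi i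
  have hEs : ∫ x, (∑ i : Fin n, fun x : Fin n → ℝ => hh ρ β m (x i)) x ∂PP = 0 := by
    simp only [Finset.sum_apply]
    rw [integral_finsetSum _ fun i _ => (hLi i).integrable (by norm_num)]
    refine Finset.sum_eq_zero fun i _ => ?_
    rw [← hmean0]
    exact integral_comp_eval (μ := fun _ : Fin n => ν) (i := i) hmeas.aestronglyMeasurable
  rw [variance_of_integral_eq_zero hLs.aemeasurable hEs] at hvs
  have hvs2 : ∫ x, (∑ i : Fin n, hh ρ β m (x i)) ^ 2 ∂PP ≤ n * (4 * K1 ^ 2 * K2 * J m ^ 4) := by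
    simp only [Finset.sum_apply] at hvs
    rw [hvs]
    simp only [Finset.sum_const, Finset.card_univ, Fintype.card_fin, nsmul_eq_mul]
    gcongr
  have isq : Integrable (fun x : Fin n → ℝ => (∑ i : Fin n, hh ρ β m (x i)) ^ 2) PP := by
    simpa using hLs.integrable_sq
  have sq0 : 0 < √(n : ℝ) := Real.sqrt_pos.2 hn0
  have sqn : √(n : ℝ) ^ 2 = n := Real.sq_sqrt hn0.le
  have ib : Integrable (fun x : Fin n → ℝ =>
      √n / (n : ℝ) ^ 2 * (∑ i : Fin n, hh ρ β m (x i)) ^ 2 + 1 / √n) PP :=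
    (isq.const_mul _).add (integrable_const _)
  calc _ ≤ ∫⁻ x, ENNReal.ofReal
        (√n / (n : ℝ) ^ 2 * (∑ i : Fin n, hh ρ β m (x i)) ^ 2 + 1 / √n) ∂PP := by
        refine lintegral_mono fun x => ENNReal.ofReal_le_ofReal ?_
        set T := ∑ i : Fin n, hh ρ β m (x i)
        have e : √n / (n : ℝ) ^ 2 * T ^ 2 + 1 / √n - |1 / (n : ℝ) * T| =
          1 / √n * ((√n * |1 / (n : ℝ) * T|) ^ 2 + 1 - (√n * |1 / (n : ℝ) * T|)) := by
          rw [mul_pow, sq_abs]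
          field_simp
          try simp only [sqn]
          try ring
        have : 0 ≤ 1 / √n * ((√n * |1 / (n : ℝ) * T|) ^ 2 + 1 - (√n * |1 / (n : ℝ) * T|)) := by
          refine mul_nonneg (by positivity) ?_
          nlinarith [sq_nonneg (√n * |1 / (n : ℝ) * T| - 1), sq_nonneg (√n * |1 / (n : ℝ) * T|)]
        linarith
    _ = ENNReal.ofReal (∫ x, (√n / (n : ℝ) ^ 2 * (∑ i : Fin n, hh ρ β m (x i)) ^ 2 + 1 / √n) ∂PP) := by
        rw [ofReal_integral_eq_lintegral_ofReal ib (ae_of_all _ fun x => by positivity)]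
    _ ≤ _ := by
        refine ENNReal.ofReal_le_ofReal ?_
        rw [integral_add (isq.const_mul _) (integrable_const _), integral_const_mul]
        simp only [integral_const, probReal_univ, one_smul]
        have h4 : J m ^ 4 ≤ J m ^ 12 := pow_le_pow_right₀ Jm (by norm_num)
        have h0 : 1 ≤ J m ^ 12 := one_le_pow₀ Jm
        calc _ ≤ √n / (n : ℝ) ^ 2 * (n * (4 * K1 ^ 2 * K2 * J m ^ 4)) + 1 / √n := by gcongr
          _ = 1 / √n * (4 * K1 ^ 2 * K2 * J m ^ 4 + 1) := by
            field_simp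
            try simp only [sqn]
            try ring
          _ ≤ 1 / √n * (4 * K1 ^ 2 * K2 * J m ^ 12 + J m ^ 12) := by gcongr
          _ = _ := by ring

end tilt

section assembly
variable {ρ : Measure ℝ} [IsProbabilityMeasure ρ] {β R δ c : ℝ}

/-- Gaussian kernel -/
noncomputable def kk (β : ℝ) (n : ℕ) (m : ℝ) : ℝ :=
  √(n * β / (2 * Real.pi)) * Real.exp (-(n * β * m ^ 2 / 2))

lemma kk_nonneg (β : ℝ) (n : ℕ) (m : ℝ) : 0 ≤ kk β n m := by unfold kk; positivity

lemma kk_meas (β : ℝ) (n : ℕ) : Measurable (kk β n) := by unfold kk; fun_prop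

lemma gauss_scaled {a l : ℝ} (ha : 0 < a) (hl : 0 < l) (C : ℝ) (hC : 0 ≤ C) :
    ∫⁻ m : ℝ, ENNReal.ofReal (C * (√(a / (2 * Real.pi)) * Real.exp (-(a * l * m ^ 2 / 2)))) =
      ENNReal.ofReal (C * √(1 / l)) := by
  have h := hs (mul_pos ha hl) 0
  have e : ∀ m : ℝ, C * (√(a / (2 * Real.pi)) * Real.exp (-(a * l * m ^ 2 / 2))) =
      (C * √(1 / l)) * (√(a * l / (2 * Real.pi)) * Real.exp (-(a * l * m ^ 2 / 2)) *
        Real.exp (0 * m)) := by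
    intro m
    rw [show a / (2 * Real.pi) = 1 / l * (a * l / (2 * Real.pi)) by field_simp,
      Real.sqrt_mul (by positivity)]
    simp only [zero_mul, Real.exp_zero, mul_one]
    ring
  simp_rw [e, ENNReal.ofReal_mul (by positivity : 0 ≤ C * √(1 / l))]
  rw [lintegral_const_mul' _ _ ENNReal.ofReal_ne_top, h]
  simp

lemma tail_bound (hG : Good ρ β R δ c) :
    ∃ K : ℝ, 0 < K ∧ ∀ n : ℕ, 0 < n →
      1 ≤ ∫⁻ m, ENNReal.ofReal (kk β n m) * ENNReal.ofReal (∫ y, Real.exp (β * m * y) ∂ρ) ^ n →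
      ∫⁻ m, ENNReal.ofReal (kk β n m) * ENNReal.ofReal (∫ y, Real.exp (β * m * y) ∂ρ) ^ n
        * ENNReal.ofReal (J m ^ 12) ≤ ENNReal.ofReal K *
      ∫⁻ m, ENNReal.ofReal (kk β n m) * ENNReal.ofReal (∫ y, Real.exp (β * m * y) ∂ρ) ^ n := by
  have hβ0 := hG.hβ0
  have hδ0 := hG.hδ0
  have hR := hG.hR
  obtain ⟨C, hC, hJ⟩ := J_pow_le_exp 12 (by positivity : 0 < β * δ / 4)
  have JR := J_pos R
  refine ⟨J R ^ 12 + C * √(1 / (δ / 2)), by positivity, fun n hn hZ => ?_⟩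
  have hn1 : (1 : ℝ) ≤ n := by exact_mod_cast hn
  set Z := ∫⁻ m, ENNReal.ofReal (kk β n m) * ENNReal.ofReal (∫ y, Real.exp (β * m * y) ∂ρ) ^ n
  have pt : ∀ m : ℝ, ENNReal.ofReal (kk β n m) *
      ENNReal.ofReal (∫ y, Real.exp (β * m * y) ∂ρ) ^ n * ENNReal.ofReal (J m ^ 12) ≤
      ENNReal.ofReal (J R ^ 12) * (ENNReal.ofReal (kk β n m) *
        ENNReal.ofReal (∫ y, Real.exp (β * m * y) ∂ρ) ^ n) +
      ENNReal.ofReal (C * (√(n * β / (2 * Real.pi)) *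
        Real.exp (-(n * β * (δ / 2) * m ^ 2 / 2)))) := by
    intro m
    have Jm := J_pos m
    by_cases hm : |m| ≤ R
    · refine le_add_right ?_
      rw [mul_comm]
      gcongr
      unfold J
      have : m ^ 2 ≤ R ^ 2 := by rw [← sq_abs m]; gcongr
      linarith
    · refine le_add_left ?_
      push Not at hm
      have hM := hG.tail m hm
      have hM1 := one_le_M hG m
      rw [← ENNReal.ofReal_pow (by linarith), ← ENNReal.ofReal_mul (kk_nonneg _ _ _),
        ← ENNReal.ofReal_mul (by have := kk_nonneg β n m; positivity)]
      refine ENNReal.ofReal_le_ofReal ?_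
      have kn := kk_nonneg β n m
      calc kk β n m * (∫ y, Real.exp (β * m * y) ∂ρ) ^ n * J m ^ 12
          ≤ kk β n m * (Real.exp (β * m ^ 2 * (1 - δ) / 2)) ^ n *
            (C * Real.exp (β * δ / 4 * m ^ 2)) := by
            gcongr
            exact hJ m
        _ = C * (√(n * β / (2 * Real.pi)) * Real.exp (-(n * β * m ^ 2 / 2) +
            n * (β * m ^ 2 * (1 - δ) / 2) + β * δ / 4 * m ^ 2)) := by
            rw [Real.exp_add, Real.exp_add, Real.exp_nat_mul]
            unfold kk; ring
        _ ≤ _ := by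
            refine mul_le_mul_of_nonneg_left (mul_le_mul_of_nonneg_left
              (Real.exp_le_exp.2 ?_) (Real.sqrt_nonneg _)) hC.le
            have : 0 ≤ β * δ * m ^ 2 * (n - 1) :=
              mul_nonneg (by positivity) (by linarith)
            nlinarith
  refine (lintegral_mono pt).trans ?_
  rw [lintegral_add_right _ (by fun_prop), lintegral_const_mul' _ _ ENNReal.ofReal_ne_top,
    gauss_scaled (by positivity) (by positivity) C hC.le, ENNReal.ofReal_add (by positivity) (by positivity),
    add_mul]
  gcongr
  exact le_mul_of_one_le_right' hZ

lemma V_bound (hG : Good ρ β R δ c) :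
    ∃ K : ℝ, 0 < K ∧ ∀ n : ℕ, 0 < n → ∀ S : ℝ,
      ∫⁻ m, ENNReal.ofReal (kk β n m) * ENNReal.ofReal (Real.exp (β * m * S)) *
        ENNReal.ofReal (J (√n * (m - S / n)) ^ 12) ≤
      ENNReal.ofReal K * ENNReal.ofReal (Real.exp (β * S ^ 2 / (2 * n))) := by
  have hβ0 := hG.hβ0
  obtain ⟨C, hC, hJ⟩ := J_pow_le_exp 12 (by positivity : 0 < β / 4)
  refine ⟨C * √(1 / (1 / 2)), by positivity, fun n hn S => ?_⟩
  have hn0 : (0 : ℝ) < n := by exact_mod_cast hn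
  have pt : ∀ m : ℝ, ENNReal.ofReal (kk β n m) * ENNReal.ofReal (Real.exp (β * m * S)) *
        ENNReal.ofReal (J (√n * (m - S / n)) ^ 12) ≤
      ENNReal.ofReal (Real.exp (β * S ^ 2 / (2 * n))) *
        ENNReal.ofReal (C * (√(n * β / (2 * Real.pi)) *
        Real.exp (-(n * β * (1 / 2) * (m - S / n) ^ 2 / 2)))) := by
    intro m
    have kn := kk_nonneg β n m
    rw [← ENNReal.ofReal_mul kn, ← ENNReal.ofReal_mul (by positivity),
      ← ENNReal.ofReal_mul (by positivity)]
    refine ENNReal.ofReal_le_ofReal ?_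
    calc kk β n m * Real.exp (β * m * S) * J (√n * (m - S / n)) ^ 12
        ≤ kk β n m * Real.exp (β * m * S) * (C * Real.exp (β / 4 * (√n * (m - S / n)) ^ 2)) := by
          gcongr; exact hJ _
      _ = C * (√(n * β / (2 * Real.pi)) * Real.exp (-(n * β * m ^ 2 / 2) + β * m * S
            + β / 4 * (√n * (m - S / n)) ^ 2)) := by
          rw [Real.exp_add, Real.exp_add]; unfold kk; ring
      _ = C * (√(n * β / (2 * Real.pi)) * Real.exp (β * S ^ 2 / (2 * n) +
            -(n * β * (1 / 2) * (m - S / n) ^ 2 / 2))) := by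
          congr 3
          rw [mul_pow, Real.sq_sqrt hn0.le]
          field_simp
          ring
      _ = _ := by rw [Real.exp_add]; ring
      _ ≤ _ := le_rfl
  refine (lintegral_mono pt).trans ?_
  rw [lintegral_const_mul' _ _ ENNReal.ofReal_ne_top,
    lintegral_sub_right_eq_self (fun m : ℝ => ENNReal.ofReal (C * (√(n * β / (2 * Real.pi)) *
        Real.exp (-(n * β * (1 / 2) * m ^ 2 / 2))))) (S / n),
    gauss_scaled (by positivity) (by positivity) C hC.le, mul_comm]

/-- joint weight -/
noncomputable def ww (β : ℝ) (n : ℕ) (z : (Fin n → ℝ) × ℝ) : ENNReal :=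
  ENNReal.ofReal (kk β n z.2) * ENNReal.ofReal (Real.exp (β * z.2 * ∑ i, z.1 i))

lemma ww_meas (β : ℝ) (n : ℕ) : Measurable (ww β n) := by
  unfold ww
  have := kk_meas β n
  fun_prop

lemma ww_int (hβ0 : 0 < β) {n : ℕ} (hn : 0 < n) (x : Fin n → ℝ) :
    ∫⁻ m, ww β n (x, m) = ENNReal.ofReal (Real.exp (β * (∑ i, x i) ^ 2 / (2 * n))) := by
  have hn0 : (0 : ℝ) < n := by exact_mod_cast hn
  have h := hs (mul_pos hn0 hβ0) (β * ∑ i, x i)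
  rw [show (β * ∑ i, x i) ^ 2 / (2 * (n * β)) = β * (∑ i, x i) ^ 2 / (2 * n) by
    field_simp] at h
  rw [← h]
  refine lintegral_congr fun m => ?_
  unfold ww
  rw [← ENNReal.ofReal_mul (kk_nonneg _ _ _)]
  simp only [kk]
  congr 3
  ring

lemma swap (hG : Good ρ β R δ c) {n : ℕ} (G : (Fin n → ℝ) × ℝ → ENNReal) (hGm : Measurable G) :
    ∫⁻ z, ww β n z * G z ∂((Measure.pi fun _ : Fin n => ρ).prod volume) =
      ∫⁻ m, ENNReal.ofReal (kk β n m) * ENNReal.ofReal (∫ y, Real.exp (β * m * y) ∂ρ) ^ n *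
        ∫⁻ x, G (x, m) ∂(Measure.pi fun _ : Fin n => ρ.tilted fun y => β * m * y) := by
  have hm : Measurable (fun z => ww β n z * G z) := (ww_meas β n).mul hGm
  rw [lintegral_prod_symm' _ hm]
  refine lintegral_congr fun m => ?_
  rw [mul_assoc, ← tilted_pi ρ (β * m) (Mint hG m), ← lintegral_const_mul' _ _ ENNReal.ofReal_ne_top]
  refine lintegral_congr fun x => ?_
  simp only [ww, mul_assoc]

lemma Jsum_bound (hG : Good ρ β R δ c) :
    ∃ K : ℝ, 0 < K ∧ ∀ n : ℕ, 0 < n → ∀ m : ℝ,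
      ∫⁻ x, ENNReal.ofReal ((1 / (n : ℝ)) * ∑ i, J (x i) ^ 12)
        ∂(Measure.pi fun _ : Fin n => ρ.tilted fun y => β * m * y) ≤
      ENNReal.ofReal (K * J m ^ 12) := by
  obtain ⟨K, hK, h⟩ := momentm hG 12
  refine ⟨K, hK, fun n hn m => ?_⟩
  have hn0 : (0 : ℝ) < n := by exact_mod_cast hn
  set ν := ρ.tilted fun y => β * m * y with hν
  have hp : IsProbabilityMeasure ν := isProbabilityMeasure_tilted (Mint hG m)
  have hM := one_le_M hG m
  have m2 : ∫ y, J y ^ 12 ∂ν ≤ K * J m ^ 12 := by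
    rw [hν, int_tilt, div_le_iff₀ (by linarith)]; exact h m
  have ii : ∀ i : Fin n, Integrable (fun x : Fin n → ℝ => J (x i) ^ 12)
      (Measure.pi fun _ : Fin n => ν) := fun i =>
    integrable_comp_eval (μ := fun _ : Fin n => ν) (i := i) (f := fun y => J y ^ 12)
      (integrable_tilt hG m 12)
  rw [← ofReal_integral_eq_lintegral_ofReal ((integrable_finsetSum _ fun i _ => ii i).const_mul _)
    (ae_of_all _ fun x => mul_nonneg (by positivity)
      (Finset.sum_nonneg fun i _ => by have := J_pos (x i); positivity))]
  refine ENNReal.ofReal_le_ofReal ?_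
  rw [integral_const_mul, integral_finsetSum _ fun i _ => ii i]
  have e : ∀ i : Fin n, ∫ x : Fin n → ℝ, J (x i) ^ 12 ∂(Measure.pi fun _ : Fin n => ν) =
      ∫ y, J y ^ 12 ∂ν := fun i =>
    integral_comp_eval (μ := fun _ : Fin n => ν) (i := i) (f := fun y => J y ^ 12)
      (J_meas.pow_const 12).aestronglyMeasurable
  simp_rw [e]
  simp only [Finset.sum_const, Finset.card_univ, Fintype.card_fin, nsmul_eq_mul]
  rw [← mul_assoc, one_div, inv_mul_cancel₀ hn0.ne', one_mul]
  exact m2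

lemma main_lint (hG : Good ρ β R δ c) :
    ∃ K : ℝ, 0 < K ∧ ∀ n : ℕ, 0 < n →
      ∫⁻ x, ENNReal.ofReal (Real.exp (β * (∑ i, x i) ^ 2 / (2 * n))) *
        ENNReal.ofReal |(1 / (n : ℝ)) * (∑ i, cwCondMoment ρ β n
              (fun y => (x i - y) * |x i - y|) (((∑ j, x j) - x i) / n))|
          ∂(Measure.pi fun _ : Fin n => ρ) ≤
      ENNReal.ofReal (K * (1 / √n)) *
        ∫⁻ x, ENNReal.ofReal (Real.exp (β * (∑ i, x i) ^ 2 / (2 * n)))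
          ∂(Measure.pi fun _ : Fin n => ρ) := by
  have hβ0 := hG.hβ0
  obtain ⟨K0, hK0, h0⟩ := compare2 hG
  obtain ⟨K1, hK1, h1⟩ := var_bound hG
  obtain ⟨K2, hK2, h2⟩ := Jsum_bound hG
  obtain ⟨KD, hKD, hD⟩ := tail_bound hG
  obtain ⟨KV, hKV, hV⟩ := V_bound hG
  refine ⟨K1 * KD + K0 * K2 * KD + K0 * KD + K0 * KV, by positivity, fun n hn => ?_⟩
  have hn0 : (0 : ℝ) < n := by exact_mod_cast hn
  have sq0 : 0 < √(n : ℝ) := Real.sqrt_pos.2 hn0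
  set r := 1 / √(n : ℝ) with hr
  have r0 : 0 < r := by positivity
  set P := Measure.pi fun _ : Fin n => ρ with hP
  set Z := ∫⁻ x, ENNReal.ofReal (Real.exp (β * (∑ i, x i) ^ 2 / (2 * n))) ∂P with hZ
  have Z1 : 1 ≤ Z := by
    calc (1 : ENNReal) = ∫⁻ x, 1 ∂P := by simp
      _ ≤ Z := by
        refine lintegral_mono fun x => ?_
        rw [← ENNReal.ofReal_one]
        refine ENNReal.ofReal_le_ofReal (Real.one_le_exp ?_)
        positivity
  have ZZ : Z = ∫⁻ m, ENNReal.ofReal (kk β n m) *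
      ENNReal.ofReal (∫ y, Real.exp (β * m * y) ∂ρ) ^ n := by
    have := swap hG (n := n) (fun _ => 1) measurable_const
    simp only [mul_one, lintegral_one] at this
    rw [lintegral_prod _ (ww_meas β n).aemeasurable] at this
    simp_rw [ww_int hβ0 hn] at this
    rw [hZ, this]
    refine lintegral_congr fun m => ?_
    have hp : IsProbabilityMeasure (ρ.tilted fun y => β * m * y) :=
      isProbabilityMeasure_tilted (Mint hG m)
    simp
  have hD' := hD n hn (by rw [← ZZ]; exact Z1)
  rw [← ZZ] at hD'
  -- bound for terms that can be swapped
  have sb : ∀ (κ : ℝ), 0 ≤ κ → ∀ G : (Fin n → ℝ) × ℝ → ENNReal, Measurable G →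
      (∀ m, ∫⁻ x, G (x, m) ∂(Measure.pi fun _ : Fin n => ρ.tilted fun y => β * m * y) ≤
        ENNReal.ofReal (κ * J m ^ 12)) →
      ∫⁻ z, ww β n z * G z ∂(P.prod volume) ≤ ENNReal.ofReal (κ * KD) * Z := by
    intro κ hκ G hGm hb
    rw [hP, swap hG G hGm, ENNReal.ofReal_mul hκ, mul_assoc]
    refine le_trans ?_ (mul_le_mul_right hD' _)
    rw [← lintegral_const_mul' _ _ ENNReal.ofReal_ne_top]
    refine lintegral_mono fun m => ?_
    refine (mul_le_mul_right (hb m) _).trans (le_of_eq ?_)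
    rw [ENNReal.ofReal_mul hκ]
    ring
  set G1 : (Fin n → ℝ) × ℝ → ENNReal :=
    fun z => ENNReal.ofReal |(1 / (n : ℝ)) * ∑ i, hh ρ β z.2 (z.1 i)| with hG1
  set G2 : (Fin n → ℝ) × ℝ → ENNReal :=
    fun z => ENNReal.ofReal (K0 * r * ((1 / (n : ℝ)) * ∑ i, J (z.1 i) ^ 12)) with hG2
  set G3 : (Fin n → ℝ) × ℝ → ENNReal :=
    fun z => ENNReal.ofReal (K0 * r * J z.2 ^ 12) with hG3
  set G4 : (Fin n → ℝ) × ℝ → ENNReal :=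
    fun z => ENNReal.ofReal (K0 * r * J (√n * (z.2 - (∑ i, z.1 i) / n)) ^ 12) with hG4
  have mh : ∀ i : Fin n, Measurable fun z : (Fin n → ℝ) × ℝ => hh ρ β z.2 (z.1 i) := fun i =>
    hh_meas.comp (measurable_snd.prodMk ((measurable_pi_apply i).comp measurable_fst))
  have mJ := J_meas
  have mw := ww_meas β n
  have mG1 : Measurable G1 := by
    refine Measurable.ennreal_ofReal (continuous_abs.measurable.comp ?_)
    exact (Finset.measurable_sum _ fun i _ => mh i).const_mul _
  have mG2 : Measurable G2 := by rw [hG2]; fun_prop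
  have mG3 : Measurable G3 := by rw [hG3]; fun_prop
  have mG4 : Measurable G4 := by rw [hG4]; fun_prop
  have b1 := sb (K1 * r) (by positivity) G1 mG1 (fun m => by
    exact h1 n hn m)
  have b2 := sb (K0 * r * K2) (by positivity) G2 mG2 (fun m => by
    simp only [hG2]
    simp_rw [ENNReal.ofReal_mul (by positivity : 0 ≤ K0 * r)]
    rw [lintegral_const_mul' _ _ ENNReal.ofReal_ne_top, mul_assoc (K0 * r),
      ENNReal.ofReal_mul (by positivity : 0 ≤ K0 * r)]
    exact mul_le_mul_right (h2 n hn m) _)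
  have b3 := sb (K0 * r) (by positivity) G3 mG3 (fun m => by
    have hp : IsProbabilityMeasure (ρ.tilted fun y => β * m * y) :=
      isProbabilityMeasure_tilted (Mint hG m)
    simp [hG3])
  have b4 : ∫⁻ z, ww β n z * G4 z ∂(P.prod volume) ≤ ENNReal.ofReal (K0 * r * KV) * Z := by
    have hm4 : Measurable (fun z => ww β n z * G4 z) := mw.mul mG4
    rw [lintegral_prod _ hm4.aemeasurable, hZ,
      ← lintegral_const_mul' _ _ ENNReal.ofReal_ne_top]
    refine lintegral_mono fun x => ?_
    rw [ENNReal.ofReal_mul (by positivity : 0 ≤ K0 * r), mul_assoc]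
    refine le_trans (le_of_eq ?_) (mul_le_mul_right (hV n hn (∑ i, x i)) _)
    rw [← lintegral_const_mul' _ _ ENNReal.ofReal_ne_top]
    refine lintegral_congr fun m => ?_
    simp only [hG4, ww]
    rw [ENNReal.ofReal_mul (by positivity : 0 ≤ K0 * r)]
    ring
  have pt : ∀ (x : Fin n → ℝ) (m : ℝ), ENNReal.ofReal |(1 / (n : ℝ)) * (∑ i, cwCondMoment ρ β n
      (fun y => (x i - y) * |x i - y|) (((∑ j, x j) - x i) / n))| ≤
      G1 (x, m) + (G2 (x, m) + (G3 (x, m) + G4 (x, m))) := by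
    intro x m
    have nnJ : ∀ u, 0 ≤ J u := fun u => (J_pos u).le
    have nn2 : 0 ≤ K0 * r * ((1 / (n : ℝ)) * ∑ i, J (x i) ^ 12) :=
      mul_nonneg (by positivity) (mul_nonneg (by positivity)
        (Finset.sum_nonneg fun i _ => pow_nonneg (nnJ _) _))
    have nn3 : 0 ≤ K0 * r * J m ^ 12 := mul_nonneg (by positivity) (pow_nonneg (nnJ _) _)
    have nn4 : 0 ≤ K0 * r * J (√n * (m - (∑ i, x i) / n)) ^ 12 :=
      mul_nonneg (by positivity) (pow_nonneg (nnJ _) _)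
    simp only [hG1, hG2, hG3, hG4]
    rw [← ENNReal.ofReal_add nn3 nn4, ← ENNReal.ofReal_add nn2 (add_nonneg nn3 nn4),
      ← ENNReal.ofReal_add (abs_nonneg _) (add_nonneg nn2 (add_nonneg nn3 nn4))]
    refine ENNReal.ofReal_le_ofReal ?_
    set S := ∑ j, x j with hS
    set u : Fin n → ℝ := fun i => cwCondMoment ρ β n
      (fun y => (x i - y) * |x i - y|) ((S - x i) / n) with hu
    have hd : |∑ i, u i - ∑ i, hh ρ β m (x i)| ≤
        ∑ i, K0 * r * (J (x i) ^ 12 + J (√n * (m - S / n)) ^ 12 + J m ^ 12) := by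
      rw [← Finset.sum_sub_distrib]
      refine (Finset.abs_sum_le_sum_abs _ _).trans (Finset.sum_le_sum fun i _ => ?_)
      exact h0 n hn (x i) S m
    have hsum : ∑ i, K0 * r * (J (x i) ^ 12 + J (√n * (m - S / n)) ^ 12 + J m ^ 12) =
        K0 * r * ((∑ i, J (x i) ^ 12) + n * J (√n * (m - S / n)) ^ 12 + n * J m ^ 12) := by
      rw [← Finset.mul_sum, Finset.sum_add_distrib, Finset.sum_add_distrib]
      simp
    rw [hsum] at hd
    have e : 1 / (n : ℝ) * ∑ i, u i = 1 / (n : ℝ) * ∑ i, hh ρ β m (x i) +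
        1 / (n : ℝ) * (∑ i, u i - ∑ i, hh ρ β m (x i)) := by ring
    rw [e]
    refine (abs_add_le _ _).trans (add_le_add_right ?_ _)
    rw [abs_mul, abs_of_pos (by positivity : 0 < 1 / (n : ℝ))]
    refine (mul_le_mul_of_nonneg_left hd (by positivity)).trans (le_of_eq ?_)
    field_simp
    ring
  calc _ ≤ ∫⁻ x, (∫⁻ m, ww β n (x, m) *
      (G1 (x, m) + (G2 (x, m) + (G3 (x, m) + G4 (x, m))))) ∂P := by
        refine lintegral_mono fun x => ?_
        rw [← ww_int hβ0 hn, ← lintegral_mul_const' _ _ ENNReal.ofReal_ne_top]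
        exact lintegral_mono fun m => mul_le_mul_right (pt x m) _
    _ = ∫⁻ z, ww β n z * (G1 z + (G2 z + (G3 z + G4 z))) ∂(P.prod volume) := by
        have hm : Measurable (fun z => ww β n z * (G1 z + (G2 z + (G3 z + G4 z)))) :=
          mw.mul (mG1.add (mG2.add (mG3.add mG4)))
        rw [lintegral_prod _ hm.aemeasurable]
    _ = ∫⁻ z, ww β n z * G1 z ∂(P.prod volume) + (∫⁻ z, ww β n z * G2 z ∂(P.prod volume) +
        (∫⁻ z, ww β n z * G3 z ∂(P.prod volume) + ∫⁻ z, ww β n z * G4 z ∂(P.prod volume))) := by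
        simp_rw [mul_add]
        have mm1 : Measurable (fun z => ww β n z * G1 z) := mw.mul mG1
        have mm2 : Measurable (fun z => ww β n z * G2 z) := mw.mul mG2
        have mm3 : Measurable (fun z => ww β n z * G3 z) := mw.mul mG3
        rw [lintegral_add_left mm1, lintegral_add_left mm2, lintegral_add_left mm3]
    _ ≤ ENNReal.ofReal (K1 * r * KD) * Z + (ENNReal.ofReal (K0 * r * K2 * KD) * Z +
        (ENNReal.ofReal (K0 * r * KD) * Z + ENNReal.ofReal (K0 * r * KV) * Z)) := by
        gcongr
    _ = _ := by
        rw [← add_mul, ← add_mul, ← add_mul, ← ENNReal.ofReal_add (by positivity) (by positivity),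
          ← ENNReal.ofReal_add (by positivity) (by positivity),
          ← ENNReal.ofReal_add (by positivity) (by positivity)]
        congr 2
        ring

end assembly


section final
variable {ρ : Measure ℝ} [IsProbabilityMeasure ρ] {β R δ c : ℝ}

lemma cw_zero {n : ℕ} (h : ¬ Integrable (fun x : Fin n → ℝ =>
    Real.exp (β * (∑ i, x i) ^ 2 / (2 * n))) (Measure.pi fun _ : Fin n => ρ)) :
    cwMeasure ρ β n = 0 := by
  unfold cwMeasure
  rw [integral_undef h]
  simp

lemma exp_of_cw (hβ0 : 0 < β) {n : ℕ} (hn : 0 < n) (h : Integrable (fun x : Fin n → ℝ =>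
    Real.exp (β * (∑ i, x i) ^ 2 / (2 * n))) (Measure.pi fun _ : Fin n => ρ)) (t : ℝ) :
    Integrable (fun x => Real.exp (t * x)) ρ := by
  have hn0 : (0 : ℝ) < n := by exact_mod_cast hn
  have h1 : Integrable (fun x : Fin n → ℝ => Real.exp (t * ∑ i, x i))
      (Measure.pi fun _ : Fin n => ρ) := by
    refine (h.const_mul (Real.exp (n * t ^ 2 / (2 * β)))).mono'
      (Measurable.aestronglyMeasurable (by fun_prop)) (ae_of_all _ fun x => ?_)
    rw [Real.norm_of_nonneg (by positivity), ← Real.exp_add]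
    refine Real.exp_le_exp.2 ?_
    set S := ∑ i, x i
    have e : n * t ^ 2 / (2 * β) + β * S ^ 2 / (2 * n) - t * S =
        (n * t - β * S) ^ 2 / (2 * β * n) := by field_simp; ring
    have : 0 ≤ (n * t - β * S) ^ 2 / (2 * β * n) := by positivity
    linarith
  have h2 := h1.lintegral_lt_top
  have e : ∀ x : Fin n → ℝ, ENNReal.ofReal (Real.exp (t * ∑ i, x i)) =
      ∏ i, ENNReal.ofReal (Real.exp (t * x i)) := by
    intro x
    rw [← ENNReal.ofReal_prod_of_nonneg (fun i _ => by positivity), ← Real.exp_sum, Finset.mul_sum]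
  simp_rw [e] at h2
  rw [lint_prod_pi ρ (fun _ y => ENNReal.ofReal (Real.exp (t * y))) (fun _ => by fun_prop)] at h2
  simp only [Finset.prod_const, Finset.card_univ, Fintype.card_fin] at h2
  have h3 : ∫⁻ y, ENNReal.ofReal (Real.exp (t * y)) ∂ρ < ⊤ := by
    rcases ENNReal.pow_lt_top_iff.1 h2 with h | h
    · exact h
    · omega
  refine ⟨Measurable.aestronglyMeasurable (by fun_prop), ?_⟩
  rw [hasFiniteIntegral_iff_ofReal (ae_of_all _ fun y => by positivity)]
  exact h3

lemma exp_sq (hβ0 : 0 < β) (H : ∀ t : ℝ, Integrable (fun x => Real.exp (t * x)) ρ)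
    (hR : 0 ≤ R) (hδ0 : 0 < δ) (hδ1 : δ < 1)
    (tail : ∀ m : ℝ, R < |m| →
      ∫ x, Real.exp (β * m * x) ∂ρ ≤ Real.exp (β * m ^ 2 * (1 - δ) / 2)) :
    Integrable (fun y => Real.exp (β / (1 - δ / 2) / 2 * y ^ 2)) ρ := by
  have hd : 0 < 1 - δ / 2 := by linarith
  refine ⟨Measurable.aestronglyMeasurable (by fun_prop), ?_⟩
  rw [hasFiniteIntegral_iff_ofReal (ae_of_all _ fun y => by positivity)]
  set a := β * (1 - δ / 2) with ha
  have a0 : 0 < a := by positivity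
  have e : ∀ y : ℝ, ENNReal.ofReal (Real.exp (β / (1 - δ / 2) / 2 * y ^ 2)) =
      ∫⁻ m : ℝ, ENNReal.ofReal (√(a / (2 * Real.pi)) * Real.exp (-(a * m ^ 2 / 2)) *
      Real.exp (β * y * m)) := by
    intro y
    rw [hs a0]
    congr 2
    rw [ha]
    field_simp
  simp_rw [e]
  rw [lintegral_lintegral_swap (Measurable.aemeasurable (by unfold Function.uncurry; fun_prop))]
  set B := (∫ x, Real.exp (β * R * x) ∂ρ) + ∫ x, Real.exp (-(β * R) * x) ∂ρ with hB
  have B0 : 0 ≤ B := add_nonneg (integral_nonneg fun x => by positivity)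
    (integral_nonneg fun x => by positivity)
  have pt : ∀ m : ℝ, ∫⁻ y, ENNReal.ofReal (√(a / (2 * Real.pi)) * Real.exp (-(a * m ^ 2 / 2)) *
      Real.exp (β * y * m)) ∂ρ ≤
      ENNReal.ofReal (B * (√(a / (2 * Real.pi)) * Real.exp (-(a * 1 * m ^ 2 / 2)))) +
      ENNReal.ofReal (1 * (√(a / (2 * Real.pi)) *
        Real.exp (-(a * (β * δ / 2 / a) * m ^ 2 / 2)))) := by
    intro m
    have e2 : ∫⁻ y, ENNReal.ofReal (√(a / (2 * Real.pi)) * Real.exp (-(a * m ^ 2 / 2)) *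
      Real.exp (β * y * m)) ∂ρ = ENNReal.ofReal (√(a / (2 * Real.pi)) *
        Real.exp (-(a * m ^ 2 / 2)) * ∫ y, Real.exp (β * m * y) ∂ρ) := by
      rw [← integral_const_mul, ofReal_integral_eq_lintegral_ofReal ((H _).const_mul _)
        (ae_of_all _ fun y => by positivity)]
      refine lintegral_congr fun y => ?_
      rw [mul_right_comm β y m]
    rw [e2]
    by_cases hm : |m| ≤ R
    · refine le_add_right (ENNReal.ofReal_le_ofReal ?_)
      have : ∫ y, Real.exp (β * m * y) ∂ρ ≤ B := by
        rw [hB, ← integral_add (H _) (H _)]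
        refine integral_mono (H _) ((H _).add (H _)) fun y => ?_
        have ⟨h1, h2⟩ := abs_le.1 hm
        have p1 := Real.exp_pos (β * R * y)
        have p2 := Real.exp_pos (-(β * R) * y)
        rcases le_total 0 y with hy | hy
        · have : Real.exp (β * m * y) ≤ Real.exp (β * R * y) := by gcongr
          simp only; linarith
        · have : Real.exp (β * m * y) ≤ Real.exp (-(β * R) * y) := by
            refine Real.exp_le_exp.2 ?_
            have : 0 ≤ β * ((m + R) * (-y)) :=
              mul_nonneg hβ0.le (mul_nonneg (by linarith) (by linarith))
            nlinarith
          simp only; linarith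
      rw [mul_one, mul_comm]
      gcongr
    · refine le_add_left (ENNReal.ofReal_le_ofReal ?_)
      push Not at hm
      rw [one_mul, mul_assoc]
      refine mul_le_mul_of_nonneg_left ?_ (Real.sqrt_nonneg _)
      refine (mul_le_mul_of_nonneg_left (tail m hm) (Real.exp_pos _).le).trans ?_
      rw [← Real.exp_add]
      refine Real.exp_le_exp.2 (le_of_eq ?_)
      rw [mul_div_cancel₀ _ a0.ne', ha]
      ring
  refine (lintegral_mono pt).trans_lt ?_
  rw [lintegral_add_right _ (by fun_prop), gauss_scaled a0 one_pos B B0,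
    gauss_scaled a0 (by positivity) 1 zero_le_one]
  exact ENNReal.add_lt_top.2 ⟨ENNReal.ofReal_lt_top, ENNReal.ofReal_lt_top⟩

lemma final (hG : Good ρ β R δ c) : ∃ C : ℝ, 0 < C ∧
      ∀ n : ℕ, 0 < n →
        (∫ x, |(1 / (n : ℝ)) *
            (∑ i, cwCondMoment ρ β n
              (fun y => (x i - y) * |x i - y|) (((∑ j, x j) - x i) / n))|
          ∂(cwMeasure ρ β n)) ≤ C * (n : ℝ) ^ (-(1 / 2) : ℝ) := by
  obtain ⟨K, hK, h⟩ := main_lint hG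
  refine ⟨K, hK, fun n hn => ?_⟩
  have hn0 : (0 : ℝ) < n := by exact_mod_cast hn
  by_cases hi : Integrable (fun x : Fin n → ℝ =>
    Real.exp (β * (∑ i, x i) ^ 2 / (2 * n))) (Measure.pi fun _ : Fin n => ρ)
  swap
  · rw [cw_zero hi, integral_zero_measure]
    positivity
  have h' := h n hn
  have er : (n : ℝ) ^ (-(1 / 2) : ℝ) = 1 / √n := by
    rw [Real.rpow_neg hn0.le, Real.sqrt_eq_rpow, one_div, one_div]
  rw [er]
  set Z := ∫ x : Fin n → ℝ, Real.exp (β * (∑ i, x i) ^ 2 / (2 * n))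
    ∂(Measure.pi fun _ : Fin n => ρ) with hZ
  have Z0 : 0 < Z := integral_exp_pos hi
  rw [← ofReal_integral_eq_lintegral_ofReal hi (ae_of_all _ fun x => by positivity), ← hZ] at h'
  refine (le_abs_self _).trans ?_
  rw [← Real.norm_eq_abs]
  refine (ENNReal.ofReal_le_ofReal_iff (by positivity)).1 ?_
  rw [ofReal_norm_eq_enorm]
  refine (enorm_integral_le_lintegral_enorm _).trans ?_
  unfold cwMeasure
  rw [lintegral_withDensity_eq_lintegral_mul_non_measurable _ (by fun_prop)
    (ae_of_all _ fun x => ENNReal.ofReal_lt_top)]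
  have e : ∀ x : Fin n → ℝ, ENNReal.ofReal (Real.exp (β * (∑ i, x i) ^ 2 / (2 * n)) / Z) =
      (ENNReal.ofReal Z)⁻¹ * ENNReal.ofReal (Real.exp (β * (∑ i, x i) ^ 2 / (2 * n))) := by
    intro x
    rw [ENNReal.ofReal_div_of_pos Z0, ENNReal.div_eq_inv_mul]
  have Zne : ENNReal.ofReal Z ≠ 0 := by simpa using Z0
  simp only [Pi.mul_apply, Real.enorm_eq_ofReal_abs, abs_abs]
  simp_rw [← hZ, e, mul_assoc]
  rw [lintegral_const_mul' _ _ (ENNReal.inv_ne_top.2 Zne)]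
  refine (mul_le_mul_right h' _).trans (le_of_eq ?_)
  rw [mul_comm, mul_assoc, ENNReal.mul_inv_cancel Zne ENNReal.ofReal_ne_top, mul_one]

end final

end CW

/-- Proposition 5.3.  For the Gibbs-sampler exchangeable pair
`(Sₙ, Sₙ')` of the Curie–Weiss model with `0 < β ≤ 1` (under the subcritical mgf bound
when `β < 1`, or the type-`k` critical mgf bounds when `β = 1`), the conditional
expectation `E((Sₙ - Sₙ')|Sₙ - Sₙ'| ∣ 𝒳)(x) = (1/n) ∑ᵢ E((xᵢ - Xᵢ')|xᵢ - Xᵢ'| ∣ 𝒳)`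
satisfies `E|E((Sₙ - Sₙ')|Sₙ - Sₙ'| ∣ 𝒳)| ≤ C n^{-1/2}`. -/
theorem curie_weiss_gibbs_antisymmetric_bound
    (ρ : Measure ℝ) [IsProbabilityMeasure ρ]
    (hmean : ∫ x, x ∂ρ = 0) (hvar : ∫ x, x ^ 2 ∂ρ = 1)
    (β : ℝ) (hβ0 : 0 < β) (hβ1 : β ≤ 1)
    (hcase :
      (β < 1 ∧ ∃ b : ℝ, β < b ∧
        ∀ t : ℝ, ∫ x, Real.exp (t * x) ∂ρ ≤ Real.exp (t ^ 2 / (2 * b))) ∨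
      (β = 1 ∧ ∃ (k : ℕ) (lamρ b₀ b₁ b₂ : ℝ), 1 ≤ k ∧ 0 < lamρ ∧
        (∀ j : ℕ, j < 2 * k →
          (∫ x, x ^ j ∂(ProbabilityTheory.gaussianReal 0 1)) - ∫ x, x ^ j ∂ρ = 0) ∧
        ((∫ x, x ^ (2 * k) ∂(ProbabilityTheory.gaussianReal 0 1)) -
          ∫ x, x ^ (2 * k) ∂ρ = lamρ) ∧
        0 < b₀ ∧ 0 < b₁ ∧ 1 < b₂ ∧
        (∀ t : ℝ, |t| ≤ b₀ →
          ∫ x, Real.exp (t * x) ∂ρ ≤ Real.exp (t ^ 2 / 2 - b₁ * t ^ (2 * k))) ∧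
        (∀ t : ℝ, b₀ < |t| →
          ∫ x, Real.exp (t * x) ∂ρ ≤ Real.exp (t ^ 2 / (2 * b₂))))) :
    ∃ C : ℝ, 0 < C ∧
      ∀ n : ℕ, 0 < n →
        (∫ x, |(1 / (n : ℝ)) *
            (∑ i, cwCondMoment ρ β n
              (fun y => (x i - y) * |x i - y|) (((∑ j, x j) - x i) / n))|
          ∂(cwMeasure ρ β n)) ≤ C * (n : ℝ) ^ (-(1 / 2) : ℝ) := by
  have hsq : Integrable (fun x => x ^ 2) ρ := by
    by_contra h
    rw [integral_undef h] at hvar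
    exact zero_ne_one hvar
  have hid : Integrable (fun x : ℝ => x) ρ := by
    refine ((integrable_const (1 : ℝ)).add hsq).mono' measurable_id.aestronglyMeasurable
      (ae_of_all _ fun x => ?_)
    simp only [id, Real.norm_eq_abs, Pi.add_apply]
    rw [← sq_abs]
    nlinarith [sq_nonneg (|x| - 1), abs_nonneg x]
  by_cases H : ∀ t : ℝ, Integrable (fun x => Real.exp (t * x)) ρ
  swap
  · refine ⟨1, one_pos, fun n hn => ?_⟩
    have : cwMeasure ρ β n = 0 := CW.cw_zero fun h => H (CW.exp_of_cw hβ0 hn h)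
    rw [this, integral_zero_measure]
    positivity
  obtain ⟨R, δ, hR, hδ0, hδ1, tail⟩ : ∃ R δ : ℝ, 0 ≤ R ∧ 0 < δ ∧ δ < 1 ∧ ∀ m : ℝ, R < |m| →
      ∫ x, Real.exp (β * m * x) ∂ρ ≤ Real.exp (β * m ^ 2 * (1 - δ) / 2) := by
    rcases hcase with ⟨_, b, hb, hM⟩ | ⟨rfl, k, lam, b₀, b₁, b₂, _, _, _, _, hb0, _, hb2, _, hM⟩
    · have hb' : 0 < b := hβ0.trans hb
      refine ⟨0, 1 - β / b, le_rfl, ?_, ?_, fun m _ => ?_⟩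
      · rw [sub_pos, div_lt_one hb']; exact hb
      · have : 0 < β / b := by positivity
        linarith
      · refine (hM (β * m)).trans (Real.exp_le_exp.2 (le_of_eq ?_))
        field_simp
        ring
    · refine ⟨b₀, 1 - 1 / b₂, hb0.le, ?_, ?_, fun m hm => ?_⟩
      · rw [sub_pos, div_lt_one (by linarith)]; exact hb2
      · have : 0 < 1 / b₂ := by positivity
        linarith
      · rw [one_mul]
        refine (hM m hm).trans (Real.exp_le_exp.2 (le_of_eq ?_))
        field_simp
        ring
  refine CW.final (R := R) (δ := δ) (c := β / (1 - δ / 2))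
    ⟨hβ0, hβ1, hmean, hid, H, hR, hδ0, tail, ?_, CW.exp_sq hβ0 H hR hδ0 hδ1 tail⟩
  rw [lt_div_iff₀ (by linarith)]
  nlinarith
end
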